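/- Let F be a field of characteristic p > 0, b ∈ F∖F^p, and let E = F(b^{1/p^e}) be the simple purely inseparable extension of exponent e. Then H_p^{n+1}(E/F) = Σ_{t=0}^{e−1} Σ_{1 ≤ j ≤ p^t, gcd(j,p)=1} (image of b^j·(dΩ_F^{n-1})^{[p^t]} in H_p^{n+1}(F)). -/

import Mathlib

noncomputable section

/-- The full algebra of absolute differential forms of a field `F`:
the exterior algebra of the `F`-module of absolute Kähler differentials `Ω[F⁄ℤ]`. -/
abbrev DF (F : Type*) [Field F] : Type _ :=
  ExteriorAlgebra F (KaehlerDifferential ℤ F)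

/-- `Ω_F^n`, the space of differential `n`-forms, as a submodule of `DF F`. -/
def omegaPow (F : Type*) [Field F] (n : ℕ) : Submodule F (DF F) :=
  LinearMap.range (ExteriorAlgebra.ι F :
    KaehlerDifferential ℤ F →ₗ[F] DF F) ^ n

/-- `Ω_F^{n-1}`, with the convention `Ω_F^{-1} = 0`. -/
def omegaPred (F : Type*) [Field F] : ℕ → Submodule F (DF F)
  | 0 => ⊥
  | n + 1 => omegaPow F n

/-- The exact 1-form `d a` of an element `a ∈ F`. -/
def dForm (F : Type*) [Field F] (a : F) : DF F :=
  ExteriorAlgebra.ι F (KaehlerDifferential.D ℤ F a)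

/-- The logarithmic 1-form `da/a` of an element `a ∈ F`. -/
def dLog (F : Type*) [Field F] (a : F) : DF F :=
  ExteriorAlgebra.ι F (a⁻¹ • KaehlerDifferential.D ℤ F a)

/-- The logarithmic `n`-form `(dx₁/x₁) ∧ … ∧ (dxₙ/xₙ)`. -/
def logForm (F : Type*) [Field F] {n : ℕ} (x : Fin n → F) : DF F :=
  (List.ofFn fun i => dLog F (x i)).prod

/-- The exterior derivative `d` together with the (`p`-basis dependent) additive map `s_p`
on the differential forms of a field `F` of characteristic `p`. -/
structure DiffStr (p : ℕ) (F : Type*) [Field F] where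
  d : DF F →+ DF F
  sp : DF F →+ DF F
  d_grade : ∀ n : ℕ, ∀ ω ∈ omegaPow F n, d ω ∈ omegaPow F (n + 1)
  d_d : ∀ ω : DF F, d (d ω) = 0
  d_one : d 1 = 0
  d_smul : ∀ (a : F) (ω : DF F), d (a • ω) = dForm F a * ω + a • d ω
  sp_grade : ∀ n : ℕ, ∀ ω ∈ omegaPow F n, sp ω ∈ omegaPow F n
  sp_log : ∀ (n : ℕ) (a : F) (x : Fin n → F),
      ∃ η ∈ omegaPred F n, sp (a • logForm F x) = a ^ p • logForm F x + d η

/-- The Artin–Schreier map `℘ = s_p − id` on differential forms. -/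
def asMap {p : ℕ} {F : Type*} [Field F] (S : DiffStr p F) : DF F →+ DF F :=
  S.sp - AddMonoidHom.id (DF F)

/-- The subgroup `℘Ω_F^n + dΩ_F^{n-1}` of `Ω_F^n`; the group `H_p^{n+1}(F)` is the quotient
of `Ω_F^n` by this subgroup. -/
def hRel {p : ℕ} {F : Type*} [Field F] (S : DiffStr p F) (n : ℕ) : AddSubgroup (DF F) :=
  ((omegaPow F n).toAddSubgroup.map (asMap S)) ⊔ ((omegaPred F n).toAddSubgroup.map S.d)

/-- The `t`-th iterate `v ↦ v^{[p^t]}` of the map `s_p`. -/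
def spIter {p : ℕ} {F : Type*} [Field F] (S : DiffStr p F) (t : ℕ) : DF F → DF F :=
  (fun x => S.sp x)^[t]

/-- `ν_n(F) = ker(℘ : Ω_F^n → Ω_F^n/dΩ_F^{n-1})`. -/
def nuSet {p : ℕ} {F : Type*} [Field F] (S : DiffStr p F) (n : ℕ) : Set (DF F) :=
  { η | η ∈ omegaPow F n ∧ ∃ z ∈ omegaPred F n, S.sp η - η = S.d z }

/-- Restriction of differential forms along a field extension `E/F`. -/
structure DiffRes (p : ℕ) (F E : Type*) [Field F] [Field E] [Algebra F E]
    (SF : DiffStr p F) (SE : DiffStr p E) where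
  res : DF F →+ DF E
  res_one : res 1 = 1
  res_mul : ∀ x y : DF F, res (x * y) = res x * res y
  res_smul : ∀ (a : F) (ω : DF F), res (a • ω) = algebraMap F E a • res ω
  res_dForm : ∀ a : F, res (dForm F a) = dForm E (algebraMap F E a)
  res_grade : ∀ n : ℕ, ∀ ω ∈ omegaPow F n, res ω ∈ omegaPow E n
  res_d : ∀ ω : DF F, res (SF.d ω) = SE.d (res ω)

namespace HK

section PartA
variable {p : ℕ} {F : Type*} [Field F]

lemma dForm_eq (a : F) : dForm F a = a • dLog F a := by
  unfold dForm dLog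
  by_cases h : a = 0
  · subst h; simp
  · rw [← map_smul, smul_smul, mul_inv_cancel₀ h, one_smul]

lemma dLog_eq (a : F) : dLog F a = a⁻¹ • dForm F a := by
  unfold dForm dLog
  rw [map_smul]

lemma dForm_sq (a : F) : dForm F a * dForm F a = 0 := by
  unfold dForm
  exact ExteriorAlgebra.ι_sq_zero _

lemma dForm_mul' (a c : F) : dForm F (a * c) = a • dForm F c + c • dForm F a := by
  unfold dForm
  rw [Derivation.leibniz, map_add, map_smul, map_smul]

lemma dForm_pow_char [CharP F p] (a : F) : dForm F (a ^ p) = 0 := by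
  unfold dForm
  rw [Derivation.leibniz_pow]
  rw [← Nat.cast_smul_eq_nsmul F p, CharP.cast_eq_zero, zero_smul, map_zero]

variable (S : DiffStr p F)

lemma d_dForm_mul (a : F) (ω : DF F) : S.d (dForm F a * ω) = - (dForm F a * S.d ω) := by
  have h := S.d_d (a • ω)
  rw [S.d_smul, map_add, S.d_smul, S.d_d, smul_zero, add_zero] at h
  exact eq_neg_of_add_eq_zero_left h

lemma d_dLog_mul (a : F) (ω : DF F) : S.d (dLog F a * ω) = - (dLog F a * S.d ω) := by
  rw [dLog_eq, smul_mul_assoc, S.d_smul, d_dForm_mul]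
  have : dForm F a⁻¹ = (-a⁻¹ ^ 2) • dForm F a := by
    unfold dForm
    rw [Derivation.leibniz_inv, map_smul]
  rw [this, smul_mul_assoc, ← mul_assoc, dForm_sq, zero_mul, smul_zero, zero_add, smul_neg,
    smul_mul_assoc]

lemma d_smul_pow [CharP F p] (a : F) (ω : DF F) : S.d (a ^ p • ω) = a ^ p • S.d ω := by
  rw [S.d_smul, dForm_pow_char, zero_mul, zero_add]

lemma range_ι_eq : LinearMap.range (ExteriorAlgebra.ι F : KaehlerDifferential ℤ F →ₗ[F] DF F)
    = Submodule.span F (Set.range (dLog F)) := by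
  apply le_antisymm
  · rw [LinearMap.range_eq_map, ← KaehlerDifferential.span_range_derivation, Submodule.map_span,
      Submodule.span_le]
    rintro _ ⟨_, ⟨a, rfl⟩, rfl⟩
    have : ExteriorAlgebra.ι F (KaehlerDifferential.D ℤ F a) = a • dLog F a := dForm_eq a
    rw [this]
    exact Submodule.smul_mem _ _ (Submodule.subset_span ⟨a, rfl⟩)
  · rw [Submodule.span_le]
    rintro _ ⟨a, rfl⟩
    exact ⟨_, rfl⟩

lemma omegaPow_eq (n : ℕ) : omegaPow F n =
    Submodule.span F (Set.range (fun x : Fin n → F => logForm F x)) := by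
  unfold omegaPow
  rw [range_ι_eq, Submodule.span_pow]
  congr 1
  ext y
  rw [Set.mem_pow]
  constructor
  · rintro ⟨f, rfl⟩
    choose g hg using fun i => (f i).2
    exact ⟨g, by simp [logForm, hg]⟩
  · rintro ⟨x, rfl⟩
    exact ⟨fun i => ⟨dLog F (x i), x i, rfl⟩, rfl⟩

@[elab_as_elim]
lemma omegaPow_induction {n : ℕ} {P : DF F → Prop} (h0 : P 0)
    (hadd : ∀ x y, P x → P y → P (x + y))
    (hlog : ∀ (a : F) (x : Fin n → F), P (a • logForm F x)) (ω : DF F)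
    (hω : ω ∈ omegaPow F n) : P ω := by
  rw [omegaPow_eq, Finsupp.mem_span_range_iff_exists_finsupp] at hω
  obtain ⟨c, rfl⟩ := hω
  unfold Finsupp.sum
  exact Finset.sum_induction _ P hadd h0 (fun x _ => hlog _ _)

lemma logForm_mem {n : ℕ} (x : Fin n → F) : logForm F x ∈ omegaPow F n := by
  rw [omegaPow_eq]; exact Submodule.subset_span ⟨x, rfl⟩

lemma logForm_cons {n : ℕ} (c : F) (x : Fin n → F) :
    logForm F (Fin.cons c x) = dLog F c * logForm F x := by
  simp [logForm, List.ofFn_succ]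

lemma dLog_mem_range (c : F) : dLog F c ∈ LinearMap.range (ExteriorAlgebra.ι F :
    KaehlerDifferential ℤ F →ₗ[F] DF F) := ⟨_, rfl⟩

lemma dLog_mul_mem {n : ℕ} (c : F) {ω : DF F} (h : ω ∈ omegaPow F n) :
    dLog F c * ω ∈ omegaPow F (n + 1) := by
  unfold omegaPow
  rw [pow_succ']
  exact Submodule.mul_mem_mul (dLog_mem_range c) h

lemma dLog_mul_mem_pred {n : ℕ} (c : F) {ω : DF F} (h : ω ∈ omegaPred F n) :
    dLog F c * ω ∈ omegaPow F n := by
  cases n with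
  | zero =>
    have : ω = 0 := by simpa [omegaPred] using h
    subst this; rw [mul_zero]; exact zero_mem _
  | succ n => exact dLog_mul_mem c h

lemma d_mem_pred {n : ℕ} {ω : DF F} (h : ω ∈ omegaPred F n) : S.d ω ∈ omegaPow F n := by
  cases n with
  | zero =>
    have : ω = 0 := by simpa [omegaPred] using h
    subst this; rw [map_zero]; exact zero_mem _
  | succ n => exact S.d_grade _ _ h

lemma sp_smul [CharP F p] {n : ℕ} (a : F) (ω : DF F) (h : ω ∈ omegaPow F n) :
    ∃ η ∈ omegaPred F n, S.sp (a • ω) = a ^ p • S.sp ω + S.d η := by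
  refine omegaPow_induction ?_ ?_ ?_ ω h
  · exact ⟨0, zero_mem _, by simp⟩
  · rintro x y ⟨η, hη, e⟩ ⟨η', hη', e'⟩
    refine ⟨η + η', add_mem hη hη', ?_⟩
    rw [smul_add, map_add, map_add, map_add, e, e', smul_add]; abel
  · intro c x
    obtain ⟨η, hη, e⟩ := S.sp_log n (a * c) x
    obtain ⟨η', hη', e'⟩ := S.sp_log n c x
    refine ⟨η - a ^ p • η', sub_mem hη (Submodule.smul_mem _ _ hη'), ?_⟩
    rw [smul_smul, e, e', map_sub, d_smul_pow, smul_add, smul_smul, mul_pow]; abel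

lemma sp_dLog {n : ℕ} (c : F) (ω : DF F) (h : ω ∈ omegaPow F n) :
    ∃ η ∈ omegaPow F n, S.sp (dLog F c * ω) = dLog F c * S.sp ω + S.d η := by
  refine omegaPow_induction ?_ ?_ ?_ ω h
  · exact ⟨0, zero_mem _, by simp⟩
  · rintro x y ⟨η, hη, e⟩ ⟨η', hη', e'⟩
    refine ⟨η + η', add_mem hη hη', ?_⟩
    rw [mul_add, map_add, map_add, map_add, e, e', mul_add]; abel
  · intro a x
    obtain ⟨η, hη, e⟩ := S.sp_log (n + 1) a (Fin.cons c x)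
    obtain ⟨η', hη', e'⟩ := S.sp_log n a x
    refine ⟨η + dLog F c * η', add_mem hη (dLog_mul_mem_pred _ hη'), ?_⟩
    rw [mul_smul_comm, ← logForm_cons, e, e', map_add, d_dLog_mul, mul_add, mul_smul_comm,
      logForm_cons]; abel

lemma spIter_zero (x : DF F) : spIter S 0 x = x := rfl

lemma spIter_succ (t : ℕ) (x : DF F) : spIter S (t + 1) x = S.sp (spIter S t x) :=
  Function.iterate_succ_apply' _ _ _

lemma spIter_succ' (t : ℕ) (x : DF F) : spIter S (t + 1) x = spIter S t (S.sp x) := rfl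

lemma spIter_add (t : ℕ) (x y : DF F) : spIter S t (x + y) = spIter S t x + spIter S t y := by
  induction t with
  | zero => rfl
  | succ t ih => rw [spIter_succ, ih, map_add, ← spIter_succ, ← spIter_succ]

lemma spIter_map_zero (t : ℕ) : spIter S t 0 = 0 := by
  induction t with
  | zero => rfl
  | succ t ih => rw [spIter_succ, ih, map_zero]

lemma spIter_neg (t : ℕ) (x : DF F) : spIter S t (-x) = - spIter S t x := by
  have := spIter_add S t x (-x)
  rw [add_neg_cancel, spIter_map_zero] at this
  exact (neg_eq_of_add_eq_zero_right this.symm).symm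

lemma spIter_sub (t : ℕ) (x y : DF F) : spIter S t (x - y) = spIter S t x - spIter S t y := by
  rw [sub_eq_add_neg, spIter_add, spIter_neg, ← sub_eq_add_neg]

lemma spIter_mem {n : ℕ} (t : ℕ) {x : DF F} (h : x ∈ omegaPow F n) :
    spIter S t x ∈ omegaPow F n := by
  induction t with
  | zero => exact h
  | succ t ih => rw [spIter_succ]; exact S.sp_grade _ _ ih

lemma mem_hRel_d {n : ℕ} {η : DF F} (h : η ∈ omegaPred F n) : S.d η ∈ hRel S n :=
  AddSubgroup.mem_sup_right ⟨η, h, rfl⟩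

lemma mem_hRel_as {n : ℕ} {x : DF F} (h : x ∈ omegaPow F n) : S.sp x - x ∈ hRel S n :=
  AddSubgroup.mem_sup_left ⟨x, h, rfl⟩

lemma mem_hRel_iff {n : ℕ} {x : DF F} : x ∈ hRel S n ↔
    ∃ u ∈ omegaPow F n, ∃ v ∈ omegaPred F n, x = S.sp u - u + S.d v := by
  constructor
  · intro h
    obtain ⟨_, ⟨u, hu, rfl⟩, _, ⟨v, hv, rfl⟩, rfl⟩ := AddSubgroup.mem_sup.1 h
    exact ⟨u, hu, v, hv, rfl⟩
  · rintro ⟨u, hu, v, hv, rfl⟩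
    exact add_mem (mem_hRel_as S hu) (mem_hRel_d S hv)

/-- a subgroup `N` which is closed under `sp`-correction terms: general expansion. -/
lemma spIter_smul [CharP F p] {n : ℕ} (N : AddSubgroup (DF F)) (t : ℕ) (a k : F) (ω : DF F)
    (h : ω ∈ omegaPow F n)
    (hN : ∀ i < t, ∀ η ∈ omegaPred F n, k • spIter S i (S.d η) ∈ N) :
    k • spIter S t (a • ω) - (k * a ^ p ^ t) • spIter S t ω ∈ N := by
  induction t generalizing ω a with
  | zero => simp [spIter_zero, smul_smul]
  | succ t ih =>
    obtain ⟨η, hη, e⟩ := sp_smul S a ω h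
    have h1 := ih (a ^ p) (S.sp ω) (S.sp_grade _ _ h) (fun i hi => hN i (by omega))
    have h2 := hN t (by omega) η hη
    rw [spIter_succ', e, spIter_add, smul_add, spIter_succ']
    have h3 : (a ^ p) ^ p ^ t = a ^ p ^ (t + 1) := by rw [← pow_mul, pow_succ']
    rw [h3] at h1
    convert add_mem h1 h2 using 1
    abel

lemma spIter_dLog {n : ℕ} (N : AddSubgroup (DF F)) (t : ℕ) (c k : F) (ω : DF F)
    (h : ω ∈ omegaPow F n)
    (hN : ∀ i < t, ∀ η ∈ omegaPow F n, k • spIter S i (S.d η) ∈ N) :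
    k • spIter S t (dLog F c * ω) - k • (dLog F c * spIter S t ω) ∈ N := by
  induction t generalizing ω with
  | zero => simp [spIter_zero]
  | succ t ih =>
    obtain ⟨η, hη, e⟩ := sp_dLog S c ω h
    have h1 := ih (S.sp ω) (S.sp_grade _ _ h) (fun i hi => hN i (by omega))
    have h2 := hN t (by omega) η hη
    rw [spIter_succ', e, spIter_add, smul_add, spIter_succ']
    convert add_mem h1 h2 using 1
    abel

/-- The right-hand side group. -/
def KK (b : F) (e n : ℕ) : AddSubgroup (DF F) :=
  AddSubgroup.closure ((hRel S n : Set (DF F)) ∪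
      { x | ∃ t j : ℕ, t < e ∧ 1 ≤ j ∧ j ≤ p ^ t ∧ Nat.Coprime j p ∧
          ∃ v ∈ omegaPred F n, x = b ^ j • spIter S t (S.d v) })

variable {S}
lemma hRel_le_KK {b : F} {e n : ℕ} {x : DF F} (h : x ∈ hRel S n) : x ∈ KK S b e n :=
  AddSubgroup.subset_closure (Or.inl h)

lemma gen_mem_KK {b : F} {e n t j : ℕ} (ht : t < e) (hj : 1 ≤ j) (hj2 : j ≤ p ^ t)
    (hc : Nat.Coprime j p) {v : DF F} (hv : v ∈ omegaPred F n) :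
    b ^ j • spIter S t (S.d v) ∈ KK S b e n :=
  AddSubgroup.subset_closure (Or.inr ⟨t, j, ht, hj, hj2, hc, v, hv, rfl⟩)

lemma lemmaB {b : F} (hb : b ≠ 0) {e n : ℕ} (he : 0 < e) {z : DF F} (hz : z ∈ omegaPred F n) :
    dLog F b * z ∈ KK S b e n := by
  have h1 : S.d z ∈ KK S b e n := hRel_le_KK (mem_hRel_d S hz)
  have h2 := gen_mem_KK (S := S) (b := b) he le_rfl (by simp) (by simp)
    (Submodule.smul_mem _ b⁻¹ hz)
  rw [pow_one, spIter_zero, S.d_smul, smul_add, smul_smul, mul_inv_cancel₀ hb, one_smul] at h2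
  have : dForm F b⁻¹ = (-b⁻¹ ^ 2) • dForm F b := by
    unfold dForm
    rw [Derivation.leibniz_inv, map_smul]
  rw [this, dForm_eq, smul_smul, smul_mul_assoc, smul_smul] at h2
  have h3 : b * (-b⁻¹ ^ 2 * b) = -1 := by field_simp
  rw [h3, neg_one_smul] at h2
  convert sub_mem h1 h2 using 1
  abel

lemma lemmaA [CharP F p] (hp : p.Prime) {b : F} (hb : b ≠ 0) {e n : ℕ} (l : ℕ) (hl : l < e) (j : ℕ)
    (η : DF F) (hη : η ∈ omegaPred F n) : b ^ j • spIter S l (S.d η) ∈ KK S b e n := by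
  have he : 0 < e := by omega
  induction l using Nat.strong_induction_on generalizing j η with
  | _ l ih =>
  induction j using Nat.strong_induction_on generalizing η with
  | _ j ihj =>
  have step : p ^ l < j → b ^ j • spIter S l (S.d η) ∈ KK S b e n := by
    intro hj
    obtain ⟨k, rfl⟩ : ∃ k, j = k + p ^ l := ⟨j - p ^ l, by omega⟩
    have hpl : 0 < p ^ l := pow_pos hp.pos _
    have hN : ∀ i < l, ∀ η ∈ omegaPred F n, b ^ k • spIter S i (S.d η) ∈ KK S b e n :=
      fun i hi η hη => ih i hi (by omega) k η hη
    have h1 := spIter_smul S (KK S b e n) l b (b ^ k) (S.d η) (d_mem_pred S hη) hN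
    have h2 : b • S.d η = S.d (b • η) - b • (dLog F b * η) := by
      rw [S.d_smul, dForm_eq, smul_mul_assoc]; abel
    rw [h2, spIter_sub, smul_sub] at h1
    have h3 := ihj k (by omega) (b • η) (Submodule.smul_mem _ _ hη)
    have h4 : b ^ k • spIter S l (b • (dLog F b * η)) ∈ KK S b e n := by
      cases n with
      | zero =>
        have : η = 0 := by simpa [omegaPred] using hη
        subst this
        simp only [mul_zero, smul_zero, spIter_map_zero]; exact zero_mem _
      | succ n =>
        have h5 := spIter_dLog S (KK S b e (n+1)) l b (b ^ k) (b • η)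
          (Submodule.smul_mem _ _ hη) hN
        rw [mul_smul_comm] at h5
        have h6 : b ^ k • (dLog F b * spIter S l (b • η)) ∈ KK S b e (n+1) := by
          rw [← mul_smul_comm]
          exact lemmaB hb he (Submodule.smul_mem _ _ (spIter_mem S l (Submodule.smul_mem _ _ hη)))
        convert add_mem h5 h6 using 1
        abel
    rw [pow_add]
    convert sub_mem (sub_mem h3 h4) h1 using 1
    abel
  by_cases hj : p ^ l < j
  · exact step hj
  by_cases hc : Nat.Coprime j p
  · have : 1 ≤ j := by
      rcases Nat.eq_zero_or_pos j with rfl | h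
      · rw [Nat.coprime_zero_left] at hc; exact absurd hc hp.ne_one
      · exact h
    exact gen_mem_KK hl this (not_lt.1 hj) hc hη
  · have : p ∣ j := by
      rw [Nat.coprime_comm] at hc
      by_contra h
      exact hc ((Nat.Prime.coprime_iff_not_dvd hp).2 h)
    obtain ⟨k, rfl⟩ := this
    cases l with
    | zero =>
      rw [spIter_zero, mul_comm, pow_mul, ← d_smul_pow]
      exact hRel_le_KK (mem_hRel_d S (Submodule.smul_mem _ _ hη))
    | succ l =>
      have h1 := ih l (by omega) (by omega) k η hη
      have hm : spIter S l (S.d η) ∈ omegaPow F n := spIter_mem S l (d_mem_pred S hη)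
      obtain ⟨ζ, hζ, e1⟩ := sp_smul S (b ^ k) _ hm
      have h2 : S.sp (b ^ k • spIter S l (S.d η)) - b ^ k • spIter S l (S.d η) ∈ KK S b e n :=
        hRel_le_KK (mem_hRel_as S (Submodule.smul_mem _ _ hm))
      have h3 : S.d ζ ∈ KK S b e n := hRel_le_KK (mem_hRel_d S hζ)
      rw [e1, ← spIter_succ, ← pow_mul, mul_comm k p] at h2
      convert sub_mem (add_mem h2 h1) h3 using 1
      abel

end PartA

section Easy
variable {p : ℕ} {F E : Type*} [Field F] [Field E] [Algebra F E]
  {SF : DiffStr p F} {SE : DiffStr p E} (R : DiffRes p F E SF SE)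

lemma res_dLog (a : F) : R.res (dLog F a) = dLog E (algebraMap F E a) := by
  rw [dLog_eq, dLog_eq, R.res_smul, R.res_dForm, map_inv₀]

lemma res_logForm {n : ℕ} (x : Fin n → F) :
    R.res (logForm F x) = logForm E (fun i => algebraMap F E (x i)) := by
  induction n with
  | zero => simp [logForm, R.res_one]
  | succ n ih =>
    simp only [logForm, List.ofFn_succ, List.prod_cons, R.res_mul, res_dLog] at ih ⊢
    rw [ih]

lemma res_pred {n : ℕ} {ω : DF F} (h : ω ∈ omegaPred F n) : R.res ω ∈ omegaPred E n := by
  cases n with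
  | zero =>
    have : ω = 0 := by simpa [omegaPred] using h
    subst this; rw [map_zero]; exact zero_mem _
  | succ n => exact R.res_grade _ _ h

lemma res_sp {n : ℕ} (ω : DF F) (h : ω ∈ omegaPow F n) :
    ∃ η ∈ omegaPred E n, R.res (SF.sp ω) = SE.sp (R.res ω) + SE.d η := by
  refine omegaPow_induction ?_ ?_ ?_ ω h
  · exact ⟨0, zero_mem _, by simp⟩
  · rintro x y ⟨η, hη, e⟩ ⟨η', hη', e'⟩
    refine ⟨η + η', add_mem hη hη', ?_⟩
    simp only [map_add, e, e']; abel
  · intro a x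
    obtain ⟨η, hη, e⟩ := SF.sp_log n a x
    obtain ⟨η', hη', e'⟩ := SE.sp_log n (algebraMap F E a) (fun i => algebraMap F E (x i))
    refine ⟨R.res η - η', sub_mem (res_pred R hη) hη', ?_⟩
    rw [e, map_add, R.res_smul, R.res_smul, res_logForm, e', map_sub, R.res_d, map_pow]; abel

lemma res_hRel {n : ℕ} {ω : DF F} (h : ω ∈ hRel SF n) : R.res ω ∈ hRel SE n := by
  obtain ⟨u, hu, v, hv, rfl⟩ := (mem_hRel_iff SF).1 h
  obtain ⟨η, hη, e⟩ := res_sp R u hu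
  rw [map_add, map_sub, e, R.res_d]
  have h1 := mem_hRel_as SE (R.res_grade _ _ hu)
  have h2 := mem_hRel_d SE hη
  have h3 := mem_hRel_d SE (res_pred R hv)
  convert add_mem (add_mem h1 h2) h3 using 1
  abel

lemma pow_spIter_mem_hRel [CharP E p] {n : ℕ} (i : ℕ) (γ : E) (η : DF E) (hη : η ∈ omegaPred E n) :
    γ ^ p ^ (i + 1) • spIter SE i (SE.d η) ∈ hRel SE n := by
  induction i with
  | zero =>
    rw [zero_add, pow_one, spIter_zero, ← d_smul_pow]
    exact mem_hRel_d SE (Submodule.smul_mem _ _ hη)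
  | succ i ih =>
    have hm : spIter SE i (SE.d η) ∈ omegaPow E n := spIter_mem SE i (d_mem_pred SE hη)
    obtain ⟨ζ, hζ, e1⟩ := sp_smul SE (γ ^ p ^ (i + 1)) _ hm
    have h2 := mem_hRel_as SE (Submodule.smul_mem _ (γ ^ p ^ (i + 1)) hm)
    have h3 := mem_hRel_d SE hζ
    rw [e1, ← spIter_succ, ← pow_mul, ← pow_succ] at h2
    convert sub_mem (add_mem h2 ih) h3 using 1
    abel

lemma res_spIter {n : ℕ} (N : AddSubgroup (DF E)) (k : E) (t : ℕ)
    (hN : ∀ i < t, ∀ η ∈ omegaPred E n, k • spIter SE i (SE.d η) ∈ N)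
    (ω : DF F) (h : ω ∈ omegaPow F n) :
    k • R.res (spIter SF t ω) - k • spIter SE t (R.res ω) ∈ N := by
  induction t generalizing ω with
  | zero => simp [spIter_zero]
  | succ t ih =>
    obtain ⟨η, hη, e⟩ := res_sp R ω h
    have h1 := ih (fun i hi => hN i (by omega)) (SF.sp ω) (SF.sp_grade _ _ h)
    have h2 := hN t (by omega) η hη
    rw [e, spIter_add, smul_add] at h1
    rw [spIter_succ', spIter_succ']
    convert add_mem h1 h2 using 1
    abel

lemma easy [CharP E p] {b : F} {e : ℕ} {β : E} (hβ : β ^ p ^ e = algebraMap F E b) {n : ℕ}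
    {ω : DF F} (h : ω ∈ KK SF b e n) : R.res ω ∈ hRel SE n := by
  have key : KK SF b e n ≤ (hRel SE n).comap R.res := by
    unfold KK
    rw [AddSubgroup.closure_le]
    rintro x (hx | ⟨t, j, ht, hj, hj2, hc, v, hv, rfl⟩)
    · exact res_hRel R hx
    · change R.res _ ∈ hRel SE n
      have hN : ∀ i < e, ∀ η ∈ omegaPred E n,
          (algebraMap F E (b ^ j)) • spIter SE i (SE.d η) ∈ hRel SE n := by
        intro i hi η hη
        have : algebraMap F E (b ^ j) = ((β ^ j) ^ p ^ (e - (i + 1))) ^ p ^ (i + 1) := by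
          rw [map_pow, ← hβ, ← pow_mul, ← pow_mul, ← pow_add, ← pow_mul, mul_comm]
          congr 3; omega
        rw [this]
        exact pow_spIter_mem_hRel i _ η hη
      rw [R.res_smul]
      have h1 := res_spIter R (hRel SE n) (algebraMap F E (b ^ j)) t
        (fun i hi => hN i (by omega)) (SF.d v) (d_mem_pred SF hv)
      have h2 := hN t ht (R.res v) (res_pred R hv)
      rw [R.res_d] at h1
      convert add_mem h1 h2 using 1
      abel
  exact key h

end Easy
end HK

namespace HK

section Jac
variable {A : Type*} [Ring A] {p : ℕ} [hp : Fact p.Prime] [CharP A p]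

lemma choose_neg (m : ℕ) (hm : m < p) : ((p - 1).choose m : A) * (-1) ^ m = 1 := by
  induction m with
  | zero => simp
  | succ m ih =>
    have h1 := ih (by omega)
    have h2 : ((p - 1).choose m : A) + ((p-1).choose (m+1) : A) = 0 := by
      rw [← Nat.cast_add, ← Nat.choose_succ_succ' , Nat.sub_add_cancel hp.out.one_le,
        CharP.cast_eq_zero_iff A p]
      exact hp.out.dvd_choose_self (by omega) hm
    rw [pow_succ, mul_neg_one, mul_neg, ← neg_mul, ← eq_neg_of_add_eq_zero_left h2, h1]

lemma neg_one_pow_pred : (-1 : A) ^ (p - 1) = 1 := by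
  have := choose_neg (A := A) (p := p) (p - 1) (by have := hp.out.pos; omega)
  simpa using this

lemma sum_eq_ad (x y : A) : ∑ i ∈ Finset.range p, x ^ i * y * x ^ (p - 1 - i)
    = (fun z => x * z - z * x)^[p - 1] y := by
  have hc : Commute (LinearMap.mulLeft ℤ x) (-LinearMap.mulRight ℤ x) :=
    (LinearMap.commute_mulLeft_right (R := ℤ) x x).neg_right
  have h := congrArg (fun f : Module.End ℤ A => f y) (hc.add_pow (p - 1))
  have h0 : ∀ n, ((LinearMap.mulLeft ℤ x + -LinearMap.mulRight ℤ x) ^ n) y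
      = (fun z => x * z - z * x)^[n] y := by
    intro n
    rw [Module.End.pow_apply]
    congr 1
    funext z
    simp [sub_eq_add_neg]
  simp only [h0] at h
  rw [h, Nat.sub_add_cancel hp.out.pos, LinearMap.sum_apply]
  refine Finset.sum_congr rfl fun i hi => ?_
  have hi' : i < p := Finset.mem_range.1 hi
  have e1 : (-1 : A) ^ (p - 1 - i) = (-1) ^ i := by
    have h1 : (-1 : A) ^ (p - 1 - i) * (-1) ^ i = 1 := by
      rw [← pow_add, Nat.sub_add_cancel (by omega), neg_one_pow_pred]
    have h2 : (-1 : A) ^ i * (-1) ^ i = 1 := by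
      rw [← pow_add, ← two_mul, pow_mul]; simp
    calc (-1 : A) ^ (p - 1 - i) = (-1 : A) ^ (p - 1 - i) * ((-1 : A) ^ i * (-1) ^ i) := by
          rw [h2, mul_one]
      _ = _ := by rw [← mul_assoc, h1, one_mul]
  have e2 : ((-LinearMap.mulRight ℤ x) ^ (p - 1 - i) : Module.End ℤ A)
      = (-1) ^ (p - 1 - i) * LinearMap.mulRight ℤ (x ^ (p - 1 - i)) := by
    rw [neg_pow, LinearMap.pow_mulRight]
  have e3 : ∀ (n : ℕ) (z : A), ((-1 : Module.End ℤ A) ^ n) z = (-1) ^ n * z := by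
    intro n z
    rcases Nat.even_or_odd n with h | h <;> simp [h.neg_one_pow]
  rw [e2, LinearMap.pow_mulLeft]
  have e4 := choose_neg (A := A) (p := p) i hi'
  simp only [Module.End.mul_apply, e3, LinearMap.mulLeft_apply, LinearMap.mulRight_apply,
    Module.End.natCast_apply]
  have e6 : ∀ z : A, (-1) ^ i * ((p - 1).choose i • z) = z := by
    intro z
    rw [mul_smul_comm, ← smul_mul_assoc, nsmul_eq_mul, e4, one_mul]
  rw [smul_mul_assoc, e1, e6, mul_assoc]

open Polynomial in
lemma deriv_pow (f : A[X]) (n : ℕ) : derivative (f ^ n) =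
    ∑ i ∈ Finset.range n, f ^ i * derivative f * f ^ (n - 1 - i) := by
  induction n with
  | zero => simp
  | succ n ih =>
    rw [pow_succ, derivative_mul, ih, Finset.sum_range_succ, Finset.sum_mul]
    congr 1
    · refine Finset.sum_congr rfl fun i hi => ?_
      have := Finset.mem_range.1 hi
      rw [mul_assoc, ← pow_succ]
      congr 2; omega
    · simp

open Polynomial in
/-- Jacobson's formula in the abelian case. -/
lemma jacobson (x y : A)
    (hc : ∀ k, Commute y ((fun z => x * z - z * x)^[k] y)) :
    (x + y) ^ p = x ^ p + (fun z => x * z - z * x)^[p - 1] y + y ^ p := by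
  set f : A[X] := C x + C y * X with hf
  set w := (fun z => x * z - z * x)^[p - 1] y with hw
  have hder : derivative f = C y := by simp [hf]
  have h1 : derivative (f ^ p) = C w := by
    rw [deriv_pow, hder]
    rw [sum_eq_ad]
    have : ∀ k, (fun z => f * z - z * f)^[k] (C y) = C ((fun z => x * z - z * x)^[k] y) := by
      intro k
      induction k with
      | zero => rfl
      | succ k ih =>
        rw [Function.iterate_succ_apply', ih, Function.iterate_succ_apply']
        set q := (fun z => x * z - z * x)^[k] y with hq
        have h2 : C y * X * C q = C q * (C y * X) := by
          rw [mul_assoc, X_mul_C, ← mul_assoc, ← mul_assoc, ← C_mul, ← C_mul, (hc k).eq]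
        simp only [hf, add_mul, mul_add, h2, C_sub, C_mul]
        abel
    rw [this]
  have hdeg : (f ^ p).natDegree < p + 1 := by
    have h2 : f.natDegree ≤ 1 := by
      rw [hf, add_comm]; exact natDegree_linear_le
    have := natDegree_pow_le_of_le p h2
    omega
  have hcoef0 : (f ^ p).coeff 0 = x ^ p := by
    have := map_pow (constantCoeff : A[X] →+* A) f p
    simpa [hf] using this
  have hcoefp : (f ^ p).coeff p = y ^ p := by
    have : f.natDegree ≤ 1 := by
      rw [hf, add_comm]; exact natDegree_linear_le
    have := coeff_pow_of_natDegree_le (p := f) (m := p) this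
    simpa [hf] using this
  have hp1 : 1 < p := hp.out.one_lt
  have hcoef : ∀ k, 1 < k → k < p → (f ^ p).coeff k = 0 := by
    intro k hk hkp
    have h2 := congrArg (fun g => g.coeff (k - 1)) h1
    simp only [coeff_derivative] at h2
    rw [coeff_C_of_ne_zero (by omega), Nat.sub_add_cancel (by omega)] at h2
    have h3 : ((k - 1 : ℕ) : A) + 1 = (k : A) := by
      rw [← Nat.cast_add_one, Nat.sub_add_cancel (by omega)]
    rw [h3] at h2
    obtain ⟨m, hm⟩ : ∃ m : ℕ, ((k * m : ℕ) : A) = ((1 : ℕ) : A) := by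
      have hcop : Nat.Coprime k p :=
        (Nat.coprime_of_lt_prime (by omega) hkp hp.out).symm
      obtain ⟨m, hm⟩ := Nat.exists_mul_mod_eq_one_of_coprime hcop hp1
      exact ⟨m, (CharP.natCast_eq_natCast A p).2 (by
        rw [Nat.ModEq, hm.2, Nat.mod_eq_of_lt hp1])⟩
    have := congrArg (· * (m : A)) h2
    simpa [mul_assoc, ← Nat.cast_mul, hm] using this
  have hcoef1 : (f ^ p).coeff 1 = w := by
    have h2 := congrArg (fun g => g.coeff 0) h1
    simpa [coeff_derivative] using h2
  have hev : eval 1 (f ^ p) = (x + y) ^ p := by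
    have := map_pow (eval₂RingHom' (RingHom.id A) 1 (fun a => Commute.one_right _)) f p
    have h2 : eval 1 f = x + y := by
      rw [hf, eval_add, eval_mul_X, eval_C, eval_C, mul_one]
    rw [← h2]
    exact this
  rw [← hev, eval_eq_sum_range' hdeg]
  simp only [one_pow, mul_one]
  rw [Finset.sum_range_succ, hcoefp]
  congr 1
  obtain ⟨q, rfl⟩ : ∃ q, p = q + 2 := ⟨p - 2, by omega⟩
  rw [Finset.sum_range_succ', Finset.sum_range_succ', hcoef0, hcoef1]
  rw [Finset.sum_eq_zero, zero_add, add_comm]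
  intro i hi
  exact hcoef _ (by omega) (by have := Finset.mem_range.1 hi; omega)

end Jac

section JacDer
variable {L : Type*} [Field L] {p : ℕ} [hp : Fact p.Prime] [CharP L p] (D : Derivation ℤ L L)

lemma charP_end : CharP (Module.End ℤ L) p := by
  constructor
  intro x
  rw [← CharP.cast_eq_zero_iff L p]
  constructor
  · intro h
    have := congrArg (fun f : Module.End ℤ L => f 1) h
    simpa using this
  · intro h
    ext z
    simp [h]

lemma jac_apply (δ f : L) : (fun z => D z + δ * z)^[p] f
    = (⇑D)^[p] f + ((⇑D)^[p - 1] δ + δ ^ p) * f := by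
  have := charP_end (L := L) (p := p)
  set x : Module.End ℤ L := (D : L →ₗ[ℤ] L) with hx
  have had : ∀ k, (fun z => x * z - z * x)^[k] (LinearMap.mulLeft ℤ δ)
      = LinearMap.mulLeft ℤ ((⇑D)^[k] δ) := by
    intro k
    induction k with
    | zero => rfl
    | succ k ih =>
      rw [Function.iterate_succ_apply', ih, Function.iterate_succ_apply']
      ext z
      simp [hx]
      ring
  have h := jacobson x (LinearMap.mulLeft ℤ δ) (p := p) (by
    intro k
    rw [had]
    ext z
    simp; ring)
  rw [had, LinearMap.pow_mulLeft] at h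
  have h := congrArg (fun g : Module.End ℤ L => g f) h
  simp only [Module.End.pow_apply, LinearMap.add_apply, LinearMap.mulLeft_apply] at h
  rw [add_mul, ← add_assoc]
  exact h

lemma jac_cor1 (hD : ∀ f, (⇑D)^[p] f = D f) (ε : L) (hε : ε ≠ 0) :
    (⇑D)^[p - 1] (D ε / ε) + (D ε / ε) ^ p = D ε / ε := by
  set c := D ε / ε with hc
  have h1 : ∀ n z, ε * (fun z => D z + c * z)^[n] z = (⇑D)^[n] (ε * z) := by
    intro n
    induction n with
    | zero => intro z; rfl
    | succ n ih =>
      intro z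
      rw [Function.iterate_succ_apply, ih, Function.iterate_succ_apply]
      congr 1
      rw [Derivation.leibniz, hc, smul_eq_mul, smul_eq_mul]
      field_simp
  have h2 := h1 p 1
  rw [jac_apply, hD, hD, mul_one, mul_one, D.map_one_eq_zero, zero_add] at h2
  rw [hc, eq_div_iff hε, mul_comm, ← hc, h2]

lemma exists_eig (T : L →+ L) (hT : ∀ f, (⇑T)^[p] f = T f) :
    ∃ (m : ℕ) (x : L), m < p ∧ x ≠ 0 ∧ T x = m * x := by
  let _ := ZMod.algebra L p
  let T' : Module.End (ZMod p) L := T.toZModLinearMap p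
  open Polynomial in
  have key : ∀ (s : Finset (ZMod p)) (v : L), v ≠ 0 →
      aeval T' (∏ a ∈ s, (X - C a)) v = 0 → ∃ (a : ZMod p) (x : L), x ≠ 0 ∧ T' x = a • x := by
    intro s
    induction s using Finset.induction_on with
    | empty =>
      intro v hv h
      simp at h
      exact absurd h hv
    | insert a s ha ih =>
      intro v hv h
      rw [Finset.prod_insert ha, map_mul, Module.End.mul_apply] at h
      by_cases h0 : aeval T' (∏ a ∈ s, (X - C a)) v = 0
      · exact ih v hv h0
      · refine ⟨a, _, h0, ?_⟩
        rw [map_sub, aeval_X, aeval_C, LinearMap.sub_apply, Module.algebraMap_end_apply] at h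
        exact sub_eq_zero.1 h
  obtain ⟨a, x, hx, h⟩ := key Finset.univ 1 one_ne_zero (by
    have : ∏ a : ZMod p, (Polynomial.X - Polynomial.C a) = Polynomial.X ^ p - Polynomial.X := by
      have hr := FiniteField.roots_X_pow_card_sub_X (ZMod p)
      rw [ZMod.card] at hr
      have h3 := Polynomial.prod_multiset_X_sub_C_of_monic_of_roots_card_eq
        (p := (Polynomial.X ^ p - Polynomial.X : Polynomial (ZMod p)))
        (Polynomial.monic_X_pow_sub (by
          rw [Polynomial.degree_X]; exact_mod_cast hp.out.one_lt)) (by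
          rw [hr, FiniteField.X_pow_card_sub_X_natDegree_eq _ hp.out.one_lt, ← Finset.card_def,
            Finset.card_univ, ZMod.card])
      rw [hr] at h3
      exact h3
    rw [this]
    simp only [map_sub, map_pow, Polynomial.aeval_X, LinearMap.sub_apply, Module.End.pow_apply]
    exact sub_eq_zero.2 (hT 1))
  refine ⟨a.val, x, a.val_lt, hx, ?_⟩
  have h2 : T' x = T x := rfl
  rw [← h2, h, Algebra.smul_def]
  congr 1
  conv_lhs => rw [← ZMod.natCast_zmod_val a]
  rw [map_natCast]

lemma jac_cor2 (hD : ∀ f, (⇑D)^[p] f = D f) (g : L) (hg : g ≠ 0) (hgD : D g = g) (δ : L)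
    (hδ : (⇑D)^[p - 1] δ + δ ^ p = δ) : ∃ ε : L, ε ≠ 0 ∧ D ε = δ * ε := by
  let T : L →+ L := (D : L →ₗ[ℤ] L).toAddMonoidHom + AddMonoidHom.mulLeft (-δ)
  have hT : ⇑T = fun z => D z + (-δ) * z := rfl
  have hneg : ∀ n, (⇑D)^[n] (-δ) = - (⇑D)^[n] δ := by
    intro n
    induction n with
    | zero => rfl
    | succ n ih => rw [Function.iterate_succ_apply', ih, map_neg, Function.iterate_succ_apply']
  obtain ⟨m, x, hm, hx, hmx⟩ := exists_eig (p := p) T (by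
    intro f
    rw [hT, jac_apply, hD, hneg, neg_pow, neg_one_pow_char L p]
    linear_combination (-f) * hδ)
  refine ⟨g ^ (p - m) * x, mul_ne_zero (pow_ne_zero _ hg) hx, ?_⟩
  rw [hT] at hmx
  have h1 : D x = δ * x + m * x := by linear_combination hmx
  have h2 : D (g ^ (p - m)) = ((p - m : ℕ) : L) * g ^ (p - m) := by
    rw [Derivation.leibniz_pow, hgD, nsmul_eq_mul, smul_eq_mul, ← pow_succ,
      Nat.sub_add_cancel (by omega)]
  have h3 : ((p - m : ℕ) : L) = - m := by
    rw [Nat.cast_sub hm.le, CharP.cast_eq_zero, zero_sub]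
  rw [Derivation.leibniz, h1, h2, h3, smul_eq_mul, smul_eq_mul]
  ring

end JacDer
end HK

namespace HK

universe u v w

/-- Coordinate model of the exterior algebra on `r` generators; `(x', x'')` stands for
`x' + e_r ∧ x''`. -/
def Frm (L : Type u) : ℕ → Type u
  | 0 => L
  | r + 1 => Frm L r × Frm L r

section FrmBasic
variable {L : Type u} {M : Type v} {N : Type w} [AddCommGroup L] [AddCommGroup M] [AddCommGroup N]

instance Frm.instACG : ∀ r, AddCommGroup (Frm L r)
  | 0 => inferInstanceAs (AddCommGroup L)
  | r + 1 =>
    letI := Frm.instACG r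
    inferInstanceAs (AddCommGroup (Frm L r × Frm L r))

variable {r : ℕ}

def fa : Frm L (r + 1) →+ Frm L r := AddMonoidHom.fst (Frm L r) (Frm L r)
def fb : Frm L (r + 1) →+ Frm L r := AddMonoidHom.snd (Frm L r) (Frm L r)
def fmk (x y : Frm L r) : Frm L (r + 1) := ((x, y) : Frm L r × Frm L r)

@[simp] lemma fa_mk (x y : Frm L r) : fa (fmk x y) = x := rfl
@[simp] lemma fb_mk (x y : Frm L r) : fb (fmk x y) = y := rfl
lemma mk_eta (x : Frm L (r + 1)) : fmk (fa x) (fb x) = x := rfl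
lemma frm_ext {x y : Frm L (r + 1)} (h1 : fa x = fa y) (h2 : fb x = fb y) : x = y := by
  rw [← mk_eta x, ← mk_eta y, h1, h2]

def hmk (f g : M →+ Frm L r) : M →+ Frm L (r + 1) := AddMonoidHom.prod f g
@[simp] lemma fa_hmk (f g : M →+ Frm L r) (x : M) : fa (hmk f g x) = f x := rfl
@[simp] lemma fb_hmk (f g : M →+ Frm L r) (x : M) : fb (hmk f g x) = g x := rfl

def fmap (f : L →+ M) : {r : ℕ} → Frm L r →+ Frm M r
  | 0 => f
  | _ + 1 => hmk ((fmap f).comp fa) ((fmap f).comp fb)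

@[simp] lemma fa_fmap (f : L →+ M) (x : Frm L (r + 1)) : fa (fmap f x) = fmap f (fa x) := rfl
@[simp] lemma fb_fmap (f : L →+ M) (x : Frm L (r + 1)) : fb (fmap f x) = fmap f (fb x) := rfl
lemma fmap_zero' (f : L →+ M) (x : Frm L 0) : fmap f x = f x := rfl

lemma fmap_comp (g : M →+ N) (f : L →+ M) (x : Frm L r) :
    fmap g (fmap f x) = fmap (g.comp f) x := by
  induction r with
  | zero => rfl
  | succ r ih => apply frm_ext <;> simp [ih]

lemma fmap_id (x : Frm L r) : fmap (AddMonoidHom.id L) x = x := by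
  induction r with
  | zero => rfl
  | succ r ih => apply frm_ext <;> simp [ih]

lemma fmap_eq_id {f : L →+ L} (h : ∀ a, f a = a) (x : Frm L r) : fmap f x = x := by
  have : f = AddMonoidHom.id L := by ext a; exact h a
  rw [this, fmap_id]

lemma fmap_add (f g : L →+ M) (x : Frm L r) : fmap (f + g) x = fmap f x + fmap g x := by
  induction r with
  | zero => rfl
  | succ r ih => apply frm_ext <;> simp [ih]

lemma fmap_sub (f g : L →+ M) (x : Frm L r) : fmap (f - g) x = fmap f x - fmap g x := by
  induction r with
  | zero => rfl
  | succ r ih => apply frm_ext <;> simp [ih]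

lemma fmap_zero (x : Frm L r) : fmap (0 : L →+ M) x = 0 := by
  induction r with
  | zero => rfl
  | succ r ih => apply frm_ext <;> simp [ih]

lemma fmap_eq_zero {f : L →+ M} (h : ∀ a, f a = 0) (x : Frm L r) : fmap f x = 0 := by
  have : f = 0 := by ext a; exact h a
  rw [this, fmap_zero]

lemma fmap_congr {f g : L →+ M} (h : ∀ a, f a = g a) (x : Frm L r) : fmap f x = fmap g x := by
  have : f = g := by ext a; exact h a
  rw [this]

lemma fmap_comm {f f' : L →+ L} (h : ∀ a, f (f' a) = f' (f a)) (x : Frm L r) :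
    fmap f (fmap f' x) = fmap f' (fmap f x) := by
  rw [fmap_comp, fmap_comp]; exact fmap_congr h x

lemma fmap_comm' {A B : Type*} [AddCommGroup A] [AddCommGroup B]
    {f : L →+ M} {f' : A →+ L} {g : B →+ M} {g' : A →+ B} (h : ∀ a, f (f' a) = g (g' a))
    (x : Frm A r) : fmap f (fmap f' x) = fmap g (fmap g' x) := by
  rw [fmap_comp, fmap_comp]; exact fmap_congr h x

lemma fmap_inj {f : L →+ M} (h : ∀ a, f a = 0 → a = 0) (x : Frm L r) (hx : fmap f x = 0) :
    x = 0 := by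
  induction r with
  | zero => exact h _ hx
  | succ r ih =>
    apply frm_ext
    · rw [map_zero]; apply ih; rw [← fa_fmap, hx, map_zero]
    · rw [map_zero]; apply ih; rw [← fb_fmap, hx, map_zero]

lemma fmap_lift {I : Type*} {s : Set I} {h : I → L →+ M} {f : N →+ L}
    (hf : ∀ a, (∀ i ∈ s, h i a = 0) → ∃ b, f b = a)
    (x : Frm L r) (hx : ∀ i ∈ s, fmap (h i) x = 0) : ∃ y : Frm N r, fmap f y = x := by
  induction r with
  | zero => exact hf x hx
  | succ r ih =>
    obtain ⟨y1, h1⟩ := ih (fa x) (fun i hi => by rw [← fa_fmap, hx i hi, map_zero])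
    obtain ⟨y2, h2⟩ := ih (fb x) (fun i hi => by rw [← fb_fmap, hx i hi, map_zero])
    exact ⟨fmk y1 y2, by apply frm_ext <;> simp [h1, h2]⟩

/-- exterior derivative in the coordinate model -/
def dd (D : ℕ → L →+ L) : {r : ℕ} → Frm L r →+ Frm L r
  | 0 => 0
  | r + 1 => hmk ((dd D).comp fa) ((fmap (D r)).comp fa - (dd D).comp fb)

@[simp] lemma dd_zero (D : ℕ → L →+ L) (x : Frm L 0) : dd D x = 0 := rfl
@[simp] lemma fa_dd (D : ℕ → L →+ L) (x : Frm L (r + 1)) : fa (dd D x) = dd D (fa x) := rfl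
@[simp] lemma fb_dd (D : ℕ → L →+ L) (x : Frm L (r + 1)) :
    fb (dd D x) = fmap (D r) (fa x) - dd D (fb x) := rfl

lemma fmap_dd {D : ℕ → L →+ L} {D' : ℕ → M →+ M} {f : L →+ M}
    (h : ∀ i < r, ∀ a, f (D i a) = D' i (f a)) (x : Frm L r) :
    fmap f (dd D x) = dd D' (fmap f x) := by
  induction r with
  | zero => simp
  | succ r ih =>
    have ih' := ih (fun i hi => h i (by omega))
    apply frm_ext
    · simp [ih']
    · simp only [fb_fmap, fb_dd, map_sub, ih', fa_fmap]
      congr 1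
      exact fmap_comm' (h r (by omega)) _

lemma dd_dd {D : ℕ → L →+ L} (h : ∀ i < r, ∀ j < r, ∀ a, D i (D j a) = D j (D i a))
    (x : Frm L r) : dd D (dd D x) = 0 := by
  induction r with
  | zero => simp
  | succ r ih =>
    have ih' := ih (fun i hi j hj => h i (by omega) j (by omega))
    apply frm_ext
    · simp [ih']
    · simp only [fb_dd, map_sub, fa_dd, ih', map_zero, sub_zero]
      rw [fmap_dd (D' := D) (fun i hi a => h r (by omega) i (by omega) a), sub_self]

lemma dd_const {D : ℕ → L →+ L} {f : M →+ L} (h : ∀ i < r, ∀ a, D i (f a) = 0) (x : Frm M r) :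
    dd D (fmap f x) = 0 := by
  induction r with
  | zero => simp
  | succ r ih =>
    have ih' := ih (fun i hi => h i (by omega))
    apply frm_ext
    · simp [ih']
    · simp only [fb_dd, fa_fmap, fb_fmap, ih', map_zero, sub_zero]
      rw [fmap_comp]
      exact fmap_eq_zero (h r (by omega)) _

lemma dd_congr {D D' : ℕ → L →+ L} (h : ∀ i < r, ∀ a, D i a = D' i a) (x : Frm L r) :
    dd D x = dd D' x := by
  have := fmap_dd (D := D) (D' := D') (f := AddMonoidHom.id L) h x
  rwa [fmap_id, fmap_id] at this

/-- projection to degree `n` -/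
def proj : {r : ℕ} → ℕ → Frm L r →+ Frm L r
  | 0, 0 => AddMonoidHom.id _
  | 0, _ + 1 => 0
  | _ + 1, 0 => hmk ((proj 0).comp fa) 0
  | _ + 1, n + 1 => hmk ((proj (n + 1)).comp fa) ((proj n).comp fb)

@[simp] lemma fa_proj (n : ℕ) (x : Frm L (r + 1)) : fa (proj n x) = proj n (fa x) := by
  cases n <;> rfl
@[simp] lemma fb_proj_zero (x : Frm L (r + 1)) : fb (proj 0 x) = 0 := rfl
@[simp] lemma fb_proj_succ (n : ℕ) (x : Frm L (r + 1)) : fb (proj (n + 1) x) = proj n (fb x) := rfl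

lemma fmap_proj (f : L →+ M) (n : ℕ) (x : Frm L r) : fmap f (proj n x) = proj n (fmap f x) := by
  induction r generalizing n with
  | zero => cases n <;> simp [proj]
  | succ r ih => cases n <;> apply frm_ext <;> simp [ih]

lemma proj_zero_dd (D : ℕ → L →+ L) (x : Frm L r) : proj 0 (dd D x) = 0 := by
  induction r with
  | zero => rfl
  | succ r ih => apply frm_ext <;> simp [ih]

lemma dd_proj (D : ℕ → L →+ L) (n : ℕ) (x : Frm L r) :
    dd D (proj n x) = proj (n + 1) (dd D x) := by
  induction r generalizing n with
  | zero => simp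
  | succ r ih => cases n <;> apply frm_ext <;> simp [ih, fmap_proj, proj_zero_dd]

lemma proj_proj (n : ℕ) (x : Frm L r) : proj n (proj n x) = proj n x := by
  induction r generalizing n with
  | zero => cases n <;> simp [proj]
  | succ r ih => cases n <;> apply frm_ext <;> simp [ih]

end FrmBasic

section FrmField
variable {L : Type u} {M : Type v} [Field L] [Field M] {r : ℕ}

abbrev mulL (a : L) : L →+ L := AddMonoidHom.mulLeft a

/-- wedge with the 1-form `∑ c_i e_i`. -/
def mm (c : ℕ → L) : {r : ℕ} → Frm L r →+ Frm L r
  | 0 => 0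
  | r + 1 => hmk ((mm c).comp fa) ((fmap (mulL (c r))).comp fa - (mm c).comp fb)

@[simp] lemma mm_zero (c : ℕ → L) (x : Frm L 0) : mm c x = 0 := rfl
@[simp] lemma fa_mm (c : ℕ → L) (x : Frm L (r + 1)) : fa (mm c x) = mm c (fa x) := rfl
@[simp] lemma fb_mm (c : ℕ → L) (x : Frm L (r + 1)) :
    fb (mm c x) = fmap (mulL (c r)) (fa x) - mm c (fb x) := rfl

lemma fmap_mm {c : ℕ → L} {c' : ℕ → M} {f : L →+ M} (h : ∀ i < r, ∀ a, f (c i * a) = c' i * f a)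
    (x : Frm L r) : fmap f (mm c x) = mm c' (fmap f x) := by
  induction r with
  | zero => simp
  | succ r ih =>
    have ih' := ih (fun i hi => h i (by omega))
    apply frm_ext
    · simp [ih']
    · simp only [fb_fmap, fb_mm, map_sub, ih', fa_fmap]
      congr 1
      exact fmap_comm' (h r (by omega)) _

lemma mm_congr {c c' : ℕ → L} (h : ∀ i < r, c i = c' i) (x : Frm L r) : mm c x = mm c' x := by
  have := fmap_mm (c := c) (c' := c') (f := AddMonoidHom.id L)
    (fun i hi a => by simp [h i hi]) x
  rwa [fmap_id, fmap_id] at this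

lemma mm_sub (c c' : ℕ → L) (x : Frm L r) : mm (fun i => c i - c' i) x = mm c x - mm c' x := by
  induction r with
  | zero => simp
  | succ r ih =>
    apply frm_ext
    · simp [ih]
    · have : mulL (c r - c' r) = mulL (c r) - mulL (c' r) := by ext a; simp [sub_mul]
      simp only [fb_mm, ih, map_sub, this, fmap_sub]
      abel

lemma fmap_der_mm {c c' : ℕ → L} {f : L →+ L}
    (h : ∀ i < r, ∀ a, f (c i * a) = c' i * a + c i * f a)
    (x : Frm L r) : fmap f (mm c x) = mm c' x + mm c (fmap f x) := by
  induction r with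
  | zero => simp
  | succ r ih =>
    have ih' := ih (fun i hi => h i (by omega))
    apply frm_ext
    · simp [ih']
    · have e : fmap f (fmap (mulL (c r)) (fa x))
          = fmap (mulL (c' r)) (fa x) + fmap (mulL (c r)) (fmap f (fa x)) := by
        rw [fmap_comp, fmap_comp, ← fmap_add]
        exact fmap_congr (fun a => h r (by omega) a) _
      simp only [fb_fmap, fb_mm, map_sub, ih', fa_fmap, map_add, e]
      abel

variable {D : ℕ → L →+ L}

lemma dd_mul (hl : ∀ i < r, ∀ a b, D i (a * b) = a * D i b + b * D i a) (f : L) (x : Frm L r) :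
    dd D (fmap (mulL f) x) = mm (fun i => D i f) x + fmap (mulL f) (dd D x) := by
  induction r with
  | zero => simp
  | succ r ih =>
    have ih' := ih (fun i hi => hl i (by omega))
    apply frm_ext
    · simp [ih']
    · have e : fmap (D r) (fmap (mulL f) (fa x))
          = fmap (mulL (D r f)) (fa x) + fmap (mulL f) (fmap (D r) (fa x)) := by
        rw [fmap_comp, fmap_comp, ← fmap_add]
        exact fmap_congr (fun a => by simp [hl r (by omega)]; ring) _
      simp only [fb_dd, fa_fmap, fb_fmap, ih', e, map_add, fb_mm, map_sub]
      abel

lemma dd_mm (hl : ∀ i < r, ∀ a b, D i (a * b) = a * D i b + b * D i a) {c : ℕ → L}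
    (hc : ∀ i < r, ∀ j < r, D i (c j) = D j (c i)) (x : Frm L r) :
    dd D (mm c x) = - mm c (dd D x) := by
  induction r with
  | zero => simp
  | succ r ih =>
    have hl' : ∀ i < r, ∀ a b, D i (a * b) = a * D i b + b * D i a := fun i hi => hl i (by omega)
    have ih' := ih hl' (fun i hi j hj => hc i (by omega) j (by omega))
    apply frm_ext
    · simp [ih']
    · have e := fmap_der_mm (f := D r) (c := c) (c' := fun i => D i (c r)) (r := r)
        (fun i hi a => by
          rw [hl r (by omega), hc r (by omega) i (by omega)]; ring) (fa x)
      simp only [fb_dd, fa_mm, fb_mm, map_sub, map_neg, e, dd_mul hl', ih', fa_dd]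
      abel

end FrmField
end HK

namespace HK
universe u

/-- Finite system of commuting logarithmic derivations with dual elements. -/
structure PB (p R : ℕ) (L : Type u) [Field L] where
  D : ℕ → L →+ L
  g : ℕ → L
  leib : ∀ i < R, ∀ a b, D i (a * b) = a * D i b + b * D i a
  comm : ∀ i < R, ∀ j < R, ∀ a, D i (D j a) = D j (D i a)
  pp : ∀ i < R, ∀ a, (⇑(D i))^[p] a = D i a
  gg : ∀ i < R, D i (g i) = g i
  gij : ∀ i < R, ∀ j < R, i ≠ j → D i (g j) = 0
  g0 : ∀ i < R, g i ≠ 0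

lemma exists_ext_der (L : Type u) (L' : Type*) [Field L] [Field L'] [Algebra L L']
    [Algebra.IsSeparable L L'] (D : Derivation ℤ L L) :
    ∃ D' : Derivation ℤ L' L', ∀ a, D' (algebraMap L L' a) = algebraMap L L' (D a) := by
  have := Algebra.FormallyEtale.of_isSeparable L L'
  let φ : KaehlerDifferential ℤ L →ₗ[L] L' :=
    (Algebra.linearMap L L').comp D.liftKaehlerDifferential
  let ψ := (LinearMap.liftBaseChange L' φ).comp
    (KaehlerDifferential.tensorKaehlerEquivOfFormallyEtale ℤ L L').symm.toLinearMap
  refine ⟨ψ.compDer (KaehlerDifferential.D ℤ L'), fun a => ?_⟩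
  change ψ (KaehlerDifferential.D ℤ L' (algebraMap L L' a)) = _
  simp only [ψ, LinearMap.comp_apply, LinearEquiv.coe_coe,
    KaehlerDifferential.tensorKaehlerEquivOfFormallyEtale_symm_D_algebraMap]
  simp [φ]

section
variable {p : ℕ} [hp : Fact p.Prime] {L : Type u} [Field L] [CharP L p] {R : ℕ}

def addDer (D : L →+ L) (h : ∀ a b, D (a * b) = a * D b + b * D a) : Derivation ℤ L L :=
  Derivation.mk' D.toIntLinearMap h

lemma der_pow_p {D : L →+ L} (h : ∀ a b, D (a * b) = a * D b + b * D a) (a : L) :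
    D (a ^ p) = 0 := by
  have := (addDer D h).leibniz_pow a p
  rw [← Nat.cast_smul_eq_nsmul L p, CharP.cast_eq_zero, zero_smul] at this
  exact this

lemma der_mul_pow {D : L →+ L} (h : ∀ a b, D (a * b) = a * D b + b * D a) (a x : L) :
    D (a * x ^ p) = D a * x ^ p := by
  rw [h, der_pow_p h]; ring

lemma trace_pow_p (L' : Type*) [Field L'] [Algebra L L'] [FiniteDimensional L L']
    [Algebra.IsSeparable L L'] (x : L') :
    Algebra.trace L L' (x ^ p) = (Algebra.trace L L' x) ^ p := by
  have : CharP L' p := charP_of_injective_algebraMap (algebraMap L L').injective p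
  let K := AlgebraicClosure L
  have : CharP K p := charP_of_injective_algebraMap (algebraMap L K).injective p
  apply (algebraMap L K).injective
  rw [trace_eq_sum_embeddings K, map_pow (algebraMap L K), trace_eq_sum_embeddings K, sum_pow_char]
  simp

open IntermediateField in
theorem exists_root (P : PB p R L) (c : L) (hc : c ≠ 0) :
    ∃ (L' : Type u) (_ : Field L') (_ : CharP L' p) (P' : PB p R L') (ι : L →+* L')
      (lam : L' →+ L) (t : L'), t ^ (p - 1) = ι c ∧ (∀ a, lam (ι a) = a) ∧
      (∀ x, lam (x ^ p) = lam x ^ p) ∧ (∀ i < R, ∀ x, lam (P'.D i x) = P.D i (lam x)) ∧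
      ∀ i < R, ∀ a, P'.D i (ι a) = ι (P.D i a) := by
  have hp2 := hp.out.two_le
  obtain ⟨t, ht⟩ := IsAlgClosed.exists_pow_nat_eq (algebraMap L (AlgebraicClosure L) c)
    (n := p - 1) (by omega)
  set f : Polynomial L := Polynomial.X ^ (p - 1) - Polynomial.C c with hf
  have hft : Polynomial.aeval t f = 0 := by simp [hf, ht]
  have hmon : f.Monic := Polynomial.monic_X_pow_sub_C c (by omega)
  have hIntg : IsIntegral L t := ⟨f, hmon, by simpa [Polynomial.aeval_def] using hft⟩
  have hdvd : minpoly L t ∣ f := minpoly.dvd L t hft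
  have hp1 : ((p - 1 : ℕ) : L) ≠ 0 := by
    rw [Ne, CharP.cast_eq_zero_iff L p]
    intro h
    have := Nat.le_of_dvd (by omega) h
    omega
  have hsepf : f.Separable := Polynomial.separable_X_pow_sub_C c hp1 hc
  have hsep : IsSeparable L t := hsepf.of_dvd hdvd
  have : FiniteDimensional L L⟮t⟯ := adjoin.finiteDimensional hIntg
  have : Algebra.IsSeparable L L⟮t⟯ := (isSeparable_adjoin_simple_iff_isSeparable L _).2 hsep
  have hchar : CharP L⟮t⟯ p := charP_of_injective_algebraMap (algebraMap L L⟮t⟯).injective p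
  have hdeg : Module.finrank L L⟮t⟯ ≤ p - 1 := by
    rw [adjoin.finrank hIntg]
    have := Polynomial.natDegree_le_of_dvd hdvd hmon.ne_zero
    rwa [hf, Polynomial.natDegree_X_pow_sub_C] at this
  set n := Module.finrank L L⟮t⟯ with hn
  have hn0 : 0 < n := Module.finrank_pos
  have hnL : (n : L) ≠ 0 := by
    rw [Ne, CharP.cast_eq_zero_iff L p]
    intro h
    have := Nat.le_of_dvd hn0 h
    omega
  have hnp : (n : L)⁻¹ ^ p = (n : L)⁻¹ := by
    rw [inv_pow]; congr 1; exact map_natCast (frobenius L p) n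
  let lam : L⟮t⟯ →ₗ[L] L := (n : L)⁻¹ • Algebra.trace L L⟮t⟯
  have lam_ι : ∀ a, lam (algebraMap L L⟮t⟯ a) = a := by
    intro a
    change (n : L)⁻¹ * Algebra.trace L L⟮t⟯ _ = a
    rw [Algebra.trace_algebraMap, ← hn, nsmul_eq_mul, inv_mul_cancel_left₀ hnL]
  have lam_p : ∀ x, lam (x ^ p) = lam x ^ p := by
    intro x
    change (n : L)⁻¹ * Algebra.trace L L⟮t⟯ _ = ((n : L)⁻¹ * Algebra.trace L L⟮t⟯ _) ^ p
    rw [trace_pow_p, mul_pow, hnp]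
  -- spanning by p-th powers
  have hspan : ∀ {Q : L⟮t⟯ → Prop} (x : L⟮t⟯), Q 0 → (∀ x y, Q x → Q y → Q (x + y)) →
      (∀ a y, Q (algebraMap L L⟮t⟯ a * y ^ p)) → Q x := by
    intro Q x h0 hadd hQ
    have hsp := Field.span_map_pow_expChar_pow_eq_top_of_isSeparable (F := L) (E := L⟮t⟯) p 1
      (v := fun y : L⟮t⟯ => y) (by simp)
    simp only [pow_one] at hsp
    have hx : x ∈ Submodule.span L (Set.range fun y : L⟮t⟯ => y ^ p) := by
      rw [hsp]; trivial
    rw [Finsupp.mem_span_range_iff_exists_finsupp] at hx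
    obtain ⟨c, rfl⟩ := hx
    refine Finset.sum_induction _ Q hadd h0 (fun y _ => ?_)
    change Q (c y • y ^ p)
    rw [Algebra.smul_def]; exact hQ _ _
  choose! D' hD' using fun (i : ℕ) (hi : i < R) =>
    exists_ext_der L L⟮t⟯ (addDer (P.D i) (P.leib i hi))
  have hleib : ∀ i, ∀ a b, (D' i) (a * b) = a * D' i b + b * D' i a := fun i a b =>
    (D' i).leibniz a b
  have hDp : ∀ i < R, ∀ a (y : L⟮t⟯), D' i (algebraMap L L⟮t⟯ a * y ^ p)
      = algebraMap L L⟮t⟯ (P.D i a) * y ^ p := by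
    intro i hi a y
    have h := der_mul_pow (p := p) (D := (D' i : L⟮t⟯ →ₗ[ℤ] L⟮t⟯).toAddMonoidHom) (hleib i)
      (algebraMap L L⟮t⟯ a) y
    change D' i _ = D' i _ * _ at h
    rw [h, hD' i hi]; rfl
  let P' : PB p R L⟮t⟯ :=
    { D := fun i => (D' i : L⟮t⟯ →ₗ[ℤ] L⟮t⟯).toAddMonoidHom
      g := fun i => algebraMap L L⟮t⟯ (P.g i)
      leib := fun i _ => hleib i
      comm := by
        intro i hi j hj x
        change D' i (D' j x) = D' j (D' i x)
        refine hspan (Q := fun x => D' i (D' j x) = D' j (D' i x)) x (by simp)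
          (fun x y hx hy => by simp only [map_add, hx, hy]) (fun a y => ?_)
        rw [hDp j hj, hDp i hi, hDp i hi, hDp j hj, P.comm i hi j hj]
      pp := by
        intro i hi x
        change (⇑(D' i))^[p] x = D' i x
        have hadd : ∀ k (x y : L⟮t⟯), (⇑(D' i))^[k] (x + y) = (⇑(D' i))^[k] x + (⇑(D' i))^[k] y :=
          fun k => iterate_map_add (D' i) k
        have h0 : ∀ k, (⇑(D' i))^[k] 0 = 0 := fun k => iterate_map_zero (D' i) k
        refine hspan (Q := fun x => (⇑(D' i))^[p] x = D' i x) x (by rw [h0, map_zero]) (fun x y hx hy => by rw [hadd, hx, hy, map_add])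
          (fun a y => ?_)
        have : ∀ k, (⇑(D' i))^[k] (algebraMap L L⟮t⟯ a * y ^ p)
            = algebraMap L L⟮t⟯ ((⇑(P.D i))^[k] a) * y ^ p := by
          intro k
          induction k with
          | zero => rfl
          | succ k ih =>
            rw [Function.iterate_succ_apply', ih, hDp i hi, Function.iterate_succ_apply']
        rw [this, P.pp i hi, hDp i hi]
      gg := fun i hi => by
        change D' i _ = _
        rw [hD' i hi]; exact congrArg _ (P.gg i hi)
      gij := fun i hi j hj hij => by
        change D' i _ = _
        rw [hD' i hi]
        exact (congrArg _ (P.gij i hi j hj hij)).trans (map_zero _)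
      g0 := fun i hi => by
        rw [Ne, map_eq_zero]; exact P.g0 i hi }
  refine ⟨L⟮t⟯, inferInstance, hchar, P', algebraMap L L⟮t⟯, lam.toAddMonoidHom,
    AdjoinSimple.gen L t, ?_, lam_ι, lam_p, ?_, ?_⟩
  · apply (algebraMap L⟮t⟯ (AlgebraicClosure L)).injective
    rw [map_pow, AdjoinSimple.algebraMap_gen, ht]; rfl
  · intro i hi x
    change lam (D' i x) = P.D i (lam x)
    refine hspan (Q := fun x => lam (D' i x) = P.D i (lam x)) x (by simp)
      (fun x y hx hy => by simp only [map_add, hx, hy]) (fun a y => ?_)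
    rw [hDp i hi, ← Algebra.smul_def, ← Algebra.smul_def, map_smul, map_smul, lam_p, smul_eq_mul,
      smul_eq_mul, der_mul_pow (P.leib i hi)]
  · intro i hi a
    exact hD' i hi a

end
end HK

namespace HK
universe u v
set_option linter.unusedSectionVars false

section
variable {p : ℕ} {L : Type u} [Field L]

/-- iterates as additive maps -/
def itH (D : L →+ L) : ℕ → L →+ L
  | 0 => AddMonoidHom.id L
  | k + 1 => D.comp (itH D k)

lemma itH_apply (D : L →+ L) (k : ℕ) (a : L) : itH D k a = (⇑D)^[k] a := by
  induction k with
  | zero => rfl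
  | succ k ih => rw [Function.iterate_succ_apply', ← ih]; rfl

lemma itH_succ (D : L →+ L) (k : ℕ) (a : L) : itH D (k + 1) a = D (itH D k a) := rfl

lemma itH_comm {D D' : L →+ L} (h : ∀ a, D (D' a) = D' (D a)) (k : ℕ) (a : L) :
    itH D k (D' a) = D' (itH D k a) := by
  induction k with
  | zero => rfl
  | succ k ih => rw [itH_succ, ih, h, itH_succ]

lemma itH_self (D : L →+ L) (k : ℕ) (a : L) : itH D k (D a) = itH D (k + 1) a := by
  rw [itH_comm (fun _ => rfl)]; rfl

lemma itH_killed {D : L →+ L} {a : L} (h : D a = 0) (k : ℕ) : itH D (k + 1) a = 0 := by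
  rw [← itH_self, h, map_zero]

lemma itH_mul {D : L →+ L} {c : L} (h : ∀ a, D (c * a) = c * D a) (k : ℕ) (a : L) :
    itH D k (c * a) = c * itH D k a := by
  induction k with
  | zero => rfl
  | succ k ih => rw [itH_succ, ih, h, itH_succ]

/-- the projector `1 - D^(p-1)` -/
def pih (p : ℕ) (D : L →+ L) : L →+ L := AddMonoidHom.id L - itH D (p - 1)

lemma pih_apply (D : L →+ L) (a : L) : pih p D a = a - itH D (p - 1) a := rfl

lemma pih_mul {D : L →+ L} {c : L} (h : ∀ a, D (c * a) = c * D a) (a : L) :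
    pih p D (c * a) = c * pih p D a := by
  rw [pih_apply, pih_apply, itH_mul h, mul_sub]

lemma pih_comm {D D' : L →+ L} (h : ∀ a, D (D' a) = D' (D a)) (a : L) :
    pih p D (D' a) = D' (pih p D a) := by
  rw [pih_apply, pih_apply, itH_comm h, map_sub]

variable [hp : Fact p.Prime]

lemma pih_killed {D : L →+ L} {a : L} (h : D a = 0) : pih p D a = a := by
  have := hp.out.two_le
  obtain ⟨k, hk⟩ : ∃ k, p - 1 = k + 1 := ⟨p - 2, by omega⟩
  rw [pih_apply, hk, itH_killed h, sub_zero]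

lemma der_pih {D : L →+ L} (h : ∀ a, (⇑D)^[p] a = D a) (a : L) : D (pih p D a) = 0 := by
  have := hp.out.two_le
  rw [pih_apply, map_sub, ← itH_succ, itH_apply, Nat.sub_add_cancel (by omega), h, sub_self]

lemma pih_der {D : L →+ L} (h : ∀ a, (⇑D)^[p] a = D a) (a : L) : pih p D (D a) = 0 := by
  rw [pih_comm (fun _ => rfl), der_pih h]

def frb (p : ℕ) [Fact p.Prime] (L : Type u) [Field L] [CharP L p] : L →+ L :=
  (frobenius L p).toAddMonoidHom

lemma frb_apply [CharP L p] (a : L) : frb p L a = a ^ p := rfl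

/-! coefficients -/
def coef (α : ℕ → Bool) : {r : ℕ} → Frm L r →+ L
  | 0 => AddMonoidHom.id L
  | r + 1 => match α r with
    | true => (coef α).comp fb
    | false => (coef α).comp fa

variable {α : ℕ → Bool} {s r : ℕ}

lemma coef_zero (x : Frm L 0) : coef α x = x := rfl
lemma coef_true (h : α s = true) (x : Frm L (s + 1)) : coef α x = coef α (fb x) := by
  rw [coef, h]; rfl
lemma coef_false (h : α s = false) (x : Frm L (s + 1)) : coef α x = coef α (fa x) := by
  rw [coef, h]; rfl

lemma coef_fmap {M : Type v} [Field M] (f : L →+ M) (x : Frm L s) :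
    coef α (fmap f x) = f (coef α x) := by
  induction s with
  | zero => rfl
  | succ s ih =>
    cases h : α s
    · rw [coef_false h, coef_false h, fa_fmap, ih]
    · rw [coef_true h, coef_true h, fb_fmap, ih]

def XX (p : ℕ) (D : ℕ → L →+ L) (α : ℕ → Bool) : ℕ → L → Prop
  | 0, y => y = 0
  | s + 1, y => match α s with
    | true => XX p D α s (pih p (D s) y)
    | false => XX p D α s y ∧ D s y = 0

variable {D : ℕ → L →+ L}

lemma XX_true (h : α s = true) (y : L) : XX p D α (s + 1) y ↔ XX p D α s (pih p (D s) y) := by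
  rw [XX, h]
lemma XX_false (h : α s = false) (y : L) :
    XX p D α (s + 1) y ↔ XX p D α s y ∧ D s y = 0 := by
  rw [XX, h]

lemma XX_mul {c y : L} (hc : ∀ i < s, ∀ a, D i (c * a) = c * D i a) (h : XX p D α s y) :
    XX p D α s (c * y) := by
  induction s generalizing y with
  | zero => rw [XX] at *; rw [h, mul_zero]
  | succ s ih =>
    have hc' : ∀ i < s, ∀ a, D i (c * a) = c * D i a := fun i hi => hc i (by omega)
    cases hs : α s
    · rw [XX_false hs] at *
      exact ⟨ih hc' h.1, by rw [hc s (by omega), h.2, mul_zero]⟩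
    · rw [XX_true hs] at *
      rw [pih_mul (hc s (by omega))]; exact ih hc' h

lemma XX_killed {y : L} (hc : ∀ i < s, D i y = 0) (h : XX p D α s y) : y = 0 := by
  induction s generalizing y with
  | zero => rw [XX] at h; exact h
  | succ s ih =>
    have hc' : ∀ i < s, D i y = 0 := fun i hi => hc i (by omega)
    cases hs : α s
    · rw [XX_false hs] at h; exact ih hc' h.1
    · rw [XX_true hs, pih_killed (hc s (by omega))] at h; exact ih hc' h

lemma XX_map {M : Type v} [Field M] {D' : ℕ → M →+ M} {f : L →+ M} (hf : ∀ a, f a = 0 → a = 0)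
    (hD : ∀ i < s, ∀ a, D' i (f a) = f (D i a)) {y : L} :
    XX p D' α s (f y) ↔ XX p D α s y := by
  induction s generalizing y with
  | zero => rw [XX, XX]; exact ⟨hf y, fun h => by rw [h, map_zero]⟩
  | succ s ih =>
    have ih' := fun y => ih (y := y) (fun i hi => hD i (by omega))
    cases hs : α s
    · rw [XX_false hs, XX_false hs, ih', hD s (by omega)]
      exact and_congr_right fun _ => ⟨hf _, fun h => by rw [h, map_zero]⟩
    · have h1 : ∀ k, itH (D' s) k (f y) = f (itH (D s) k y) := by
        intro k
        induction k with
        | zero => rfl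
        | succ k ih => rw [itH_succ, ih, hD s (by omega), itH_succ]
      rw [XX_true hs, XX_true hs, ← ih', pih_apply, pih_apply, h1, map_sub]

/-! lexicographic cuts -/
def Cut (B : Prop) (α : ℕ → Bool) (r : ℕ) : {s : ℕ} → Frm L s → Prop
  | 0, x => B ∨ x = 0
  | s + 1, x => if s + 1 ≤ r then B ∨ x = 0 else
    match α s with
    | true => Cut B α r (fb x)
    | false => fb x = 0 ∧ Cut B α r (fa x)

variable {B : Prop}
lemma cut_low (h : s ≤ r) (x : Frm L s) : Cut B α r x ↔ B ∨ x = 0 := by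
  cases s with
  | zero => rw [Cut]
  | succ s => rw [Cut, if_pos h]
lemma cut_true (h : ¬ s + 1 ≤ r) (hs : α s = true) (x : Frm L (s + 1)) :
    Cut B α r x ↔ Cut B α r (fb x) := by
  rw [Cut, if_neg h, hs]
lemma cut_false (h : ¬ s + 1 ≤ r) (hs : α s = false) (x : Frm L (s + 1)) :
    Cut B α r x ↔ fb x = 0 ∧ Cut B α r (fa x) := by
  rw [Cut, if_neg h, hs]

lemma cut_add {x y : Frm L s} (hx : Cut B α r x) (hy : Cut B α r y) : Cut B α r (x + y) := by
  induction s with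
  | zero =>
    rw [cut_low (by omega)] at *
    rcases hx with h | h
    · exact Or.inl h
    · rcases hy with h' | h'
      · exact Or.inl h'
      · right; rw [h, h', add_zero]
  | succ s ih =>
    by_cases hr : s + 1 ≤ r
    · rw [cut_low hr] at *
      rcases hx with h | h
      · exact Or.inl h
      · rcases hy with h' | h'
        · exact Or.inl h'
        · right; rw [h, h', add_zero]
    · cases hs : α s
      · rw [cut_false hr hs] at *
        exact ⟨by rw [map_add, hx.1, hy.1, add_zero], by rw [map_add]; exact ih hx.2 hy.2⟩
      · rw [cut_true hr hs] at *
        rw [map_add]; exact ih hx hy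

lemma cut_fmap {M : Type v} [Field M] (f : L →+ M) {x : Frm L s} (hx : Cut B α r x) :
    Cut B α r (fmap f x) := by
  induction s with
  | zero =>
    rw [cut_low (by omega)] at *
    exact hx.imp_right fun h => by rw [h, map_zero]
  | succ s ih =>
    by_cases hr : s + 1 ≤ r
    · rw [cut_low hr] at *
      exact hx.imp_right fun h => by rw [h, map_zero]
    · cases hs : α s
      · rw [cut_false hr hs] at *
        exact ⟨by rw [fb_fmap, hx.1, map_zero], ih hx.2⟩
      · rw [cut_true hr hs] at *
        exact ih hx

lemma cut_neg {x : Frm L s} (hx : Cut B α r x) : Cut B α r (-x) := by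
  have := cut_fmap (-(AddMonoidHom.id L)) hx
  have e : fmap (-(AddMonoidHom.id L)) x = -x := by
    have := fmap_sub (0 : L →+ L) (AddMonoidHom.id L) x
    rw [zero_sub, fmap_zero, fmap_id, zero_sub] at this
    exact this
  rwa [e] at this

lemma cut_sub {x y : Frm L s} (hx : Cut B α r x) (hy : Cut B α r y) : Cut B α r (x - y) := by
  rw [sub_eq_add_neg]; exact cut_add hx (cut_neg hy)

lemma cut_mono {B' : Prop} (hB : B → B') {x : Frm L s} (hx : Cut B α r x) : Cut B' α r x := by
  induction s with
  | zero => rw [cut_low (by omega)] at *; exact hx.imp_left hB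
  | succ s ih =>
    by_cases hr : s + 1 ≤ r
    · rw [cut_low hr] at *; exact hx.imp_left hB
    · cases hs : α s
      · rw [cut_false hr hs] at *; exact ⟨hx.1, ih hx.2⟩
      · rw [cut_true hr hs] at *; exact ih hx

lemma cut_zero_iff {x : Frm L s} : Cut False α 0 x ↔ Cut True α 0 x ∧ coef α x = 0 := by
  induction s with
  | zero => rw [cut_low le_rfl, cut_low le_rfl, false_or, true_or, true_and]; exact Iff.rfl
  | succ s ih =>
    cases hs : α s
    · rw [cut_false (by omega) hs, cut_false (by omega) hs, coef_false hs, ih, and_assoc]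
    · rw [cut_true (by omega) hs, cut_true (by omega) hs, coef_true hs, ih]

lemma cut_up {B1 B2 : Prop} {α' : ℕ → Bool} {r' : ℕ} (h0 : r' ≤ r + 1) (h0' : r ≤ r')
    (hα : ∀ i, r < i → α' i = α i)
    (hB : B1 → B2)
    (hr : ∀ x : Frm L (r + 1), Cut B1 α r' x → Cut B2 α' r x)
    {x : Frm L s} (hx : Cut B1 α r' x) : Cut B2 α' r x := by
  induction s with
  | zero => rw [cut_low (by omega)] at *; exact hx.imp_left hB
  | succ s ih =>
    rcases lt_trichotomy s r with h | h | h
    · rw [cut_low (by omega)] at *; exact hx.imp_left hB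
    · subst h; exact hr x hx
    · cases hs : α s
      · have hs' := hs
        rw [← hα s h] at hs'
        rw [cut_false (by omega) hs] at hx; rw [cut_false (by omega) hs']
        exact ⟨hx.1, ih hx.2⟩
      · have hs' := hs
        rw [← hα s h] at hs'
        rw [cut_true (by omega) hs] at hx; rw [cut_true (by omega) hs']
        exact ih hx

lemma cut_dn {B1 B2 : Prop} {α' : ℕ → Bool}
    (hα : ∀ i, r < i → α' i = α i)
    (hB : B1 → B2)
    (hr : ∀ x : Frm L (r + 1), Cut B1 α r x → Cut B2 α' (r + 1) x)
    {x : Frm L s} (hx : Cut B1 α r x) : Cut B2 α' (r + 1) x := by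
  induction s with
  | zero => rw [cut_low (by omega)] at *; exact hx.imp_left hB
  | succ s ih =>
    rcases lt_trichotomy s r with h | h | h
    · rw [cut_low (by omega)] at *; exact hx.imp_left hB
    · subst h; exact hr x hx
    · cases hs : α s
      · have hs' := hs
        rw [← hα s h] at hs'
        rw [cut_false (by omega) hs] at hx; rw [cut_false (by omega) hs']
        exact ⟨hx.1, ih hx.2⟩
      · have hs' := hs
        rw [← hα s h] at hs'
        rw [cut_true (by omega) hs] at hx; rw [cut_true (by omega) hs']
        exact ih hx

lemma lemX (comm : ∀ i < s, ∀ j < s, ∀ a, D i (D j a) = D j (D i a))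
    (pp : ∀ i < s, ∀ a, (⇑(D i))^[p] a = D i a) (v : Frm L s) (hv : Cut True α 0 (dd D v)) :
    XX p D α s (coef α (dd D v)) := by
  induction s with
  | zero => rw [XX, dd_zero, map_zero]
  | succ s ih =>
    have ih' := ih (fun i hi j hj => comm i (by omega) j (by omega)) (fun i hi => pp i (by omega))
    cases hs : α s
    · rw [cut_false (by omega) hs, fa_dd, fb_dd] at hv
      rw [XX_false hs, coef_false hs, fa_dd]
      refine ⟨ih' _ hv.2, ?_⟩
      rw [← coef_fmap, fmap_dd (D' := D) (fun i hi a => comm s (by omega) i (by omega) a),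
        sub_eq_zero.1 hv.1, dd_dd (fun i hi j hj => comm i (by omega) j (by omega)), map_zero]
    · rw [cut_true (by omega) hs, fb_dd] at hv
      rw [XX_true hs, coef_true hs, fb_dd, ← coef_fmap]
      have e : fmap (pih p (D s)) (fmap (D s) (fa v) - dd D (fb v))
          = dd D (-fmap (pih p (D s)) (fb v)) := by
        rw [map_sub, fmap_comp, fmap_eq_zero (fun a => pih_der (pp s (by omega)) a), zero_sub,
          fmap_dd (D' := D) (fun i hi a => pih_comm (fun a => comm s (by omega) i (by omega) a) a),
          map_neg]
      rw [e]
      apply ih'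
      rw [← e]
      exact cut_fmap _ hv

lemma lemZ1 (comm : ∀ i < s, ∀ j < s, ∀ a, D i (D j a) = D j (D i a))
    (pp : ∀ i < s, ∀ a, (⇑(D i))^[p] a = D i a) (η : ℕ → L)
    (h1 : ∀ i < s, ∀ j < s, D i (η j) = D j (η i)) (h2 : ∀ i < s, pih p (D i) (η i) = 0) :
    ∃ w, ∀ i < s, D i w = η i := by
  induction s with
  | zero => exact ⟨0, fun i hi => by omega⟩
  | succ s ih =>
    obtain ⟨w, hw⟩ := ih (fun i hi j hj => comm i (by omega) j (by omega))
      (fun i hi => pp i (by omega)) (fun i hi j hj => h1 i (by omega) j (by omega))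
      (fun i hi => h2 i (by omega))
    have := hp.out.two_le
    obtain ⟨k, hk⟩ : ∃ k, p - 1 = k + 1 := ⟨p - 2, by omega⟩
    set ζ := η s - D s w with hζ
    have hζ1 : ∀ i < s, D i ζ = 0 := fun i hi => by
      rw [hζ, map_sub, comm i (by omega) s (by omega), hw i hi, h1 i (by omega) s (by omega),
        sub_self]
    have hζ2 : pih p (D s) ζ = 0 := by
      rw [hζ, map_sub, h2 s (by omega), pih_der (pp s (by omega)), sub_zero]
    rw [pih_apply, hk, itH_succ, sub_eq_zero] at hζ2
    refine ⟨w + itH (D s) k ζ, fun i hi => ?_⟩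
    rcases Nat.lt_succ_iff_lt_or_eq.1 hi with h | rfl
    · rw [map_add, hw i h, ← itH_comm (fun a => comm s (by omega) i (by omega) a), hζ1 i h,
        map_zero, add_zero]
    · rw [map_add, ← hζ2, hζ]; abel

end
end HK

namespace HK
universe u v
set_option linter.unusedSectionVars false

section
variable {p : ℕ} [hp : Fact p.Prime] {L : Type u} [Field L] {s r R : ℕ}

def PB.trim (P : PB p (s + 1) L) : PB p s L where
  D := P.D
  g := P.g
  leib i hi := P.leib i (by omega)
  comm i hi j hj := P.comm i (by omega) j (by omega)
  pp i hi := P.pp i (by omega)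
  gg i hi := P.gg i (by omega)
  gij i hi j hj := P.gij i (by omega) j (by omega)
  g0 i hi := P.g0 i (by omega)

lemma der_one {D : L →+ L} (h : ∀ a b, D (a * b) = a * D b + b * D a) : D 1 = 0 := by
  have := h 1 1
  simp only [mul_one, one_mul] at this
  simpa using this

lemma der_inv {D : L →+ L} (h : ∀ a b, D (a * b) = a * D b + b * D a) {a : L} (ha : D a = 0) :
    D a⁻¹ = 0 := by
  by_cases h0 : a = 0
  · rw [h0, inv_zero, map_zero]
  · have := h a a⁻¹
    rw [mul_inv_cancel₀ h0, der_one h, ha, mul_zero, add_zero] at this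
    exact (mul_eq_zero.1 this.symm).resolve_left h0

lemma der_smul {D : L →+ L} (h : ∀ a b, D (a * b) = a * D b + b * D a) {c : L} (hc : D c = 0)
    (a : L) : D (c * a) = c * D a := by
  rw [h, hc, mul_zero, add_zero]

/-- common kernel of a family of derivations -/
def kerF {I : Type v} (D : I → L →+ L) (h : ∀ i, ∀ a b, D i (a * b) = a * D i b + b * D i a) :
    Subfield L where
  carrier := {a | ∀ i, D i a = 0}
  mul_mem' {a b} ha hb i := by rw [h, ha i, hb i, mul_zero, mul_zero, add_zero]
  one_mem' i := der_one (h i)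
  add_mem' {a b} ha hb i := by rw [map_add, ha i, hb i, add_zero]
  zero_mem' i := map_zero _
  neg_mem' {a} ha i := by rw [map_neg, ha i, neg_zero]
  inv_mem' a ha i := der_inv (h i) (ha i)

lemma mem_kerF {I : Type v} {D : I → L →+ L}
    {h : ∀ i, ∀ a b, D i (a * b) = a * D i b + b * D i a} {a : L} :
    a ∈ kerF D h ↔ ∀ i, D i a = 0 := Iff.rfl

abbrev subH (K : Subfield L) : K →+ L := K.subtype.toAddMonoidHom

theorem PB.restrict (P : PB p R L) (K : Subfield L) (hD : ∀ i < R, ∀ a ∈ K, P.D i a ∈ K)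
    (hg : ∀ i < R, P.g i ∈ K) :
    ∃ P0 : PB p R K, ∀ i < R, ∀ a : K, P.D i (subH K a) = subH K (P0.D i a) := by
  let D0 : ℕ → K →+ K := fun i => if h : i < R then
    { toFun := fun a => ⟨P.D i a, hD i h a a.2⟩
      map_zero' := by ext; simp
      map_add' := fun a b => by ext; simp } else 0
  have hD0 : ∀ i < R, ∀ a : K, P.D i (subH K a) = subH K (D0 i a) := by
    intro i hi a
    simp only [D0, dif_pos hi]; rfl
  have hD0' : ∀ i < R, ∀ a : K, P.D i (a : L) = ((D0 i a : K) : L) := hD0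
  let g0 : ℕ → K := fun i => if h : i < R then ⟨P.g i, hg i h⟩ else 0
  have hg0 : ∀ i < R, ((g0 i : K) : L) = P.g i := by
    intro i hi; simp only [g0, dif_pos hi]
  refine ⟨⟨D0, g0, ?_, ?_, ?_, ?_, ?_, ?_⟩, hD0⟩
  · intro i hi a b
    ext
    rw [← hD0' i hi]; push_cast
    rw [← hD0' i hi, ← hD0' i hi]; exact P.leib i hi _ _
  · intro i hi j hj a
    ext
    rw [← hD0' i hi, ← hD0' j hj, ← hD0' j hj, ← hD0' i hi]; exact P.comm i hi j hj _
  · intro i hi a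
    ext
    rw [← hD0' i hi, ← P.pp i hi]
    have : ∀ k, (((⇑(D0 i))^[k] a : K) : L) = (⇑(P.D i))^[k] (a : L) := by
      intro k
      induction k with
      | zero => rfl
      | succ k ih =>
        rw [Function.iterate_succ_apply', Function.iterate_succ_apply', ← hD0' i hi, ih]
    exact this p
  · intro i hi
    ext
    rw [← hD0' i hi, hg0 i hi, P.gg i hi]
  · intro i hi j hj hij
    ext
    rw [← hD0' i hi, hg0 j hj, P.gij i hi j hj hij]; rfl
  · intro i hi h
    apply P.g0 i hi
    rw [← hg0 i hi, h]; rfl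

variable [CharP L p]

lemma charP_sub (K : Subfield L) : CharP K p :=
  ⟨fun x => by
    rw [← CharP.cast_eq_zero_iff L p x, ← map_natCast K.subtype, map_eq_zero]⟩

/-- kernel of the top derivation -/
theorem PB.kerTop (P : PB p (s + 1) L) :
    ∃ (K : Subfield L) (P0 : PB p s K), (∀ a, a ∈ K ↔ P.D s a = 0) ∧
      ∀ i < s, ∀ a : K, P.D i (subH K a) = subH K (P0.D i a) := by
  let K : Subfield L := kerF (fun _ : Unit => P.D s) (fun _ => P.leib s (by omega))
  have hK : ∀ a, a ∈ K ↔ P.D s a = 0 := fun a => ⟨fun h => h (), fun h _ => h⟩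
  obtain ⟨P0, h0⟩ := P.trim.restrict K (fun i hi a ha => by
    rw [hK] at *
    change P.D s (P.D i a) = 0
    rw [P.comm s (by omega) i (by omega), ha, map_zero]) (fun i hi => by
    rw [hK]; exact P.gij s (by omega) i (by omega) (by omega))
  exact ⟨K, P0, hK, h0⟩

variable {α : ℕ → Bool}

theorem thmP (s : ℕ) : ∀ (L : Type u) [Field L] [CharP L p] (P : PB p s L) (a : L),
    XX p P.D α s (a ^ p - a) → ∃ θ : Frm L s, Cut True α 0 θ ∧ coef α θ = a ∧
      ∃ v, fmap (frb p L) θ - θ = dd P.D v := by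
  induction s with
  | zero =>
    intro L _ _ P a h
    rw [XX] at h
    exact ⟨a, (cut_low le_rfl _).2 (Or.inl trivial), rfl, 0, h⟩
  | succ s ih =>
    intro L _ _ P a h
    have hp2 := hp.out.two_le
    cases hs : α s
    · rw [XX_false hs] at h
      obtain ⟨K, P0, hK, hD⟩ := P.kerTop
      have ha : P.D s a = 0 := by
        have := h.2
        rw [map_sub, der_pow_p (P.leib s (by omega)), zero_sub, neg_eq_zero] at this
        exact this
      have : CharP K p := charP_sub K
      obtain ⟨θ, h1, h2, v, h3⟩ := ih K P0 ⟨a, (hK a).2 ha⟩ (by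
        rw [← XX_map (D' := P.D) (f := subH K) (fun a h => by simpa using h) hD]
        exact h.1)
      have hz : ∀ x : Frm K s, fmap (P.D s) (fmap (subH K) x) = 0 := fun x => by
        rw [fmap_comp]; exact fmap_eq_zero (f := (P.D s).comp (subH K)) (fun a => (hK a).1 a.2) x
      refine ⟨fmk (fmap (subH K) θ) 0, ?_, ?_, fmk (fmap (subH K) v) 0, ?_⟩
      · rw [cut_false (by omega) hs]
        exact ⟨rfl, cut_fmap _ h1⟩
      · rw [coef_false hs, fa_mk, coef_fmap, h2]; rfl
      · have h4 := congrArg (fmap (subH K)) h3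
        rw [map_sub, fmap_dd (D' := P.D) (fun i hi a => (hD i hi a).symm)] at h4
        apply frm_ext
        · rw [fa_dd, fa_mk, ← h4, map_sub, fa_fmap, fa_mk]
          congr 1
          exact fmap_comm' (f := frb p _) (f' := subH K) (g := subH K) (g' := frb p K) (fun a => rfl) _
        · rw [fb_dd, fa_mk, hz, fb_mk, map_zero, sub_zero, map_sub, fb_fmap, fb_mk, map_zero,
            sub_zero]
    · rw [XX_true hs, map_sub, pih_killed (der_pow_p (P.leib s (by omega)) a)] at h
      by_cases ha : a = 0
      · subst ha
        refine ⟨0, ?_, map_zero _, 0, by simp⟩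
        apply cut_mono (fun h : False => h.elim)
        have hz : ∀ s, Cut False α 0 (0 : Frm L s) := by
          intro s
          induction s with
          | zero => rw [cut_low le_rfl]; exact Or.inr rfl
          | succ s ih =>
            cases hs : α s
            · rw [cut_false (by omega) hs]; exact ⟨rfl, ih⟩
            · rw [cut_true (by omega) hs]; exact ih
        exact hz _
      set a₁ := pih p (P.D s) a with ha₁
      have hDp : ∀ i < s + 1, ∀ x, P.D i (x ^ p) = 0 := fun i hi x => der_pow_p (P.leib i hi) x
      have ha1 : a₁ ≠ 0 := by
        intro h0
        rw [h0, sub_zero] at h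
        exact ha (pow_eq_zero_iff (by omega) |>.1 (XX_killed (fun i hi => hDp i (by omega) a) h))
      have hDa1 : P.D s a₁ = 0 := der_pih (P.pp s (by omega)) a
      obtain ⟨L', _, _, P', ι, lam, t, ht, l1, l2, l3, l4⟩ := exists_root P (a₁ / a ^ p)
        (div_ne_zero ha1 (pow_ne_zero _ ha))
      have hDp' : ∀ i < s + 1, ∀ x, P'.D i (x ^ p) = 0 := fun i hi x => der_pow_p (P'.leib i hi) x
      have hq0 : ι (a₁ / a ^ p) ≠ 0 := by
        rw [Ne, map_eq_zero]; exact div_ne_zero ha1 (pow_ne_zero _ ha)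
      have ht0 : t ≠ 0 := by
        rintro rfl
        rw [zero_pow (by omega)] at ht; exact hq0 ht.symm
      have hia : ι a ≠ 0 := by rwa [Ne, map_eq_zero]
      have hDq : P'.D s (ι (a₁ / a ^ p)) = 0 := by
        rw [l4 s (by omega), div_eq_mul_inv, ← inv_pow, der_mul_pow (P.leib s (by omega)), hDa1,
          zero_mul, map_zero]
      have hpt : t ^ p = ι (a₁ / a ^ p) * t := by
        rw [← ht, ← pow_succ, Nat.sub_add_cancel (by omega)]
      have hDt : P'.D s t = 0 := by
        have := hDp' s (by omega) t
        rw [hpt, der_smul (P'.leib s (by omega)) hDq] at this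
        exact (mul_eq_zero.1 this).resolve_left hq0
      -- the eigenfunction
      set a' := t * ι a with ha'
      have hpia : ∀ x, pih p (P'.D s) (ι x) = ι (pih p (P.D s) x) := by
        intro x
        have h1 : ∀ k, itH (P'.D s) k (ι x) = ι (itH (P.D s) k x) := by
          intro k
          induction k with
          | zero => rfl
          | succ k ih => rw [itH_succ, ih, l4 s (by omega), itH_succ]
        rw [pih_apply, pih_apply, h1, map_sub]
      have hpa' : pih p (P'.D s) a' = a' ^ p := by
        rw [ha', pih_mul (der_smul (P'.leib s (by omega)) hDt), hpia, ← ha₁, mul_pow, hpt,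
          map_div₀, map_pow]
        field_simp
      have e1 : (⇑(addDer (P'.D s) (P'.leib s (by omega))))^[p - 1] a' + a' ^ p = a' := by
        have := pih_apply (p := p) (P'.D s) a'
        rw [itH_apply, hpa'] at this
        change (⇑(P'.D s))^[p - 1] a' + a' ^ p = a'
        rw [this]; ring
      obtain ⟨ε, hε0, hε⟩ := jac_cor2 (p := p) (addDer (P'.D s) (P'.leib s (by omega)))
        (P'.pp s (by omega)) (P'.g s) (P'.g0 s (by omega)) (P'.gg s (by omega)) a' e1
      change P'.D s ε = a' * ε at hε
      -- the constant field
      obtain ⟨K, P0, hK, hD⟩ := P'.kerTop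
      have : CharP K p := charP_sub K
      have hc : P'.D s t⁻¹ = 0 := der_inv (P'.leib s (by omega)) hDt
      obtain ⟨θ', h1, h2, v', h3⟩ := ih K P0 ⟨t⁻¹, (hK _).2 hc⟩ (by
        rw [← XX_map (D' := P'.D) (f := subH K) (fun a h => by simpa using h) hD]
        change XX p P'.D α s (t⁻¹ ^ p - t⁻¹)
        have e : t⁻¹ ^ p - t⁻¹ = (t⁻¹ * (ι a)⁻¹) ^ p * ι (a ^ p - a₁) := by
          have h5 : t * ι a₁ = t ^ p * ι a ^ p := by
            rw [hpt, map_div₀, map_pow]; field_simp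
          have htp : t ^ p ≠ 0 := pow_ne_zero _ ht0
          have hap : ι a ^ p ≠ 0 := pow_ne_zero _ hia
          rw [map_sub, map_pow, mul_pow, inv_pow, inv_pow]
          field_simp
          linear_combination h5
        rw [e]
        apply XX_mul
        · intro i hi x
          exact der_smul (P'.leib i (by omega)) (hDp' i (by omega) _) x
        · exact (XX_map (f := ι.toAddMonoidHom) (fun a h => by simpa using h)
            (fun i hi a => l4 i (by omega) a)).2 h)
      have hz : ∀ x : Frm K s, fmap (P'.D s) (fmap (subH K) x) = 0 := fun x => by
        rw [fmap_comp]; exact fmap_eq_zero (f := (P'.D s).comp (subH K)) (fun a => (hK a).1 a.2) x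
      set Θ : Frm L' (s + 1) := fmk (fmap (subH K) θ') 0 with hΘ
      set V : Frm L' (s + 1) := fmk (fmap (subH K) v') 0 with hV
      have hΘV : fmap (frb p L') Θ = Θ + dd P'.D V := by
        have h4 := congrArg (fmap (subH K)) h3
        rw [map_sub, fmap_dd (D' := P'.D) (fun i hi a => (hD i hi a).symm)] at h4
        rw [← sub_eq_iff_eq_add']
        apply frm_ext
        · rw [fa_dd, hV, fa_mk, ← h4, map_sub, fa_fmap, hΘ, fa_mk]
          congr 1
          exact fmap_comm' (f := frb p _) (f' := subH K) (g := subH K) (g' := frb p K) (fun a => rfl) _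
        · rw [fb_dd, hV, fa_mk, hz, fb_mk, map_zero, sub_zero, map_sub, fb_fmap, hΘ, fb_mk,
            map_zero, sub_zero]
      have hdΘ : dd P'.D Θ = 0 := by
        have := congrArg (dd P'.D) hΘV
        rw [dd_const (fun i hi a => hDp' i hi a), map_add, dd_dd P'.comm, add_zero] at this
        exact this.symm
      set c : ℕ → L' := fun i => P'.D i ε / ε with hcdef
      have hcsymm : ∀ i < s + 1, ∀ j < s + 1, P'.D i (c j) = P'.D j (c i) := by
        intro i hi j hj
        have key : ∀ i < s + 1, ∀ j < s + 1,
            ε ^ 2 * P'.D i (c j) = ε * P'.D i (P'.D j ε) - P'.D j ε * P'.D i ε := by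
          intro i hi j hj
          have h6 : ε * c j = P'.D j ε := by simp only [hcdef]; field_simp
          have h7 := P'.leib i hi ε (c j)
          rw [h6] at h7
          linear_combination -ε * h7 - (P'.D i ε) * h6
        have := (key i hi j hj).trans (Eq.trans (by rw [P'.comm i hi j hj]; ring)
          (key j hj i hi).symm)
        exact mul_left_cancel₀ (pow_ne_zero 2 hε0) this
      have hjac : ∀ i < s + 1, itH (P'.D i) (p - 1) (c i) + c i ^ p = c i := by
        intro i hi
        rw [itH_apply]
        exact jac_cor1 (p := p) (addDer (P'.D i) (P'.leib i hi)) (P'.pp i hi) ε hε0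
      obtain ⟨k, hk⟩ : ∃ k, p - 1 = k + 1 := ⟨p - 2, by omega⟩
      obtain ⟨w, hw⟩ := lemZ1 (p := p) P'.comm P'.pp (fun i => c i ^ p - c i)
        (fun i hi j hj => by
          rw [map_sub, map_sub, hDp' i hi, hDp' j hj, hcsymm i hi j hj])
        (fun i hi => by
          rw [pih_apply, map_sub, hk, itH_killed (hDp' i hi _), ← hk]
          linear_combination hjac i hi)
      have hfin : fmap (frb p L') (mm c Θ) - mm c Θ
          = dd P'.D (fmap (mulL w) Θ - mm (fun i => c i ^ p) V) := by
        rw [fmap_mm (c' := fun i => c i ^ p) (fun i hi a => by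
          rw [frb_apply, frb_apply, mul_pow]), hΘV, map_add, map_sub (dd P'.D),
          dd_mul P'.leib, hdΘ, map_zero, add_zero, dd_mm P'.leib (fun i hi j hj => by
            rw [hDp' i hi, hDp' j hj]), mm_congr hw, mm_sub]
        abel
      refine ⟨fmap lam (mm c Θ), ?_, ?_, fmap lam (fmap (mulL w) Θ - mm (fun i => c i ^ p) V), ?_⟩
      · apply cut_fmap
        rw [cut_true (by omega) hs, fb_mm, hΘ, fa_mk, fb_mk, map_zero, sub_zero]
        exact cut_fmap _ (cut_fmap _ h1)
      · rw [coef_fmap, coef_true hs, fb_mm, hΘ, fa_mk, fb_mk, map_zero, sub_zero, coef_fmap,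
          coef_fmap, h2]
        change lam (P'.D s ε / ε * t⁻¹) = a
        rw [hε, ha']
        have : t * ι a * ε / ε * t⁻¹ = ι a := by field_simp
        rw [this, l1]
      · rw [← fmap_dd (D := P'.D) l3, ← hfin, map_sub]
        congr 1
        exact fmap_comm' (fun a => (l2 a).symm) _

def exactAS (P : PB p s L) (θ : Frm L s) : Prop :=
  ∃ v, fmap (frb p L) θ - θ = dd P.D v

lemma exactAS_add {P : PB p s L} {x y : Frm L s} (hx : exactAS P x) (hy : exactAS P y) :
    exactAS P (x + y) := by
  obtain ⟨v, hv⟩ := hx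
  obtain ⟨w, hw⟩ := hy
  exact ⟨v + w, by rw [map_add, map_add, ← hv, ← hw]; abel⟩

theorem thmT (P : PB p s L) (r : ℕ) : ∀ (α : ℕ → Bool) (θ v : Frm L s), Cut True α r θ →
    Cut False α r (fmap (frb p L) θ - θ + dd P.D v) →
    ∃ θ₁, exactAS P θ₁ ∧ Cut False α r (θ - θ₁) := by
  induction r with
  | zero =>
    intro α θ v h1 h2
    rw [cut_zero_iff] at h2
    have h3 : Cut True α 0 (dd P.D v) := by
      have := cut_sub h2.1 (cut_sub (cut_fmap (frb p L) h1) h1)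
      rwa [add_sub_cancel_left] at this
    have h3' : Cut True α 0 (dd P.D (-v)) := by rw [map_neg]; exact cut_neg h3
    have h4 := lemX P.comm P.pp (-v) h3'
    have h5 : coef α (dd P.D (-v)) = coef α θ ^ p - coef α θ := by
      have := h2.2
      rw [map_add, map_sub, coef_fmap, frb_apply] at this
      rw [map_neg, map_neg]
      linear_combination -this
    rw [h5] at h4
    obtain ⟨θ₁, c1, c2, c3⟩ := thmP s L P _ h4
    exact ⟨θ₁, c3, cut_zero_iff.2 ⟨cut_sub h1 c1, by rw [map_sub, c2, sub_self]⟩⟩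
  | succ r ih =>
    intro α θ v h1 h2
    set α1 := Function.update α r true with hα1
    set α0 := Function.update α r false with hα0
    have a1 : α1 r = true := by simp [α1]
    have a0 : α0 r = false := by simp [α0]
    have b1 : ∀ i, r < i → α1 i = α i := fun i hi => by
      simp [α1, Function.update_of_ne (show i ≠ r by omega)]
    have b0 : ∀ i, r < i → α0 i = α i := fun i hi => by
      simp [α0, Function.update_of_ne (show i ≠ r by omega)]
    obtain ⟨θ₁, ⟨w, hw⟩, g2⟩ := ih α1 θ v
      (cut_up (r' := r + 1) (by omega) (by omega) b1 id (fun x hx => by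
        rw [cut_true (by omega) a1, cut_low le_rfl]; exact Or.inl trivial) h1)
      (cut_up (r' := r + 1) (by omega) (by omega) b1 id (fun x hx => by
        rw [cut_low le_rfl] at hx
        rw [cut_true (by omega) a1, cut_low le_rfl]
        right; rw [hx.resolve_left id, map_zero]) h2)
    obtain ⟨θ₂, g3, g4⟩ := ih α0 (θ - θ₁) (v + w)
      (cut_up (r' := r) (by omega) (by omega) (fun i hi => by rw [b0 i hi, b1 i hi])
        False.elim (fun x hx => by
        rw [cut_true (by omega) a1, cut_low le_rfl] at hx
        rw [cut_false (by omega) a0, cut_low le_rfl]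
        exact ⟨hx.resolve_left id, Or.inl trivial⟩) g2)
      (cut_up (r' := r + 1) (by omega) (by omega) b0 id (fun x hx => by
        rw [cut_low le_rfl] at hx
        rw [cut_false (by omega) a0, cut_low le_rfl]
        rw [hx.resolve_left id, map_zero, map_zero]; exact ⟨rfl, Or.inr rfl⟩) (by
          have e : fmap (frb p L) (θ - θ₁) - (θ - θ₁) + dd P.D (v + w)
              = fmap (frb p L) θ - θ + dd P.D v := by
            rw [map_sub, map_add, ← hw]; abel
          rw [e]; exact h2))
    refine ⟨θ₁ + θ₂, exactAS_add ⟨w, hw⟩ g3, ?_⟩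
    rw [← sub_sub]
    exact cut_dn (fun i hi => (b0 i hi).symm) id (fun x hx => by
      rw [cut_false (by omega) a0, cut_low le_rfl] at hx
      rw [cut_low le_rfl]; right
      exact frm_ext ((hx.2.resolve_left id).trans (map_zero _).symm) (hx.1.trans (map_zero _).symm))
      g4

theorem thmLift (P : PB p (R + 1) L) (θ v : Frm L (R + 1))
    (h : fb (fmap (frb p L) θ - θ + dd P.D v) = 0) :
    ∃ θ₁, exactAS P θ₁ ∧ fb θ₁ = fb θ := by
  obtain ⟨θ₁, h1, h2⟩ := thmT P R (fun _ => true) θ v (by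
    rw [cut_true (by omega) rfl, cut_low le_rfl]; exact Or.inl trivial) (by
    rw [cut_true (by omega) rfl, cut_low le_rfl]; exact Or.inr h)
  rw [cut_true (by omega) rfl, cut_low le_rfl, map_sub] at h2
  exact ⟨θ₁, h1, (sub_eq_zero.1 (h2.resolve_left id)).symm⟩

end
end HK

namespace HK
universe u v
set_option linter.unusedSectionVars false

section
variable {p : ℕ} {K : Type u} [Field K] {s r : ℕ}

/-! ### more on Frm -/
def fone : {s : ℕ} → Frm K s
  | 0 => (1 : K)
  | _ + 1 => fmk fone 0

@[simp] lemma fa_fone : fa (fone : Frm K (s + 1)) = fone := rfl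
@[simp] lemma fb_fone : fb (fone : Frm K (s + 1)) = 0 := rfl

lemma proj_fone : proj 0 (fone : Frm K s) = fone := by
  induction s with
  | zero => rfl
  | succ s ih => apply frm_ext <;> simp [ih]

lemma mm_proj_zero (c : ℕ → K) (x : Frm K s) : proj 0 (mm c x) = 0 := by
  induction s with
  | zero => rfl
  | succ r ih => apply frm_ext <;> simp [ih]

lemma mm_proj (c : ℕ → K) (n : ℕ) (x : Frm K s) :
    mm c (proj n x) = proj (n + 1) (mm c x) := by
  induction s generalizing n with
  | zero => simp
  | succ r ih => cases n <;> apply frm_ext <;> simp [ih, fmap_proj, mm_proj_zero]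

lemma mm_of_zero {c : ℕ → K} (h : ∀ i < s, c i = 0) (x : Frm K s) : mm c x = 0 := by
  induction s with
  | zero => rfl
  | succ s ih =>
    have ih' := ih (fun i hi => h i (by omega))
    apply frm_ext
    · simp [ih']
    · rw [fb_mm, ih', h s (by omega), fmap_eq_zero (fun a => by simp)]; simp

lemma dd_fone {D : ℕ → K →+ K} (h : ∀ i < s, D i 1 = 0) : dd D (fone : Frm K s) = 0 := by
  induction s with
  | zero => rfl
  | succ s ih =>
    have ih' := ih (fun i hi => h i (by omega))
    have h1 : fmap (D s) (fone : Frm K s) = 0 := by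
      have : ∀ t, fmap (D s) (fone : Frm K t) = 0 := by
        intro t
        induction t with
        | zero => exact h s (by omega)
        | succ t ih => apply frm_ext <;> simp [ih]
      exact this s
    apply frm_ext
    · simp [ih']
    · simp [h1]

lemma fmap_sum {I : Type*} {M : Type v} [AddCommGroup M] (t : Finset I) (f : I → K →+ M)
    (x : Frm K s) : fmap (∑ i ∈ t, f i) x = ∑ i ∈ t, fmap (f i) x := by
  classical
  induction t using Finset.induction_on with
  | empty => simp [fmap_zero]
  | insert a t ha ih => rw [Finset.sum_insert ha, Finset.sum_insert ha, fmap_add, ih]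

/-! ### the coordinate map -/
abbrev Om (K : Type u) [Field K] := KaehlerDifferential ℤ K

def dlogK (a : K) : Om K := a⁻¹ • KaehlerDifferential.D ℤ K a

lemma dLog_eq_ι (a : K) : dLog K a = ExteriorAlgebra.ι K (dlogK a) := rfl

def ctr (c : Module.Dual K (Om K)) : DF K →ₗ[K] DF K := CliffordAlgebra.contractLeft c

lemma ctr_ι_mul (c : Module.Dual K (Om K)) (w : Om K) (ω : DF K) :
    ctr c (ExteriorAlgebra.ι K w * ω) = c w • ω - ExteriorAlgebra.ι K w * ctr c ω :=
  CliffordAlgebra.contractLeft_ι_mul (Q := 0) (d := c) w ω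

lemma ctr_one (c : Module.Dual K (Om K)) : ctr c (1 : DF K) = 0 :=
  CliffordAlgebra.contractLeft_one (Q := 0) (d := c)

def Phi (c : ℕ → Module.Dual K (Om K)) : {s : ℕ} → DF K →+ Frm K s
  | 0 => (ExteriorAlgebra.algebraMapInv (R := K) (M := Om K)).toLinearMap.toAddMonoidHom
  | s + 1 => hmk (Phi c) ((Phi c).comp (ctr (c s)).toAddMonoidHom)

variable (c : ℕ → Module.Dual K (Om K))

lemma Phi_zero (ω : DF K) : (Phi c ω : Frm K 0) = ExteriorAlgebra.algebraMapInv ω := rfl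
lemma fa_Phi (ω : DF K) : fa (Phi c ω : Frm K (s + 1)) = Phi c ω := rfl
lemma fb_Phi (ω : DF K) : fb (Phi c ω : Frm K (s + 1)) = Phi c (ctr (c s) ω) := rfl

lemma Phi_one : (Phi c (1 : DF K) : Frm K s) = fone := by
  induction s with
  | zero => rw [Phi_zero, map_one]; rfl
  | succ s ih =>
    apply frm_ext
    · rw [fa_Phi, ih]; rfl
    · rw [fb_Phi, ctr_one, map_zero]; rfl

lemma Phi_smul (a : K) (ω : DF K) : (Phi c (a • ω) : Frm K s) = fmap (mulL a) (Phi c ω) := by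
  induction s generalizing ω with
  | zero => rw [Phi_zero, map_smul]; rfl
  | succ s ih =>
    apply frm_ext
    · rw [fa_Phi, ih]; rfl
    · rw [fb_Phi, map_smul, ih]; rfl

lemma Phi_ι_mul (w : Om K) (ω : DF K) :
    (Phi c (ExteriorAlgebra.ι K w * ω) : Frm K s) = mm (fun i => c i w) (Phi c ω) := by
  induction s generalizing ω with
  | zero =>
    rw [Phi_zero, map_mul]
    have : ExteriorAlgebra.algebraMapInv (ExteriorAlgebra.ι K w) = 0 := by
      simp [ExteriorAlgebra.algebraMapInv]
    rw [this, zero_mul]; rfl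
  | succ s ih =>
    apply frm_ext
    · rw [fa_Phi, ih]; rfl
    · rw [fb_Phi, ctr_ι_mul, map_sub, Phi_smul, ih]; rfl

/-! ### the inverse map -/
def Psi (h : ℕ → K) : {s : ℕ} → Frm K s →+ DF K
  | 0 => (Algebra.linearMap K (DF K)).toAddMonoidHom
  | s + 1 => (Psi h).comp fa + (AddMonoidHom.mulLeft (dLog K (h s))).comp ((Psi h).comp fb)

variable {h : ℕ → K}

def v0 (x : Frm K 0) : K := x
lemma Psi_zero (x : Frm K 0) : Psi h x = v0 x • (1 : DF K) :=
  Algebra.algebraMap_eq_smul_one (R := K) (A := DF K) (v0 x)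
lemma Psi_succ (x : Frm K (s + 1)) : Psi h x = Psi h (fa x) + dLog K (h s) * Psi h (fb x) := rfl

lemma Psi_congr {h h' : ℕ → K} (hh : ∀ i < s, h i = h' i) (x : Frm K s) :
    Psi h x = Psi h' x := by
  induction s with
  | zero => rfl
  | succ s ih =>
    have ih' := ih (fun i hi => hh i (by omega))
    rw [Psi_succ, Psi_succ, ih', ih', hh s (by omega)]

lemma Psi_smul (a : K) (x : Frm K s) : Psi h (fmap (mulL a) x) = a • Psi h x := by
  induction s with
  | zero =>
    rw [Psi_zero, Psi_zero, smul_smul]; rfl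
  | succ s ih =>
    rw [Psi_succ, fa_fmap, fb_fmap, ih, ih, Psi_succ, smul_add, mul_smul_comm]

lemma dLog_anti (a b : K) (ω : DF K) :
    dLog K a * (dLog K b * ω) = - (dLog K b * (dLog K a * ω)) := by
  have := ExteriorAlgebra.ι_add_mul_swap (R := K) (dlogK a) (dlogK b)
  rw [← mul_assoc, ← mul_assoc, ← neg_mul, dLog_eq_ι, dLog_eq_ι]
  rw [eq_neg_of_add_eq_zero_left this]

lemma dLog_sq (a : K) (ω : DF K) : dLog K a * (dLog K a * ω) = 0 := by
  rw [← mul_assoc]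
  have := ExteriorAlgebra.ι_sq_zero (R := K) (dlogK a)
  rw [dLog_eq_ι, this, zero_mul]

lemma dLog_mul_Psi (k : ℕ) (hk : k < s) (x : Frm K s) :
    dLog K (h k) * Psi h x = Psi h (mm (fun i => if i = k then 1 else 0) x) := by
  induction s with
  | zero => omega
  | succ s ih =>
    rw [Psi_succ, Psi_succ, fa_mm, fb_mm, mul_add, map_sub]
    by_cases hks : k = s
    · subst hks
      rw [mm_of_zero (fun i hi => if_neg (by omega)), mm_of_zero (fun i hi => if_neg (by omega)),
        dLog_sq, if_pos rfl, fmap_eq_id (fun a => by simp)]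
      simp
    · rw [dLog_anti, ih (by omega), ih (by omega), if_neg (by omega),
        fmap_eq_zero (fun a => by simp), map_zero, zero_sub, mul_neg]

lemma Psi_mem {n : ℕ} {x : Frm K s} (hx : proj n x = x) : Psi h x ∈ omegaPow K n := by
  induction s generalizing n with
  | zero =>
    cases n with
    | zero =>
      rw [Psi_zero]
      apply Submodule.smul_mem
      unfold omegaPow; rw [pow_zero]; exact Submodule.one_le.1 le_rfl
    | succ n =>
      have : x = 0 := hx.symm
      rw [this, map_zero]; exact zero_mem _
  | succ s ih =>
    have h1 : proj n (fa x) = fa x := by rw [← fa_proj, hx]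
    rw [Psi_succ]
    refine add_mem (ih h1) ?_
    cases n with
    | zero =>
      have : fb x = 0 := by rw [← hx, fb_proj_zero]
      rw [this, map_zero, mul_zero]; exact zero_mem _
    | succ n =>
      exact dLog_mul_mem _ (ih (by rw [← fb_proj_succ, hx]))

variable [hp : Fact p.Prime] [CharP K p] (S : DiffStr p K)

lemma sp_Psi {n : ℕ} {x : Frm K s} (hx : proj n x = x) :
    ∃ η ∈ omegaPred K n, S.sp (Psi h x) = Psi h (fmap (frb p K) x) + S.d η := by
  induction s generalizing n with
  | zero =>
    cases n with
    | zero =>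
      obtain ⟨η, hη, e⟩ := S.sp_log 0 (v0 x) Fin.elim0
      refine ⟨η, hη, ?_⟩
      have : logForm K (Fin.elim0 : Fin 0 → K) = 1 := by simp [logForm]
      rw [this] at e
      rw [Psi_zero, Psi_zero]
      exact e
    | succ n =>
      have : x = 0 := hx.symm
      exact ⟨0, zero_mem _, by simp [this]⟩
  | succ s ih =>
    have h1 : proj n (fa x) = fa x := by rw [← fa_proj, hx]
    obtain ⟨η, hη, e⟩ := ih h1
    cases n with
    | zero =>
      have : fb x = 0 := by rw [← hx, fb_proj_zero]
      refine ⟨η, hη, ?_⟩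
      rw [Psi_succ, Psi_succ, fb_fmap, this, map_zero, map_zero, mul_zero, add_zero, map_zero,
        mul_zero, add_zero, e, fa_fmap]
    | succ n =>
      have h2 : proj n (fb x) = fb x := by rw [← fb_proj_succ, hx]
      obtain ⟨η', hη', e'⟩ := ih h2
      obtain ⟨ζ, hζ, e2⟩ := sp_dLog S (h s) (Psi h (fb x)) (Psi_mem h2)
      refine ⟨η + ζ - dLog K (h s) * η', sub_mem (add_mem hη hζ) (dLog_mul_mem_pred _ hη'), ?_⟩
      rw [Psi_succ, Psi_succ, fb_fmap, map_add, e, e2, e', map_sub, map_add, d_dLog_mul, fa_fmap,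
        mul_add]
      abel

lemma d_logForm {n : ℕ} (x : Fin n → K) : S.d (logForm K x) = 0 := by
  induction n with
  | zero => simp [logForm, S.d_one]
  | succ n ih =>
    rw [← Fin.cons_self_tail x, logForm_cons, d_dLog_mul, ih, mul_zero, neg_zero]

/-- compatibility of the coordinate map with `d` -/
lemma Phi_d {D : ℕ → K →+ K} (leib : ∀ i < s, ∀ a b, D i (a * b) = a * D i b + b * D i a)
    (comm : ∀ i < s, ∀ j < s, ∀ a, D i (D j a) = D j (D i a))
    (hc : ∀ i < s, ∀ a, c i (KaehlerDifferential.D ℤ K a) = D i a)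
    {n : ℕ} (ω : DF K) (hω : ω ∈ omegaPow K n) :
    (Phi c (S.d ω) : Frm K s) = dd D (Phi c ω) := by
  have key : ∀ (n : ℕ) (x : Fin n → K), dd D (Phi c (logForm K x) : Frm K s) = 0 := by
    intro n x
    induction n with
    | zero =>
      have : logForm K x = 1 := by simp [logForm]
      rw [this, Phi_one, dd_fone (fun i hi => der_one (leib i hi))]
    | succ n ih =>
      rw [← Fin.cons_self_tail x, logForm_cons, dLog_eq_ι, Phi_ι_mul, dd_mm leib ?_, ih, map_zero,
        neg_zero]
      intro i hi j hj
      set a := x 0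
      have hcj : ∀ j < s, c j (dlogK a) = a⁻¹ * D j a := by
        intro j hj
        rw [dlogK, map_smul, hc j hj]; rfl
      rw [hcj i hi, hcj j hj]
      by_cases ha : a = 0
      · simp [ha]
      have hinv : ∀ i < s, D i a⁻¹ = - (a⁻¹ * a⁻¹ * D i a) := by
        intro i hi
        have h1 := leib i hi a a⁻¹
        rw [mul_inv_cancel₀ ha, der_one (leib i hi)] at h1
        have : a⁻¹ * (a * D i a⁻¹ + a⁻¹ * D i a) = 0 := by rw [← h1, mul_zero]
        rw [mul_add, inv_mul_cancel_left₀ ha] at this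
        linear_combination this
      rw [leib i hi, leib j hj, hinv i hi, hinv j hj, comm i hi j hj]
      ring
  refine omegaPow_induction ?_ ?_ ?_ ω hω
  · simp
  · intro x y hx hy
    simp only [map_add, hx, hy]
  · intro a x
    rw [S.d_smul, d_logForm, smul_zero, add_zero, Phi_smul, dd_mul leib, key, map_zero, add_zero]
    unfold dForm
    rw [Phi_ι_mul]
    exact mm_congr (fun i hi => hc i hi a) _

/-- the coordinate map inverts `Psi` -/
lemma Phi_Psi_aux (hk : ∀ i < s, c r (dlogK (h i)) = 0) (x : Frm K s) :
    ctr (c r) (Psi h x) = 0 := by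
  induction s with
  | zero => rw [Psi_zero, map_smul, ctr_one, smul_zero]
  | succ s ih =>
    have ih' := ih (fun i hi => hk i (by omega))
    rw [Psi_succ, map_add, ih', dLog_eq_ι, ctr_ι_mul, ih', hk s (by omega)]
    simp

lemma Phi_Psi (hii : ∀ i < s, c i (dlogK (h i)) = 1)
    (hij : ∀ i < s, ∀ j < s, i ≠ j → c i (dlogK (h j)) = 0) (x : Frm K s) :
    Phi c (Psi h x) = x := by
  induction s with
  | zero =>
    rw [Psi_zero, Phi_zero, map_smul, map_one]; exact mul_one (M := K) x
  | succ s ih =>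
    have ih' := ih (fun i hi => hii i (by omega)) (fun i hi j hj => hij i (by omega) j (by omega))
    have h0 : ∀ x : Frm K s, ctr (c s) (Psi h x) = 0 := fun x =>
      Phi_Psi_aux c (fun i hi => hij s (by omega) i (by omega) (by omega)) x
    rw [Psi_succ]
    apply frm_ext
    · rw [fa_Phi, map_add, ih', dLog_eq_ι, Phi_ι_mul, mm_of_zero, add_zero]
      exact fun i hi => hij i (by omega) s (by omega) (by omega)
    · rw [fb_Phi, map_add, h0, zero_add, dLog_eq_ι, ctr_ι_mul, h0, mul_zero, sub_zero,
        hii s (by omega), one_smul, ih']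

lemma fb_Phi_Psi (hk : ∀ i < r, c s (dlogK (h i)) = 0) (x : Frm K r) :
    fb (Phi c (Psi h x) : Frm K (s + 1)) = 0 := by
  rw [fb_Phi, Phi_Psi_aux c hk, map_zero]

end
end HK

namespace HK
universe u v w
set_option linter.unusedSectionVars false

/-- full system of commuting logarithmic derivations dual to a `p`-basis -/
structure FS (p : ℕ) (I : Type w) (K : Type u) [Field K] where
  D : I → K →+ K
  g : I → K
  leib : ∀ i, ∀ a b, D i (a * b) = a * D i b + b * D i a
  comm : ∀ i j, ∀ a, D i (D j a) = D j (D i a)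
  pp : ∀ i, ∀ a, (⇑(D i))^[p] a = D i a
  gg : ∀ i, D i (g i) = g i
  gij : ∀ i j, i ≠ j → D i (g j) = 0
  g0 : ∀ i, g i ≠ 0
  span : ∀ w : Om K, w ∈ Submodule.span K (Set.range fun i => dlogK (g i))

section
variable {p : ℕ} {K : Type u} [Field K] {s r : ℕ} {I : Type w}

lemma Psi_fone {h : ℕ → K} : Psi h (fone : Frm K s) = 1 := by
  induction s with
  | zero => rw [Psi_zero]; exact one_smul K _
  | succ s ih => rw [Psi_succ, fa_fone, fb_fone, ih, map_zero, mul_zero, add_zero]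

lemma support_aux (g : I → K) (span : ∀ w : Om K, w ∈ Submodule.span K (Set.range fun i => dlogK (g i)))
    (n : ℕ) : ∀ ω ∈ omegaPow K n, ∃ T : Finset I, ∀ (s : ℕ) (f : ℕ → I),
      (∀ t ∈ T, ∃ k < s, f k = t) → ∃ y : Frm K s, proj n y = y ∧ ω = Psi (fun k => g (f k)) y := by
  classical
  induction n with
  | zero =>
    intro ω hω
    unfold omegaPow at hω
    rw [pow_zero, Submodule.mem_one] at hω
    obtain ⟨a, rfl⟩ := hω
    refine ⟨∅, fun s f _ => ⟨fmap (mulL a) fone, ?_, ?_⟩⟩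
    · rw [← fmap_proj, proj_fone]
    · rw [Psi_smul, Psi_fone, Algebra.algebraMap_eq_smul_one]
  | succ n ih =>
    intro ω hω
    unfold omegaPow at hω
    rw [pow_succ'] at hω
    induction hω using Submodule.mul_induction_on' with
    | mem_mul_mem x hx y hy =>
      obtain ⟨w, rfl⟩ := hx
      obtain ⟨T, hT⟩ := ih y hy
      have hw := span w
      induction hw using Submodule.span_induction with
      | mem x hx =>
        obtain ⟨i, rfl⟩ := hx
        refine ⟨insert i T, fun s f hf => ?_⟩
        obtain ⟨y', h1, h2⟩ := hT s f (fun t ht => hf t (Finset.mem_insert_of_mem ht))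
        obtain ⟨k, hk, rfl⟩ := hf i (Finset.mem_insert_self _ _)
        refine ⟨mm (fun i => if i = k then 1 else 0) y', ?_, ?_⟩
        · rw [← mm_proj, h1]
        · rw [h2]; exact dLog_mul_Psi (h := fun k => g (f k)) k hk y'
      | zero => exact ⟨∅, fun s f hf => ⟨0, by simp, by simp⟩⟩
      | add x z _ _ hx hz =>
        obtain ⟨T1, h1⟩ := hx
        obtain ⟨T2, h2⟩ := hz
        refine ⟨T1 ∪ T2, fun s f hf => ?_⟩
        obtain ⟨y1, a1, b1⟩ := h1 s f (fun t ht => hf t (Finset.mem_union_left _ ht))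
        obtain ⟨y2, a2, b2⟩ := h2 s f (fun t ht => hf t (Finset.mem_union_right _ ht))
        exact ⟨y1 + y2, by rw [map_add, a1, a2], by rw [map_add, add_mul, b1, b2, map_add]⟩
      | smul a x _ hx =>
        obtain ⟨T1, h1⟩ := hx
        refine ⟨T1, fun s f hf => ?_⟩
        obtain ⟨y1, a1, b1⟩ := h1 s f hf
        exact ⟨fmap (mulL a) y1, by rw [← fmap_proj, a1], by
          rw [map_smul, smul_mul_assoc, b1, Psi_smul]⟩
    | add x _ z _ hx hz =>
      obtain ⟨T1, h1⟩ := hx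
      obtain ⟨T2, h2⟩ := hz
      refine ⟨T1 ∪ T2, fun s f hf => ?_⟩
      obtain ⟨y1, a1, b1⟩ := h1 s f (fun t ht => hf t (Finset.mem_union_left _ ht))
      obtain ⟨y2, a2, b2⟩ := h2 s f (fun t ht => hf t (Finset.mem_union_right _ ht))
      exact ⟨y1 + y2, by rw [map_add, a1, a2], by rw [b1, b2, map_add]⟩

namespace FS
variable (Γ : FS p I K)

lemma support {n : ℕ} {ω : DF K} (hω : ω ∈ omegaPow K n) : ∃ T : Finset I,
    ∀ (s : ℕ) (f : ℕ → I), (∀ t ∈ T, ∃ k < s, f k = t) →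
      ∃ y : Frm K s, proj n y = y ∧ ω = Psi (fun k => Γ.g (f k)) y :=
  support_aux Γ.g Γ.span n ω hω

def c (i : I) : Module.Dual K (Om K) := (addDer (Γ.D i) (Γ.leib i)).liftKaehlerDifferential

lemma c_D (i : I) (a : K) : Γ.c i (KaehlerDifferential.D ℤ K a) = Γ.D i a :=
  Derivation.liftKaehlerDifferential_comp_D _ a

lemma c_dlog (i : I) (a : K) : Γ.c i (dlogK a) = a⁻¹ * Γ.D i a := by
  rw [dlogK, map_smul, c_D]; rfl

lemma c_self (i : I) : Γ.c i (dlogK (Γ.g i)) = 1 := by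
  rw [c_dlog, Γ.gg, inv_mul_cancel₀ (Γ.g0 i)]

lemma c_ne {i j : I} (h : i ≠ j) : Γ.c i (dlogK (Γ.g j)) = 0 := by
  rw [c_dlog, Γ.gij i j h, mul_zero]

lemma ext0 {x : Om K} (h : ∀ i, Γ.c i x = 0) : x = 0 := by
  obtain ⟨l, rfl⟩ := (Finsupp.mem_span_range_iff_exists_finsupp).1 (Γ.span x)
  have : l = 0 := by
    ext i
    have := h i
    rw [Finsupp.sum, map_sum, Finset.sum_eq_single i] at this
    · simpa [c_self] using this
    · intro j _ hj
      rw [map_smul, c_ne Γ (Ne.symm hj), smul_zero]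
    · intro hi
      simp [Finsupp.notMem_support_iff.1 hi]
  simp [this]

def pb (f : ℕ → I) (s : ℕ) (hf : ∀ i < s, ∀ j < s, i ≠ j → f i ≠ f j) : PB p s K where
  D k := Γ.D (f k)
  g k := Γ.g (f k)
  leib _ _ := Γ.leib _
  comm _ _ _ _ := Γ.comm _ _
  pp _ _ := Γ.pp _
  gg _ _ := Γ.gg _
  gij i hi j hj h := Γ.gij _ _ (hf i hi j hj h)
  g0 _ _ := Γ.g0 _

lemma Phi_Psi {f : ℕ → I} (hf : ∀ i < s, ∀ j < s, i ≠ j → f i ≠ f j) (x : Frm K s) :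
    Phi (fun k => Γ.c (f k)) (Psi (fun k => Γ.g (f k)) x) = x :=
  HK.Phi_Psi _ (fun _ _ => Γ.c_self _) (fun i hi j hj h => Γ.c_ne (hf i hi j hj h)) x

variable [hp : Fact p.Prime] [CharP K p]

lemma Phi_d (S : DiffStr p K) (f : ℕ → I) {n : ℕ} {ω : DF K} (hω : ω ∈ omegaPow K n) :
    (Phi (fun k => Γ.c (f k)) (S.d ω) : Frm K s) =
      dd (fun k => Γ.D (f k)) (Phi (fun k => Γ.c (f k)) ω) :=
  HK.Phi_d _ S (fun _ _ => Γ.leib _) (fun _ _ _ _ => Γ.comm _ _) (fun _ _ => Γ.c_D _) ω hω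

/-- `D_j` detects the top slot for indices not involved -/
lemma fb_Phi_d (S : DiffStr p K) {f : ℕ → I} (hf : ∀ i < s, ∀ j < s, i ≠ j → f i ≠ f j)
    {j : I} (hj : ∀ k < s, f k ≠ j) {n : ℕ} {y : Frm K s} (hy : proj n y = y) :
    fb (Phi (fun k => Γ.c (if k < s then f k else j)) (S.d (Psi (fun k => Γ.g (f k)) y))
      : Frm K (s + 1)) = fmap (Γ.D j) y := by
  set f' : ℕ → I := fun k => if k < s then f k else j with hf'
  have e1 : ∀ k < s, f' k = f k := fun k hk => if_pos hk
  have e2 : f' s = j := if_neg (lt_irrefl _)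
  rw [Γ.Phi_d S f' (Psi_mem hy), fb_dd, fa_Phi, fb_Phi]
  rw [Psi_congr (h' := fun k => Γ.g (f' k)) (fun i hi => by rw [e1 i hi])]
  rw [Γ.Phi_Psi (f := f') (fun i hi j hj h => by rw [e1 i hi, e1 j hj]; exact hf i hi j hj h)]
  have e3 : ctr (Γ.c (f' s)) (Psi (fun k => Γ.g (f' k)) y) = 0 := by
    refine Phi_Psi_aux (fun k => Γ.c (f' k)) (r := s) (fun i hi => ?_) y
    apply Γ.c_ne
    rw [e2, e1 i hi]
    exact (hj i hi).symm
  rw [e3, map_zero, map_zero, sub_zero, e2]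

lemma dForm_eq_sum {f : ℕ → I} (hf : ∀ i < s, ∀ j < s, i ≠ j → f i ≠ f j) {a : K}
    (ha : ∀ j, (∀ k < s, f k ≠ j) → Γ.D j a = 0) :
    dForm K a = ∑ k ∈ Finset.range s, Γ.D (f k) a • dLog K (Γ.g (f k)) := by
  have : KaehlerDifferential.D ℤ K a = ∑ k ∈ Finset.range s, Γ.D (f k) a • dlogK (Γ.g (f k)) := by
    rw [← sub_eq_zero]
    apply Γ.ext0
    intro i
    rw [map_sub, c_D, map_sum, sub_eq_zero]
    by_cases hi : ∃ k < s, f k = i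
    · obtain ⟨k, hk, rfl⟩ := hi
      rw [Finset.sum_eq_single k]
      · rw [map_smul, c_self]; simp
      · intro j hj hjk
        rw [map_smul, Γ.c_ne (hf k hk j (Finset.mem_range.1 hj) hjk.symm), smul_zero]
      · intro h; exact absurd (Finset.mem_range.2 hk) h
    · push Not at hi
      rw [ha i hi, Finset.sum_eq_zero]
      intro j hj
      rw [map_smul, Γ.c_ne (hi j (Finset.mem_range.1 hj)).symm, smul_zero]
  unfold dForm
  rw [this, map_sum]
  refine Finset.sum_congr rfl fun k _ => ?_
  rw [map_smul]; rfl

lemma d_Psi_aux (S : DiffStr p K) {f : ℕ → I} (hf : ∀ i < s, ∀ j < s, i ≠ j → f i ≠ f j)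
    (h : ℕ → K) (r : ℕ) (y : Frm K r) (hy : ∀ j, (∀ k < s, f k ≠ j) → fmap (Γ.D j) y = 0) :
    S.d (Psi h y) =
      ∑ k ∈ Finset.range s, dLog K (Γ.g (f k)) * Psi h (fmap (Γ.D (f k)) y) := by
  induction r with
  | zero =>
    have hd := Γ.dForm_eq_sum hf (a := v0 y) hy
    rw [Psi_zero, S.d_smul, S.d_one, smul_zero, add_zero, mul_one, hd]
    refine Finset.sum_congr rfl fun k _ => ?_
    rw [Psi_zero, mul_smul_comm, mul_one]; rfl
  | succ r ih =>
    have h1 := ih (fa y) (fun j hj => by rw [← fa_fmap, hy j hj, map_zero])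
    have h2 := ih (fb y) (fun j hj => by rw [← fb_fmap, hy j hj, map_zero])
    rw [Psi_succ, map_add, d_dLog_mul, h1, h2, Finset.mul_sum, ← Finset.sum_neg_distrib,
      ← Finset.sum_add_distrib]
    refine Finset.sum_congr rfl fun k _ => ?_
    rw [Psi_succ, mul_add, dLog_anti (h r), neg_neg]; rfl

lemma sum_Psi (D : ℕ → K →+ K) (h : ℕ → K) (y : Frm K s) :
    ∑ k ∈ Finset.range s, dLog K (h k) * Psi h (fmap (D k) y) = Psi h (dd D y) := by
  induction s with
  | zero => simp
  | succ s ih =>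
    rw [Finset.sum_range_succ]
    simp only [Psi_succ, mul_add, Finset.sum_add_distrib, fa_fmap, fb_fmap, fa_dd, fb_dd, ih,
      dLog_sq, add_zero, map_sub, mul_sub]
    simp only [fun k => dLog_anti (h k) (h s), Finset.sum_neg_distrib]
    rw [← Finset.mul_sum, ih]
    abel

end FS
end
end HK

namespace HK
universe u v w
set_option linter.unusedSectionVars false

/-- data of a simple purely inseparable extension -/
structure SPI (p e : ℕ) (K : Type u) (E : Type v) [Field K] [Field E] [Algebra K E] where
  β : E
  b : K
  hβ : β ^ p ^ e = algebraMap K E b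
  comp : ℕ → E →+ K
  comp_mul : ∀ l < p ^ e, ∀ (a : K) (m : ℕ),
    comp l (algebraMap K E a * β ^ m) = if m % p ^ e = l then a * b ^ (m / p ^ e) else 0
  sum_comp : ∀ x, x = ∑ l ∈ Finset.range (p ^ e), algebraMap K E (comp l x) * β ^ l

section
variable {p e : ℕ} [hp : Fact p.Prime] {K : Type u} {E : Type v} [Field K] [Field E] [Algebra K E]
  [CharP K p] [CharP E p]

open Polynomial in
lemma minpoly_spi {b : K} (hb : ¬ ∃ y : K, y ^ p = b) {β : E}
    (hβ : β ^ p ^ e = algebraMap K E b) : minpoly K β = X ^ p ^ e - C b := by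
  have : ExpChar K p := ExpChar.prime hp.out
  have h1 : (minpoly K β).natSepDegree = 1 := by
    rw [minpoly.natSepDegree_eq_one_iff_pow_mem p]
    exact ⟨e, b, hβ.symm⟩
  obtain ⟨n, y, hn⟩ := (minpoly.natSepDegree_eq_one_iff_eq_X_pow_sub_C p).1 h1
  have hq : (X ^ p ^ e - C b : K[X]) ≠ 0 :=
    (monic_X_pow_sub_C b (pow_pos hp.out.pos e).ne').ne_zero
  have h2 : minpoly K β ∣ X ^ p ^ e - C b := minpoly.dvd _ _ (by simp [hβ])
  have h3 := natDegree_le_of_dvd h2 hq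
  rw [hn, natDegree_X_pow_sub_C, natDegree_X_pow_sub_C] at h3
  have h4 : n ≤ e := (Nat.pow_le_pow_iff_right hp.out.one_lt).1 h3
  have h5 : β ^ p ^ n = algebraMap K E y := by
    have := minpoly.aeval K β
    rw [hn] at this
    simpa [sub_eq_zero] using this
  have h6 : y ^ p ^ (e - n) = b := by
    apply (algebraMap K E).injective
    rw [map_pow, ← h5, ← hβ, ← pow_mul, ← pow_add, Nat.add_sub_cancel' h4]
  have h7 : n = e := by
    by_contra hne
    apply hb
    refine ⟨y ^ p ^ (e - n - 1), ?_⟩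
    rw [← pow_mul, ← pow_succ, ← h6]
    congr 2
    omega
  subst h7
  rw [hn]
  simp at h6
  rw [h6]

theorem exists_spi {b : K} (hb : ¬ ∃ y : K, y ^ p = b) {β : E}
    (hβ : β ^ p ^ e = algebraMap K E b) (hgen : Algebra.adjoin K {β} = ⊤) :
    ∃ X : SPI p e K E, X.β = β ∧ X.b = b := by
  have hq : 0 < p ^ e := pow_pos hp.out.pos e
  have hIntg : IsIntegral K β := by
    rw [← minpoly.ne_zero_iff, minpoly_spi hb hβ]
    exact (Polynomial.monic_X_pow_sub_C b hq.ne').ne_zero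
  let B := PowerBasis.ofAdjoinEqTop hIntg hgen
  have hdim : B.dim = p ^ e := by
    rw [PowerBasis.ofAdjoinEqTop_dim, minpoly_spi hb hβ, Polynomial.natDegree_X_pow_sub_C]
  have hBl : ∀ l : Fin B.dim, B.basis l = β ^ (l : ℕ) := fun l => by
    rw [B.basis_eq_pow, PowerBasis.ofAdjoinEqTop_gen]
  let comp : ℕ → E →+ K := fun l =>
    if h : l < B.dim then (B.basis.coord ⟨l, h⟩).toAddMonoidHom else 0
  have hc : ∀ l (h : l < B.dim) x, comp l x = B.basis.coord ⟨l, h⟩ x := by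
    intro l h x
    simp only [comp, dif_pos h]; rfl
  refine ⟨⟨β, b, hβ, comp, ?_, ?_⟩, rfl, rfl⟩
  · intro l hl a m
    have hl' : l < B.dim := by omega
    have hm : m % p ^ e < B.dim := by rw [hdim]; exact Nat.mod_lt _ hq
    have : algebraMap K E a * β ^ m = (a * b ^ (m / p ^ e)) • B.basis ⟨m % p ^ e, hm⟩ := by
      rw [hBl, Algebra.smul_def, map_mul, map_pow, ← hβ, ← pow_mul, mul_assoc, ← pow_add,
        Nat.div_add_mod]
    rw [hc l hl', this, map_smul, B.basis.coord_apply, B.basis.repr_self, Finsupp.single_apply]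
    simp
  · intro x
    conv_lhs => rw [← B.basis.sum_repr x]
    rw [← hdim, Finset.sum_range]
    refine Finset.sum_congr rfl fun l _ => ?_
    rw [hc l l.2, hBl, Algebra.smul_def]; rfl

namespace SPI
variable (X : SPI p e K E)

lemma addext {A : Type*} [AddCommGroup A] {f g : E →+ A}
    (h : ∀ (a : K) (m : ℕ), f (algebraMap K E a * X.β ^ m) = g (algebraMap K E a * X.β ^ m)) (x : E) :
    f x = g x := by
  rw [X.sum_comp x, map_sum, map_sum]
  exact Finset.sum_congr rfl fun l _ => h _ _

/-- coefficientwise extension -/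
def ext (φ : K →+ K) : E →+ E :=
  ∑ l ∈ Finset.range (p ^ e), (AddMonoidHom.mulRight (X.β ^ l)).comp
    ((algebraMap K E).toAddMonoidHom.comp (φ.comp (X.comp l)))

lemma ext_apply (φ : K →+ K) (x : E) : X.ext φ x =
    ∑ l ∈ Finset.range (p ^ e), algebraMap K E (φ (X.comp l x)) * X.β ^ l := by
  simp [ext]

lemma hqm (m : ℕ) : m % p ^ e < p ^ e := Nat.mod_lt _ (pow_pos hp.out.pos e)

lemma sum_mul (φ : ℕ → K →+ K) (a : K) (m : ℕ) :
    ∑ l ∈ Finset.range (p ^ e), algebraMap K E (φ l (X.comp l (algebraMap K E a * X.β ^ m))) * X.β ^ l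
     = algebraMap K E (φ (m % p ^ e) (a * X.b ^ (m / p ^ e))) * X.β ^ (m % p ^ e) := by
  rw [Finset.sum_eq_single (m % p ^ e)]
  · rw [X.comp_mul _ (hqm m), if_pos rfl]
  · intro l hl hne
    rw [X.comp_mul _ (Finset.mem_range.1 hl), if_neg hne.symm]; simp
  · intro h; exact absurd (Finset.mem_range.2 (hqm m)) h

lemma pow_split (m : ℕ) : algebraMap K E (X.b ^ (m / p ^ e)) * X.β ^ (m % p ^ e) = X.β ^ m := by
  rw [map_pow, ← X.hβ, ← pow_mul, ← pow_add, Nat.div_add_mod]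

lemma ext_mul {φ : K →+ K} (hφ : ∀ a, φ (a * X.b) = φ a * X.b) (a : K) (m : ℕ) :
    X.ext φ (algebraMap K E a * X.β ^ m) = algebraMap K E (φ a) * X.β ^ m := by
  have : ∀ k, φ (a * X.b ^ k) = φ a * X.b ^ k := by
    intro k
    induction k with
    | zero => simp
    | succ k ih => rw [pow_succ, ← mul_assoc, hφ, ih, mul_assoc]
  rw [ext_apply, X.sum_mul (fun _ => φ), this, map_mul, mul_assoc, X.pow_split]

/-- the log derivation with respect to `β` -/
def der : E →+ E :=
  ∑ l ∈ Finset.range (p ^ e), (AddMonoidHom.mulRight (X.β ^ l)).comp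
    ((algebraMap K E).toAddMonoidHom.comp ((mulL (l : K)).comp (X.comp l)))

lemma der_apply (x : E) : X.der x =
    ∑ l ∈ Finset.range (p ^ e), algebraMap K E (l * X.comp l x) * X.β ^ l := by
  simp [der]

lemma der_mul (he : 0 < e) (a : K) (m : ℕ) :
    X.der (algebraMap K E a * X.β ^ m) = algebraMap K E ((m : K) * a) * X.β ^ m := by
  have h := X.sum_mul (fun l => mulL (l : K)) a m
  rw [der_apply]
  refine h.trans ?_
  have hm : ((m % p ^ e : ℕ) : K) = m := by
    conv_rhs => rw [← Nat.div_add_mod m (p ^ e)]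
    have : ((p ^ e : ℕ) : K) = 0 := by
      rw [Nat.cast_pow, CharP.cast_eq_zero, zero_pow he.ne']
    rw [Nat.cast_add, Nat.cast_mul, this, zero_mul, zero_add]
  simp only [AddMonoidHom.coe_mulLeft, hm]
  rw [← mul_assoc, map_mul, mul_assoc, X.pow_split]

lemma leib_of {D : E →+ E} {ψ : ℕ → K →+ K}
    (hD : ∀ a m, D (algebraMap K E a * X.β ^ m) = algebraMap K E (ψ m a) * X.β ^ m)
    (h : ∀ a a' m m', ψ (m + m') (a * a') = a * ψ m' a' + a' * ψ m a) (x y : E) :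
    D (x * y) = x * D y + y * D x := by
  have h1 : ∀ a m, D (x * (algebraMap K E a * X.β ^ m)) = x * D (algebraMap K E a * X.β ^ m)
      + algebraMap K E a * X.β ^ m * D x := by
    intro a m
    refine X.addext (f := D.comp (AddMonoidHom.mulRight (algebraMap K E a * X.β ^ m)))
      (g := AddMonoidHom.mulRight (D (algebraMap K E a * X.β ^ m)) +
        (AddMonoidHom.mulLeft (algebraMap K E a * X.β ^ m)).comp D) (fun a' m' => ?_) x
    simp only [AddMonoidHom.comp_apply, AddMonoidHom.add_apply, AddMonoidHom.coe_mulLeft,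
      AddMonoidHom.coe_mulRight]
    have : algebraMap K E a' * X.β ^ m' * (algebraMap K E a * X.β ^ m)
      = algebraMap K E (a' * a) * X.β ^ (m' + m) := by rw [map_mul, pow_add]; ring
    rw [this, hD, hD, hD, h, map_add, map_mul, map_mul, pow_add]
    ring
  refine X.addext (f := D.comp (AddMonoidHom.mulLeft x))
      (g := (AddMonoidHom.mulLeft x).comp D + AddMonoidHom.mulRight (D x)) (fun a m => ?_) y
  simpa using h1 a m

lemma ext_leib {φ : K →+ K} (h : ∀ a b, φ (a * b) = a * φ b + b * φ a) (hb : φ X.b = 0) (x y : E) :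
    X.ext φ (x * y) = x * X.ext φ y + y * X.ext φ x :=
  X.leib_of (ψ := fun _ => φ) (X.ext_mul (fun a => by rw [h, hb, mul_zero, zero_add, mul_comm]))
    (fun a a' _ _ => h a a') x y

lemma der_leib (he : 0 < e) (x y : E) : X.der (x * y) = x * X.der y + y * X.der x :=
  X.leib_of (ψ := fun m => mulL (m : K)) (X.der_mul he)
    (fun a a' m m' => by simp only [AddMonoidHom.coe_mulLeft]; push_cast; ring) x y

lemma comm_of {D D' : E →+ E} {ψ ψ' : ℕ → K →+ K}
    (hD : ∀ a m, D (algebraMap K E a * X.β ^ m) = algebraMap K E (ψ m a) * X.β ^ m)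
    (hD' : ∀ a m, D' (algebraMap K E a * X.β ^ m) = algebraMap K E (ψ' m a) * X.β ^ m)
    (h : ∀ m a, ψ m (ψ' m a) = ψ' m (ψ m a)) (x : E) : D (D' x) = D' (D x) :=
  X.addext (f := D.comp D') (g := D'.comp D) (fun a m => by simp [hD, hD', h]) x

lemma iter_of {D : E →+ E} {ψ : ℕ → K →+ K}
    (hD : ∀ a m, D (algebraMap K E a * X.β ^ m) = algebraMap K E (ψ m a) * X.β ^ m)
    (h : ∀ m a, (⇑(ψ m))^[p] a = ψ m a) (x : E) : (⇑D)^[p] x = D x := by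
  have h1 : ∀ k a m, (⇑D)^[k] (algebraMap K E a * X.β ^ m)
      = algebraMap K E ((⇑(ψ m))^[k] a) * X.β ^ m := by
    intro k
    induction k with
    | zero => intro a m; rfl
    | succ k ih => intro a m; rw [Function.iterate_succ_apply, hD, ih, Function.iterate_succ_apply]
  have h2 := X.addext (f := itH D p) (g := D) (fun a m => by rw [itH_apply, h1, hD, h]) x
  rwa [itH_apply] at h2

lemma comp_of {D : E →+ E} {ψ : ℕ → K →+ K}
    (hD : ∀ a m, D (algebraMap K E a * X.β ^ m) = algebraMap K E (ψ m a) * X.β ^ m)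
    {l : ℕ} (hl : l < p ^ e) (x : E) : X.comp l (D x) = ψ l (X.comp l x) := by
  conv_lhs => rw [X.sum_comp x, map_sum, map_sum]
  rw [Finset.sum_eq_single l]
  · rw [hD, X.comp_mul l hl, Nat.mod_eq_of_lt hl, if_pos rfl, Nat.div_eq_of_lt hl]; simp
  · intro m hm hne
    rw [hD, X.comp_mul l hl, Nat.mod_eq_of_lt (Finset.mem_range.1 hm), if_neg hne]
  · intro h; exact absurd (Finset.mem_range.2 hl) h

lemma comp_algebraMap {l : ℕ} (hl : l < p ^ e) (a : K) :
    X.comp l (algebraMap K E a) = if l = 0 then a else 0 := by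
  have := X.comp_mul l hl a 0
  simpa [eq_comm] using this

lemma comp_frob {l : ℕ} (hl : l < p ^ e) (x : E) : X.comp l (x ^ p) =
    ∑ m ∈ Finset.range (p ^ e), if p * m % p ^ e = l then
      X.b ^ (p * m / p ^ e) * X.comp m x ^ p else 0 := by
  conv_lhs => rw [X.sum_comp x, sum_pow_char, map_sum]
  refine Finset.sum_congr rfl fun m _ => ?_
  rw [mul_pow, ← map_pow, ← pow_mul, mul_comm m p, X.comp_mul l hl]
  split_ifs
  · rw [mul_comm]
  · rfl

end SPI
end
end HK

namespace HK
universe u v w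
set_option linter.unusedSectionVars false

section
variable {p : ℕ} [hp : Fact p.Prime] {K : Type u} [Field K] [CharP K p]

lemma iter_der {D : K →+ K} (h : ∀ a b, D (a * b) = a * D b + b * D a) (a z : K) :
    (⇑D)^[p] (a * z) = a * (⇑D)^[p] z + z * (⇑D)^[p] a := by
  by_cases ha : a = 0
  · subst ha; simp [← itH_apply]
  set c := D a / a with hc
  have h1 : ∀ n z, a * (fun z => D z + c * z)^[n] z = (⇑D)^[n] (a * z) := by
    intro n
    induction n with
    | zero => intro z; rfl
    | succ n ih =>
      intro z
      rw [Function.iterate_succ_apply, ih, Function.iterate_succ_apply, h, mul_add, hc]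
      congr 2
      field_simp
  have h2 := fun f => jac_apply (p := p) (addDer D h) c f
  have h3 : (⇑D)^[p] 1 = 0 := by
    obtain ⟨k, hk⟩ : ∃ k, p = k + 1 := ⟨p - 1, by have := hp.out.pos; omega⟩
    rw [hk, ← itH_apply]
    exact itH_killed (der_one h) k
  have h4 : ∀ f, (⇑D)^[p] (a * f) = a * ((⇑D)^[p] f + ((⇑D)^[p - 1] c + c ^ p) * f) := by
    intro f
    rw [← h1]
    congr 1
    exact h2 f
  have h5 := h4 1
  rw [h3, mul_one, mul_one, zero_add] at h5
  rw [h4, h5]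
  ring

lemma exists_max (b : K) (hb : ¬ ∃ y : K, y ^ p = b) : ∃ M : Subfield K,
    (∀ x : K, x ^ p ∈ M) ∧ b ∉ M ∧ ∀ x : K, x ∉ M → ∀ N : Subfield K, M ≤ N → x ∈ N → b ∈ N := by
  obtain ⟨M, h1, h2⟩ := zorn_le_nonempty₀
    {M : Subfield K | (frobenius K p).fieldRange ≤ M ∧ b ∉ M} (by
      intro c hc hch y hy
      refine ⟨sSup c, ⟨(hc hy).1.trans (le_sSup hy), ?_⟩, fun z hz => le_sSup hz⟩
      rw [Subfield.mem_sSup_of_directedOn ⟨y, hy⟩ hch.directedOn]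
      rintro ⟨M, hM, hbM⟩
      exact (hc hM).2 hbM) (frobenius K p).fieldRange ⟨le_rfl, by
        rintro ⟨y, hy⟩; exact hb ⟨y, hy⟩⟩
  refine ⟨M, fun x => h1 ⟨x, rfl⟩, h2.1.2, fun x hx N hMN hxN => ?_⟩
  by_contra hbN
  exact hx (h2.2 ⟨h1.trans hMN, hbN⟩ hMN hxN)

open IntermediateField in
theorem exists_der (b : K) (hb : ¬ ∃ y : K, y ^ p = b) :
    ∃ D : K →+ K, (∀ x y, D (x * y) = x * D y + y * D x) ∧ D b = b := by
  obtain ⟨M, hM, hbM, hmax⟩ := exists_max b hb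
  have : CharP M p := charP_sub M
  have hnp : ∀ x : K, x ∉ M → ¬ ∃ y : M, y ^ p = (⟨x ^ p, hM x⟩ : M) := by
    rintro x hx ⟨y, hy⟩
    apply hx
    have : (y : K) ^ p = x ^ p := congrArg Subtype.val hy
    have := frobenius_inj K p this
    rw [← this]; exact y.2
  have hIntg : ∀ x : K, IsIntegral M x := fun x =>
    IsIntegral.of_pow hp.out.pos (isIntegral_algebraMap (x := (⟨x ^ p, hM x⟩ : M)))
  have hrk : ∀ x : K, x ∉ M → Module.finrank M M⟮x⟯ = p := by
    intro x hx
    rw [adjoin.finrank (hIntg x), minpoly_spi (e := 1) (hnp x hx) (by rw [pow_one]; rfl),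
      Polynomial.natDegree_X_pow_sub_C, pow_one]
  have htop : M⟮b⟯ = ⊤ := by
    rw [eq_top_iff]
    intro x _
    by_cases hx : x ∈ M
    · exact M⟮b⟯.algebraMap_mem ⟨x, hx⟩
    · have hbx : b ∈ M⟮x⟯ := by
        refine hmax x hx M⟮x⟯.toSubfield (fun y hy => M⟮x⟯.algebraMap_mem ⟨y, hy⟩) ?_
        exact mem_adjoin_simple_self M x
      have hle : M⟮b⟯ ≤ M⟮x⟯ := by
        rw [adjoin_simple_le_iff]; exact hbx
      have : FiniteDimensional M M⟮x⟯ := adjoin.finiteDimensional (hIntg x)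
      have := eq_of_le_of_finrank_eq hle (by rw [hrk b hbM, hrk x hx])
      rw [this]
      exact mem_adjoin_simple_self M x
  have hgen : Algebra.adjoin M {b} = ⊤ := by
    rw [← adjoin_simple_toSubalgebra_of_isAlgebraic (hIntg b).isAlgebraic, htop]
    rfl
  obtain ⟨X, hX, hX'⟩ := exists_spi (p := p) (e := 1) (hnp b hbM) (β := b) (by rw [pow_one]; rfl) hgen
  refine ⟨X.der, X.der_leib one_pos, ?_⟩
  have := X.der_mul one_pos 1 1
  simpa [hX] using this

theorem exists_FS (b : K) (hb : ¬ ∃ y : K, y ^ p = b) :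
    ∃ (I : Type u) (Γ : FS p I K) (i0 : I), Γ.g i0 = b := by
  classical
  obtain ⟨D, hD, hDb⟩ := exists_der b hb
  have hb0 : b ≠ 0 := by rintro rfl; exact hb ⟨0, zero_pow hp.out.ne_zero⟩
  have hne : dlogK b ≠ 0 := by
    intro h
    have h1 := congrArg (addDer D hD).liftKaehlerDifferential h
    rw [dlogK, map_smul, Derivation.liftKaehlerDifferential_comp_D, map_zero] at h1
    have : b⁻¹ * D b = 0 := h1
    rw [hDb, inv_mul_cancel₀ hb0] at this
    exact one_ne_zero this
  have hs : LinearIndepOn K id {dlogK b} := LinearIndepOn.singleton hne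
  have hst : ({dlogK b} : Set (Om K)) ⊆ Set.range (dlogK (K := K)) := by
    rw [Set.singleton_subset_iff]; exact ⟨b, rfl⟩
  have ht : ⊤ ≤ Submodule.span K (Set.range (dlogK (K := K))) := by
    rw [← KaehlerDifferential.span_range_derivation, Submodule.span_le]
    rintro _ ⟨a, rfl⟩
    by_cases ha : a = 0
    · rw [ha, map_zero]; exact zero_mem _
    · have : KaehlerDifferential.D ℤ K a = a • dlogK a := by
        rw [dlogK, smul_smul, mul_inv_cancel₀ ha, one_smul]
      rw [this]
      exact Submodule.smul_mem _ _ (Submodule.subset_span ⟨a, rfl⟩)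
  let B := Module.Basis.extendLe hs hst ht
  have hBr : ∀ i, ∃ a, dlogK a = B i := fun i =>
    Module.Basis.extendLe_subset hs hst ht ⟨i, rfl⟩
  obtain ⟨i0, hi0⟩ : ∃ i0, B i0 = dlogK b := Module.Basis.subset_extendLe hs hst ht rfl
  obtain ⟨g, hg, hgb⟩ : ∃ g : _ → K, (∀ i, dlogK (g i) = B i) ∧ g i0 = b := by
    choose g hg using hBr
    refine ⟨Function.update g i0 b, fun i => ?_, by simp⟩
    by_cases h : i = i0
    · subst h; simp [hi0]
    · simp [h, hg]
  have hg0 : ∀ i, g i ≠ 0 := by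
    intro i h
    have := hg i
    rw [h, dlogK, inv_zero, zero_smul] at this
    exact B.ne_zero i this.symm
  let δ : _ → Derivation ℤ K K := fun i => (B.coord i).compDer (KaehlerDifferential.D ℤ K)
  have hδ : ∀ i j, δ i (g j) = if j = i then g j else 0 := by
    intro i j
    have : KaehlerDifferential.D ℤ K (g j) = g j • B j := by
      rw [← hg, dlogK, smul_smul, mul_inv_cancel₀ (hg0 j), one_smul]
    change B.coord i (KaehlerDifferential.D ℤ K (g j)) = _
    rw [this, map_smul, B.coord_apply, B.repr_self, Finsupp.single_apply]
    simp
  have key : ∀ τ : Derivation ℤ K K, (∀ i, τ (g i) = 0) → τ = 0 := by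
    intro τ hτ
    have h1 : τ.liftKaehlerDifferential = 0 := by
      refine B.ext fun i => ?_
      rw [← hg, dlogK, map_smul, Derivation.liftKaehlerDifferential_comp_D, hτ, smul_zero]; rfl
    ext a
    rw [← Derivation.liftKaehlerDifferential_comp_D, h1]; rfl
  let Δ : _ → K →+ K := fun i => (δ i : K →ₗ[ℤ] K).toAddMonoidHom
  have hleib : ∀ i a b, Δ i (a * b) = a * Δ i b + b * Δ i a := fun i a b => (δ i).leibniz a b
  have hΔ : ∀ i j, Δ i (g j) = if j = i then g j else 0 := hδ
  refine ⟨_, ⟨Δ, g, hleib, ?_, ?_, ?_, ?_, hg0, ?_⟩, i0, hgb⟩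
  · intro i j a
    have h1 := key ⁅δ i, δ j⁆ (fun k => by
      rw [Derivation.commutator_apply, hδ, hδ, apply_ite (δ i), apply_ite (δ j), hδ, hδ, map_zero,
        map_zero]
      split_ifs <;> simp)
    have h2 := congrArg (fun τ : Derivation ℤ K K => τ a) h1
    simp only [Derivation.commutator_apply] at h2
    exact sub_eq_zero.1 h2
  · intro i a
    have h1 : ∀ k n, (⇑(Δ i))^[n + 1] (g k) = if k = i then g k else 0 := by
      intro k n
      induction n with
      | zero => exact hΔ i k
      | succ n ih =>
        rw [Function.iterate_succ_apply', ih]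
        split_ifs with h
        · rw [hΔ, if_pos h]
        · exact map_zero _
    obtain ⟨n, hn⟩ : ∃ n, p = n + 1 := ⟨p - 1, by have := hp.out.pos; omega⟩
    let τ := addDer (itH (Δ i) p - Δ i) (by
      intro a b
      simp only [AddMonoidHom.sub_apply, itH_apply, iter_der (hleib i), hleib]
      ring)
    have h2 := key τ (fun k => by
      change itH (Δ i) p (g k) - Δ i (g k) = 0
      rw [itH_apply, hn, h1, hΔ, sub_self])
    have h3 : itH (Δ i) p a - Δ i a = 0 := congrArg (fun τ : Derivation ℤ K K => τ a) h2
    rw [itH_apply] at h3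
    exact sub_eq_zero.1 h3
  · intro i; rw [hΔ, if_pos rfl]
  · intro i j h; rw [hΔ, if_neg (Ne.symm h)]
  · intro w
    have : (fun i => dlogK (g i)) = B := funext hg
    rw [this, B.span_eq]; trivial

end
end HK

namespace HK
universe u v w
set_option linter.unusedSectionVars false

section
variable {p e : ℕ} [hp : Fact p.Prime] {K : Type u} {E : Type v} [Field K] [Field E] [Algebra K E]
  [CharP K p] [CharP E p] {I : Type w}

open Classical in
/-- coefficient action -/
def psiD (Γ : FS p I K) (i0 : I) (i : I) (m : ℕ) : K →+ K := if i = i0 then mulL (m : K) else Γ.D i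

lemma natCast_pow_char (m : ℕ) : (m : K) ^ p = m := by
  have := map_natCast (frobenius K p) m
  exact this

theorem exists_FSE (he : 0 < e) (X : SPI p e K E) (Γ : FS p I K) (i0 : I) (h0 : Γ.g i0 = X.b) :
    ∃ Λ : FS p I E, Λ.g i0 = X.β ∧ (∀ i, i ≠ i0 → Λ.g i = algebraMap K E (Γ.g i)) ∧
      ∀ i a m, Λ.D i (algebraMap K E a * X.β ^ m) = algebraMap K E (psiD Γ i0 i m a) * X.β ^ m := by
  classical
  have hβ0 : X.β ≠ 0 := by
    intro h
    have := X.hβ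
    rw [h, zero_pow (pow_pos hp.out.pos e).ne', ← h0, eq_comm, map_eq_zero] at this
    exact Γ.g0 i0 this
  let D : I → E →+ E := fun i => if i = i0 then X.der else X.ext (Γ.D i)
  have D0 : D i0 = X.der := if_pos rfl
  have D1 : ∀ i, i ≠ i0 → D i = X.ext (Γ.D i) := fun i hi => if_neg hi
  let g : I → E := fun i => if i = i0 then X.β else algebraMap K E (Γ.g i)
  have g0 : g i0 = X.β := if_pos rfl
  have g1 : ∀ i, i ≠ i0 → g i = algebraMap K E (Γ.g i) := fun i hi => if_neg hi
  have hb : ∀ i, i ≠ i0 → Γ.D i X.b = 0 := fun i hi => by rw [← h0]; exact Γ.gij i i0 hi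
  have hD : ∀ i a m, D i (algebraMap K E a * X.β ^ m) = algebraMap K E (psiD Γ i0 i m a) * X.β ^ m := by
    intro i a m
    unfold psiD
    by_cases hi : i = i0
    · subst hi; rw [D0, if_pos rfl, X.der_mul he]; rfl
    · rw [D1 i hi, if_neg hi, X.ext_mul]
      intro a
      rw [Γ.leib, hb i hi, mul_zero, zero_add, mul_comm]
  have hDa : ∀ i a, D i (algebraMap K E a) = algebraMap K E (psiD Γ i0 i 0 a) := by
    intro i a; simpa using hD i a 0
  have hDβ : ∀ i, D i X.β = algebraMap K E (psiD Γ i0 i 1 1) * X.β := by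
    intro i; simpa using hD i 1 1
  refine ⟨⟨D, g, ?_, ?_, ?_, ?_, ?_, ?_, ?_⟩, g0, g1, hD⟩
  · intro i
    by_cases hi : i = i0
    · subst hi; rw [D0]; exact X.der_leib he
    · rw [D1 i hi]; exact X.ext_leib (Γ.leib i) (hb i hi)
  · intro i j
    refine X.comm_of (hD i) (hD j) (fun m a => ?_)
    unfold psiD
    split_ifs
    · rfl
    · simp [← nsmul_eq_mul]
    · simp [← nsmul_eq_mul]
    · exact Γ.comm i j a
  · intro i
    refine X.iter_of (hD i) (fun m a => ?_)
    unfold psiD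
    split_ifs
    · have : ∀ k, (⇑(mulL (m : K)))^[k] a = (m : K) ^ k * a := by
        intro k
        induction k with
        | zero => simp
        | succ k ih => rw [Function.iterate_succ_apply', ih, pow_succ']; simp [mul_assoc]
      rw [this, natCast_pow_char]; rfl
    · exact Γ.pp i a
  · intro i
    by_cases hi : i = i0
    · subst hi; rw [g0, hDβ]; simp [psiD]
    · rw [g1 i hi, hDa, psiD, if_neg hi, Γ.gg]
  · intro i j hij
    by_cases hj : j = i0
    · subst hj; rw [g0, hDβ, psiD, if_neg hij, der_one (Γ.leib i)]; simp
    · rw [g1 j hj, hDa, psiD]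
      split_ifs
      · simp
      · rw [Γ.gij i j hij, map_zero]
  · intro i
    by_cases hi : i = i0
    · subst hi; rw [g0]; exact hβ0
    · rw [g1 i hi]; simpa using Γ.g0 i
  · set W := Submodule.span E (Set.range fun i => dlogK (g i)) with hW
    have hgW : ∀ i, dlogK (g i) ∈ W := fun i => Submodule.subset_span ⟨i, rfl⟩
    have hβW : KaehlerDifferential.D ℤ E X.β ∈ W := by
      have : KaehlerDifferential.D ℤ E X.β = X.β • dlogK (g i0) := by
        rw [g0, dlogK, smul_smul, mul_inv_cancel₀ hβ0, one_smul]
      rw [this]; exact W.smul_mem _ (hgW i0)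
    have hq : ((p ^ e : ℕ) : E) = 0 := by
      rw [Nat.cast_pow, CharP.cast_eq_zero, zero_pow he.ne']
    have hmap : ∀ a : K, KaehlerDifferential.map ℤ ℤ K E (dlogK a) = dlogK (algebraMap K E a) := by
      intro a
      rw [dlogK, map_smul, KaehlerDifferential.map_D, dlogK, ← map_inv₀, algebraMap_smul]
    have hKW : ∀ w : Om K, KaehlerDifferential.map ℤ ℤ K E w ∈ W := by
      intro w
      have hw := Γ.span w
      induction hw using Submodule.span_induction with
      | mem x hx =>
        obtain ⟨i, rfl⟩ := hx
        rw [hmap]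
        by_cases hi : i = i0
        · subst hi
          have : KaehlerDifferential.D ℤ E (algebraMap K E (Γ.g i)) = 0 := by
            rw [h0, ← X.hβ, Derivation.leibniz_pow, ← Nat.cast_smul_eq_nsmul E, hq, zero_smul]
          rw [dlogK, this, smul_zero]; exact zero_mem _
        · rw [← g1 i hi]; exact hgW i
      | zero => rw [map_zero]; exact zero_mem _
      | add x y _ _ hx hy => rw [map_add]; exact add_mem hx hy
      | smul a x _ hx =>
        rw [map_smul, ← algebraMap_smul E a]; exact W.smul_mem _ hx
    have hDW : ∀ x : E, KaehlerDifferential.D ℤ E x ∈ W := by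
      intro x
      rw [X.sum_comp x, map_sum]
      refine sum_mem fun l _ => ?_
      rw [Derivation.leibniz, Derivation.leibniz_pow]
      refine add_mem (W.smul_mem _ (W.smul_of_tower_mem _ (W.smul_mem _ hβW))) (W.smul_mem _ ?_)
      rw [← KaehlerDifferential.map_D ℤ ℤ K E]
      exact hKW _
    intro w
    have h1 : Submodule.span E (Set.range (KaehlerDifferential.D ℤ E)) ≤ W := by
      rw [Submodule.span_le]; rintro _ ⟨x, rfl⟩; exact hDW x
    rw [KaehlerDifferential.span_range_derivation] at h1
    exact h1 trivial

end
end HK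

namespace HK
universe u v w
set_option linter.unusedSectionVars false

section
variable {p : ℕ} {K : Type u} [Field K] {s r R : ℕ} {I : Type w}
  [hp : Fact p.Prime] [CharP K p]

namespace FS
variable (Λ : FS p I K)

/-- indices outside the finite system do not see an equation between forms in the system -/
lemma outside (S : DiffStr p K) {f : ℕ → I} (hf : ∀ i < s, ∀ j < s, i ≠ j → f i ≠ f j)
    {m : ℕ} {w y : Frm K s} (hy : proj m y = y)
    (hw : Psi (fun k => Λ.g (f k)) w = S.d (Psi (fun k => Λ.g (f k)) y)) :
    w = dd (fun k => Λ.D (f k)) y ∧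
      ∀ j, (∀ k < s, f k ≠ j) → fmap (Λ.D j) y = 0 := by
  constructor
  · have := congrArg (fun x => (Phi (fun k => Λ.c (f k)) x : Frm K s)) hw
    simp only [Λ.Phi_Psi hf, Λ.Phi_d S f (Psi_mem hy)] at this
    exact this
  · intro j hj
    rw [← Λ.fb_Phi_d S hf hj hy, ← hw]
    apply fb_Phi_Psi
    intro i hi
    rw [if_neg (lt_irrefl _)]
    exact Λ.c_ne (hj i hi).symm

lemma fmap_pih_dd {f : ℕ → I} {x y : Frm K R} (h : fmap (Λ.D (f R)) x = dd (fun k => Λ.D (f k)) y) :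
    dd (fun k => Λ.D (f k)) (fmap (pih p (Λ.D (f R))) x) = dd (fun k => Λ.D (f k)) x := by
  have h2 := hp.out.two_le
  obtain ⟨k, hk⟩ : ∃ k, p - 1 = k + 1 := ⟨p - 2, by omega⟩
  rw [pih, fmap_sub, fmap_id, map_sub, sub_eq_self, hk]
  have : fmap (itH (Λ.D (f R)) (k + 1)) x = fmap (itH (Λ.D (f R)) k) (fmap (Λ.D (f R)) x) := by
    rw [fmap_comp]; exact fmap_congr (fun a => (itH_self _ _ _).symm) _
  rw [this, h, fmap_dd (D' := fun k => Λ.D (f k)) (fun i _ a => itH_comm (Λ.comm _ _) _ _)]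
  exact dd_dd (fun i _ j _ a => Λ.comm _ _ a) _

theorem lemE1 (S : DiffStr p K) {f : ℕ → I}
    (hf : ∀ i < R + 1, ∀ j < R + 1, i ≠ j → f i ≠ f j)
    {m : ℕ} {yu yv wb : Frm K (R + 1)} (hyv : proj m yv = yv) (hwb : fb wb = 0)
    (heq : Psi (fun k => Λ.g (f k)) wb = Psi (fun k => Λ.g (f k)) (fmap (frb p K) yu)
      - Psi (fun k => Λ.g (f k)) yu + S.d (Psi (fun k => Λ.g (f k)) yv)) :
    ∃ y1 z1 : Frm K R, fmap (Λ.D (f R)) z1 = 0 ∧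
      (∀ j, (∀ k < R + 1, f k ≠ j) → fmap (Λ.D j) z1 = 0) ∧
      fa wb = fmap (frb p K) y1 - y1 + dd (fun k => Λ.D (f k)) z1 := by
  obtain ⟨hA, hB⟩ := Λ.outside S hf (w := wb - (fmap (frb p K) yu - yu)) hyv (by
    rw [map_sub, heq, map_sub]; abel)
  have hA' : wb = fmap (frb p K) yu - yu + dd (fun k => Λ.D (f k)) yv := by rw [← hA]; abel
  set D : ℕ → K →+ K := fun k => Λ.D (f k) with hD
  have frb0 : ∀ j a, Λ.D j (frb p K a) = 0 := fun j a => by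
    rw [frb_apply]; exact der_pow_p (Λ.leib j) a
  have hC : ∀ j, (∀ k < R + 1, f k ≠ j) → fmap (Λ.D j) (fb yu) = 0 := by
    intro j hj
    have h1 := congrArg (fun x => fmap (Λ.D j) (fb x)) hA'
    simp only [hwb, map_add, map_sub, map_zero] at h1
    have h2 : fmap (Λ.D j) (fb (fmap (frb p K) yu)) = 0 := by
      rw [fb_fmap, fmap_comp]; exact fmap_eq_zero (frb0 j) _
    have h3 : fmap (Λ.D j) (fb (dd D yv)) = 0 := by
      rw [← fb_fmap, fmap_dd (D' := D) (fun i _ a => Λ.comm _ _ a), hB j hj, map_zero, map_zero]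
    rw [h2, h3] at h1
    simpa using h1.symm
  let J := {j : I // ∀ k < R + 1, f k ≠ j}
  let L : Subfield K := kerF (fun j : J => Λ.D j.1) (fun j => Λ.leib j.1)
  have hL : ∀ a, a ∈ L ↔ ∀ j : J, Λ.D j.1 a = 0 := fun a => Iff.rfl
  obtain ⟨P0, hP0⟩ := (Λ.pb f (R + 1) hf).restrict L
    (fun i hi a ha j => by
      change Λ.D j.1 (Λ.D (f i) a) = 0
      rw [Λ.comm, (hL a).1 ha j, map_zero])
    (fun i hi j => Λ.gij _ _ (j.2 i hi).symm)
  have : CharP L p := charP_sub L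
  have lift : ∀ (q : ℕ) (x : Frm K q), (∀ j, (∀ k < R + 1, f k ≠ j) → fmap (Λ.D j) x = 0) →
      ∃ y : Frm L q, fmap (subH L) y = x := fun q x hx =>
    fmap_lift (s := (Set.univ : Set J)) (h := fun j : J => Λ.D j.1) (f := subH L)
      (fun a ha => ⟨⟨a, fun j => ha j trivial⟩, rfl⟩) x (fun j _ => hx j.1 j.2)
  have sub0 : ∀ j, (∀ k < R + 1, f k ≠ j) → ∀ (q : ℕ) (x : Frm L q),
      fmap (Λ.D j) (fmap (subH L) x) = 0 := fun j hj q x => by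
    rw [fmap_comp]; exact fmap_eq_zero (fun a => a.2 ⟨j, hj⟩) _
  have subinj : ∀ a, subH L a = 0 → a = 0 := fun a ha => Subtype.ext ha
  obtain ⟨t0, ht0⟩ := lift _ _ hC
  obtain ⟨v0, hv0⟩ := lift _ _ hB
  have cdd : ∀ x : Frm L (R + 1), fmap (subH L) (dd P0.D x) = dd D (fmap (subH L) x) :=
    fmap_dd (fun i hi a => (hP0 i hi a).symm)
  have cfr : ∀ (q : ℕ) (x : Frm L q), fmap (subH L) (fmap (frb p L) x)
      = fmap (frb p K) (fmap (subH L) x) := fun q x =>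
    fmap_comm' (f := subH L) (f' := frb p L) (g := frb p K) (g' := subH L)
      (fun a => (map_pow L.subtype a p)) x
  obtain ⟨θ, ⟨w, hw⟩, hθ⟩ := thmLift P0 (fmk 0 t0) v0 (by
    apply fmap_inj subinj
    have h1 := congrArg fb hA'
    rw [hwb] at h1
    rw [← fb_fmap, map_add, map_sub, cfr, cdd, hv0, h1, map_add, map_add, map_sub, map_sub]
    simp only [fb_fmap, fb_mk, ht0])
  rw [fb_mk] at hθ
  have hw' := congrArg (fmap (subH L)) hw
  rw [map_sub, cfr, cdd] at hw'
  have hθ' : fb (fmap (subH L) θ) = fb yu := by rw [fb_fmap, hθ, ht0]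
  set Θ := fmap (subH L) θ
  set W := fmap (subH L) w with hW
  have hZ : ∀ j, (∀ k < R + 1, f k ≠ j) → fmap (Λ.D j) (W + yv) = 0 := fun j hj => by
    rw [map_add, hB j hj, add_zero]; exact sub0 j hj _ _
  have hfb : fmap (Λ.D (f R)) (fa (W + yv)) = dd D (fb (W + yv)) := by
    rw [← sub_eq_zero]
    change fb (dd D (W + yv)) = 0
    rw [map_add, ← hw', map_add, map_sub, fb_fmap, hθ', ← hwb, hA']
    simp
  refine ⟨fa (yu - Θ), fmap (pih p (Λ.D (f R))) (fa (W + yv)), ?_, ?_, ?_⟩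
  · rw [fmap_comp]; exact fmap_eq_zero (der_pih (Λ.pp _)) _
  · intro j hj
    rw [fmap_comm (f' := pih p (Λ.D (f R))) (fun a => (pih_comm (Λ.comm _ _) a).symm), ← fa_fmap,
      hZ j hj, map_zero, map_zero]
  · rw [Λ.fmap_pih_dd hfb]
    have h1 := congrArg fa hw'
    rw [hA']
    simp only [map_add, map_sub, fa_fmap, fa_dd] at h1 ⊢
    rw [← h1]
    abel
end FS
end
end HK

namespace HK
universe u v w
set_option linter.unusedSectionVars false

section
variable {p : ℕ} {K : Type u} [Field K] {s r R : ℕ} {I : Type w}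

lemma exists_const (h : ℕ → K) (s : ℕ) (a : K) : ∃ y : Frm K s, proj 0 y = y ∧
    ∀ φ : K →+ K, Psi h (fmap φ y) = φ a • (1 : DF K) := by
  induction s with
  | zero => exact ⟨a, rfl, fun φ => Psi_zero _⟩
  | succ s ih =>
    obtain ⟨y, h1, h2⟩ := ih
    refine ⟨fmk y 0, by apply frm_ext <;> simp [h1], fun φ => ?_⟩
    rw [Psi_succ, fa_fmap, fb_fmap, fa_mk, fb_mk, h2, map_zero, map_zero, mul_zero, add_zero]

lemma transport {h1 h : ℕ → K} {s s1 : ℕ} (hh : ∀ k < s1, ∃ l < s, h l = h1 k) (n : ℕ)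
    (y : Frm K s1) (hy : proj n y = y) : ∃ y' : Frm K s, proj n y' = y' ∧
      ∀ φ : K →+ K, Psi h (fmap φ y') = Psi h1 (fmap φ y) := by
  induction s1 generalizing n with
  | zero =>
    cases n with
    | zero =>
      obtain ⟨y', e1, e2⟩ := exists_const h s (v0 y)
      exact ⟨y', e1, fun φ => by rw [e2, Psi_zero]; rfl⟩
    | succ n =>
      have : y = 0 := hy.symm
      exact ⟨0, by simp, fun φ => by rw [this]; simp⟩
  | succ s1 ih =>
    obtain ⟨ya, a1, a2⟩ := ih (fun k hk => hh k (by omega)) n (fa y) (by rw [← fa_proj, hy])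
    cases n with
    | zero =>
      refine ⟨ya, a1, fun φ => ?_⟩
      have : fb y = 0 := by rw [← hy, fb_proj_zero]
      rw [Psi_succ, fa_fmap, fb_fmap, this, map_zero, map_zero, mul_zero, add_zero, a2]
    | succ n =>
      obtain ⟨yb, b1, b2⟩ := ih (fun k hk => hh k (by omega)) n (fb y)
        (by rw [← fb_proj_succ, hy])
      obtain ⟨l, hl, e⟩ := hh s1 (by omega)
      refine ⟨ya + mm (fun i => if i = l then 1 else 0) yb, ?_, fun φ => ?_⟩
      · rw [map_add, a1, ← mm_proj, b1]
      · rw [map_add, map_add, a2, Psi_succ, fa_fmap, fb_fmap, ← b2, ← e, dLog_mul_Psi l hl]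
        congr 2
        exact fmap_mm (fun i _ a => by split <;> simp) _

lemma exists_enum [DecidableEq I] (T : Finset I) (i0 : I) : ∃ (R : ℕ) (f : ℕ → I), f R = i0 ∧
    (∀ i < R + 1, ∀ j < R + 1, i ≠ j → f i ≠ f j) ∧ ∀ t ∈ T, ∃ k < R + 1, f k = t := by
  set l := (T.erase i0).toList with hl
  have hnd : l.Nodup := Finset.nodup_toList _
  have hm : ∀ t, t ∈ l ↔ t ≠ i0 ∧ t ∈ T := fun t => by rw [hl, Finset.mem_toList, Finset.mem_erase]
  have hlt : ∀ k (h : k < l.length), l.getD k i0 = l[k] := fun k h => by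
    simp [List.getD_eq_getElem?_getD, h]
  have hR : l.getD l.length i0 = i0 := by simp [List.getD_eq_getElem?_getD]
  have hne : ∀ k < l.length, l.getD k i0 ≠ i0 := fun k h => by
    rw [hlt k h]; exact ((hm _).1 (List.getElem_mem h)).1
  refine ⟨l.length, fun k => l.getD k i0, hR, ?_, ?_⟩
  · intro i hi j hj hij
    change l.getD i i0 ≠ l.getD j i0
    rcases Nat.lt_succ_iff_lt_or_eq.1 hi with hi | rfl <;>
      rcases Nat.lt_succ_iff_lt_or_eq.1 hj with hj | rfl
    · rw [hlt i hi, hlt j hj]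
      intro e
      exact hij ((List.Nodup.getElem_inj_iff hnd).1 e)
    · rw [hR]; exact hne i hi
    · rw [hR]; exact (hne j hj).symm
    · exact absurd rfl hij
  · intro t ht
    by_cases h : t = i0
    · exact ⟨l.length, by omega, by rw [h]; exact hR⟩
    · obtain ⟨k, hk, e⟩ := List.getElem_of_mem ((hm t).2 ⟨h, ht⟩)
      exact ⟨k, by omega, by change l.getD k i0 = t; rw [hlt k hk, e]⟩

variable [hp : Fact p.Prime] [CharP K p]

theorem FS.expand (Λ : FS p I K) (i0 : I) (S : DiffStr p K) {n : ℕ} {u v : DF K}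
    (hu : u ∈ omegaPow K n) (hv : v ∈ omegaPred K n) :
    ∃ T : Finset I, ∀ (s : ℕ) (f : ℕ → I), (∀ t ∈ T, ∃ k < s, f k = t) →
      ∃ (m : ℕ) (yu yv : Frm K s), proj m yv = yv ∧
        S.sp u - u + S.d v = Psi (fun k => Λ.g (f k)) (fmap (frb p K) yu)
          - Psi (fun k => Λ.g (f k)) yu + S.d (Psi (fun k => Λ.g (f k)) yv) := by
  classical
  obtain ⟨T1, hT1⟩ := Λ.support hu
  obtain ⟨R1, f1, -, -, hc⟩ := exists_enum T1 i0
  obtain ⟨y, hy, e⟩ := hT1 _ _ hc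
  obtain ⟨η, hη, e2⟩ := sp_Psi (h := fun k => Λ.g (f1 k)) S hy
  have hsup : ∃ T2 : Finset I, ∀ (s : ℕ) (f : ℕ → I), (∀ t ∈ T2, ∃ k < s, f k = t) →
      ∃ (m : ℕ) (yv : Frm K s), proj m yv = yv ∧ v + η = Psi (fun k => Λ.g (f k)) yv := by
    cases n with
    | zero =>
      have h1 : v = 0 := hv
      have h2 : η = 0 := hη
      exact ⟨∅, fun s f _ => ⟨0, 0, by simp, by simp [h1, h2]⟩⟩
    | succ n =>
      obtain ⟨T2, h2⟩ := Λ.support (Submodule.add_mem _ hv hη : v + η ∈ omegaPow K n)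
      exact ⟨T2, fun s f hf => ⟨n, h2 s f hf⟩⟩
  obtain ⟨T2, hT2⟩ := hsup
  refine ⟨(Finset.range (R1 + 1)).image f1 ∪ T2, fun s f hf => ?_⟩
  obtain ⟨m, yv, hm, e3⟩ := hT2 s f (fun t ht => hf t (Finset.mem_union_right _ ht))
  obtain ⟨y', -, e4⟩ := transport (h1 := fun k => Λ.g (f1 k)) (h := fun k => Λ.g (f k)) (s := s)
    (fun k hk => by
      obtain ⟨l, hl, el⟩ := hf (f1 k) (Finset.mem_union_left _
        (Finset.mem_image_of_mem _ (Finset.mem_range.2 hk)))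
      exact ⟨l, hl, by rw [el]⟩) n y hy
  refine ⟨m, y', yv, hm, ?_⟩
  have e5 := e4 (AddMonoidHom.id K)
  rw [fmap_id, fmap_id] at e5
  rw [e4, e5, ← e3, map_add, ← e, show S.sp u = S.sp (Psi (fun k => Λ.g (f1 k)) y) by rw [← e], e2]
  abel
end
end HK

namespace HK
universe u v w
set_option linter.unusedSectionVars false

section
variable {p e : ℕ} [hp : Fact p.Prime] {K : Type u} [Field K] [CharP K p] {R : ℕ}

/-- the subgroup generated by `b^m (dz)^{[p^i]}`, `i < k`, `z` good -/
def NN (p : ℕ) [Fact p.Prime] [CharP K p] (D : ℕ → K →+ K) (b : K) (G : Frm K R → Prop) (k : ℕ) :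
    AddSubgroup (Frm K R) :=
  AddSubgroup.closure {x | ∃ m i z, i < k ∧ G z ∧
    x = fmap (mulL (b ^ m)) ((⇑(fmap (frb p K) : Frm K R →+ Frm K R))^[i] (dd D z))}

variable {D : ℕ → K →+ K} {b : K} {G : Frm K R → Prop}

lemma NN_gen {k m i : ℕ} (hi : i < k) {z : Frm K R} (hz : G z) :
    fmap (mulL (b ^ m)) ((⇑(fmap (frb p K) : Frm K R →+ Frm K R))^[i] (dd D z)) ∈ NN p D b G k :=
  AddSubgroup.subset_closure ⟨m, i, z, hi, hz, rfl⟩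

lemma fmap_mulL_one (x : Frm K R) : fmap (mulL (1 : K)) x = x :=
  fmap_eq_id (fun a => one_mul a) x

lemma NN_dd {k : ℕ} {z : Frm K R} (hz : G z) : dd D z ∈ NN p D b G (k + 1) := by
  have := NN_gen (p := p) (D := D) (b := b) (G := G) (k := k + 1) (m := 0) (i := 0) (by omega) hz
  rwa [pow_zero, fmap_mulL_one, Function.iterate_zero_apply] at this

lemma NN_step {k : ℕ} (m : ℕ) {x : Frm K R} (hx : x ∈ NN p D b G k) :
    fmap (mulL (b ^ m)) (fmap (frb p K) x) ∈ NN p D b G (k + 1) := by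
  unfold NN at hx
  induction hx using AddSubgroup.closure_induction with
  | mem x hx =>
    obtain ⟨m', i, z, hi, hz, rfl⟩ := hx
    have := NN_gen (p := p) (D := D) (b := b) (G := G) (k := k + 1) (m := m + p * m') (i := i + 1)
      (by omega) hz
    convert this using 1
    rw [Function.iterate_succ_apply', fmap_comp, fmap_comp, fmap_comp]
    refine fmap_congr (fun a => ?_) _
    simp only [AddMonoidHom.comp_apply, AddMonoidHom.coe_mulLeft, frb_apply]
    rw [mul_pow, pow_add, pow_mul', mul_assoc]
  | zero => simp
  | add x y _ _ hx hy => rw [map_add, map_add]; exact add_mem hx hy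
  | neg x _ hx => rw [map_neg, map_neg]; exact neg_mem hx

theorem descent (he : 0 < e) (u z : ℕ → Frm K R) (x : Frm K R)
    (hz : ∀ l < p ^ e, G (z l)) (hz0 : ∀ l < p ^ e, ¬ p ∣ l → z l = 0)
    (H : ∀ l < p ^ e, (if l = 0 then x else 0) =
      (∑ m ∈ Finset.range (p ^ e), if p * m % p ^ e = l then
        fmap (mulL (b ^ (p * m / p ^ e))) (fmap (frb p K) (u m)) else 0) - u l + dd D (z l)) :
    x - (fmap (frb p K) (u 0) - u 0) ∈ NN p D b G e := by
  have hq : 0 < p ^ e := pow_pos hp.out.pos e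
  have C : ∀ k, k + 1 ≤ e → ∀ l < p ^ e, ¬ p ^ (k + 1) ∣ l → u l ∈ NN p D b G k := by
    intro k
    induction k with
    | zero =>
      intro _ l hl hdl
      have hl0 : l ≠ 0 := by rintro rfl; exact hdl (dvd_zero _)
      rw [zero_add, pow_one] at hdl
      have := H l hl
      rw [if_neg hl0, hz0 l hl hdl, map_zero, add_zero, Finset.sum_eq_zero] at this
      · rw [zero_sub, eq_comm, neg_eq_zero] at this
        rw [this]; exact zero_mem _
      · intro m _
        rw [if_neg]
        rintro rfl
        exact hdl ((Nat.dvd_mod_iff (dvd_pow_self p he.ne')).2 (dvd_mul_right p m))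
    | succ k ih =>
      intro hk l hl hdl
      have hl0 : l ≠ 0 := by rintro rfl; exact hdl (dvd_zero _)
      have := H l hl
      rw [if_neg hl0] at this
      have h2 : u l = (∑ m ∈ Finset.range (p ^ e), if p * m % p ^ e = l then
        fmap (mulL (b ^ (p * m / p ^ e))) (fmap (frb p K) (u m)) else 0) + dd D (z l) := by
        have aux : ∀ A B C : Frm K R, 0 = A - B + C → B = A + C := fun A B C h => by
          rw [sub_add_eq_add_sub] at h
          exact (sub_eq_zero.1 h.symm).symm
        exact aux _ _ _ this
      rw [h2]
      refine add_mem (sum_mem fun m hm => ?_) (NN_dd (hz l hl))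
      split_ifs with hml
      · refine NN_step _ (ih (by omega) m (Finset.mem_range.1 hm) fun hd => hdl ?_)
        rw [← hml, Nat.dvd_mod_iff (pow_dvd_pow p hk), pow_succ']
        exact mul_dvd_mul_left p hd
      · exact zero_mem _
  have h0 := H 0 hq
  rw [if_pos rfl, ← Finset.add_sum_erase _ _ (Finset.mem_range.2 hq), if_pos (by simp)] at h0
  simp only [mul_zero, Nat.zero_div, pow_zero, fmap_mulL_one] at h0
  obtain ⟨k, rfl⟩ : ∃ k, e = k + 1 := ⟨e - 1, by omega⟩
  set Q := ∑ m ∈ (Finset.range (p ^ (k + 1))).erase 0, (if p * m % p ^ (k + 1) = 0 then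
        fmap (mulL (b ^ (p * m / p ^ (k + 1)))) (fmap (frb p K) (u m)) else 0) with hQ
  have : x - (fmap (frb p K) (u 0) - u 0) = Q + dd D (z 0) := by rw [h0]; abel
  rw [this]
  refine add_mem (sum_mem fun m hm => ?_) (NN_dd (hz 0 hq))
  obtain ⟨hm0, hm1⟩ := Finset.mem_erase.1 hm
  split_ifs with hml
  · refine NN_step _ (C k le_rfl m (Finset.mem_range.1 hm1) fun hd => ?_)
    exact absurd (Nat.le_of_dvd (by omega) hd) (not_le.2 (Finset.mem_range.1 hm1))
  · exact zero_mem _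
end

section
variable {p e : ℕ} [hp : Fact p.Prime] {K : Type u} {E : Type v} [Field K] [Field E] [Algebra K E]
  [CharP K p] [CharP E p] {I : Type w} {R : ℕ}

theorem descentE (he : 0 < e) (X : SPI p e K E) (Γ : FS p I K) (i0 : I) (Λ : FS p I E)
    (hΛ : ∀ i a m, Λ.D i (algebraMap K E a * X.β ^ m) = algebraMap K E (psiD Γ i0 i m a) * X.β ^ m)
    {f : ℕ → I} (hf0 : f R = i0) (hf : ∀ i < R + 1, ∀ j < R + 1, i ≠ j → f i ≠ f j)
    {x : Frm K R} {y1 z1 : Frm E R} (h1 : fmap (Λ.D (f R)) z1 = 0)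
    (h2 : ∀ j, (∀ k < R + 1, f k ≠ j) → fmap (Λ.D j) z1 = 0)
    (h3 : fmap (algebraMap K E).toAddMonoidHom x =
      fmap (frb p E) y1 - y1 + dd (fun k => Λ.D (f k)) z1) :
    ∃ u0 : Frm K R, x - (fmap (frb p K) u0 - u0) ∈ NN p (fun k => Γ.D (f k)) X.b
      (fun z => ∀ j, (∀ k < R + 1, f k ≠ j) → fmap (Γ.D j) z = 0) e := by
  have hc : ∀ i, ∀ l < p ^ e, ∀ a, X.comp l (Λ.D i a) = psiD Γ i0 i l (X.comp l a) :=
    fun i l hl a => X.comp_of (hΛ i) hl a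
  have psi1 : ∀ i, i ≠ i0 → ∀ l, psiD Γ i0 i l = Γ.D i := fun i hi l => if_neg hi
  have psi0 : ∀ l : ℕ, psiD Γ i0 i0 l = mulL (l : K) := fun l => if_pos rfl
  refine ⟨fmap (X.comp 0) y1, descent he (fun l => fmap (X.comp l) y1) (fun l => fmap (X.comp l) z1)
    x ?_ ?_ ?_⟩
  · intro l hl j hj
    rw [← psi1 j (fun h => hj R (by omega) (hf0.trans h.symm)) l,
      fmap_comm' (g := X.comp l) (g' := Λ.D j) (fun a => (hc j l hl a).symm), h2 j hj, map_zero]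
  · intro l hl hpl
    have : fmap (mulL (l : K)) (fmap (X.comp l) z1) = 0 := by
      rw [← psi0 l, fmap_comm' (g := X.comp l) (g' := Λ.D i0) (fun a => (hc i0 l hl a).symm),
        ← hf0, h1, map_zero]
    refine fmap_inj (fun a ha => ?_) _ this
    exact (mul_eq_zero.1 ha).resolve_left (fun h => hpl ((CharP.cast_eq_zero_iff K p l).1 h))
  · intro l hl
    have h4 := congrArg (fmap (X.comp l)) h3
    rw [map_add, map_sub, fmap_dd (D' := fun k => Γ.D (f k)) (fun i hi a => by
      rw [hc _ l hl, psi1]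
      rw [← hf0]; exact hf i (by omega) R (by omega) (by omega))] at h4
    convert h4 using 2
    · rw [fmap_comp]
      split_ifs with h
      · exact (fmap_eq_id (fun a => (X.comp_algebraMap hl a).trans (if_pos h)) _).symm
      · exact (fmap_eq_zero (fun a => (X.comp_algebraMap hl a).trans (if_neg h)) _).symm
    · congr 1
      have : ((X.comp l).comp (frb p E)) = ∑ m ∈ Finset.range (p ^ e), if p * m % p ^ e = l then
          (mulL (X.b ^ (p * m / p ^ e))).comp ((frb p K).comp (X.comp m)) else 0 := by
        ext a
        rw [AddMonoidHom.finsetSum_apply]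
        refine (X.comp_frob hl a).trans (Finset.sum_congr rfl fun m _ => ?_)
        split_ifs <;> rfl
      rw [fmap_comp, this, fmap_sum]
      refine Finset.sum_congr rfl fun m _ => ?_
      split_ifs
      · rw [fmap_comp, fmap_comp]; rfl
      · exact (fmap_zero _).symm
end
end HK

namespace HK
universe u v w
set_option linter.unusedSectionVars false

section
variable {p e : ℕ} [hp : Fact p.Prime] {K : Type u} [Field K] [CharP K p] {R s : ℕ} {I : Type w}

lemma proj_frb_iter {n : ℕ} {Y : Frm K s} (hY : proj n Y = Y) :
    proj n (fmap (frb p K) Y) = fmap (frb p K) Y := by rw [← fmap_proj, hY]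

lemma spIter_Psi (S : DiffStr p K) (N : AddSubgroup (DF K)) {h : ℕ → K} {n : ℕ} (k : K) (t : ℕ)
    (Y : Frm K s) (hY : proj n Y = Y)
    (hN : ∀ i < t, ∀ η ∈ omegaPred K n, k • spIter S i (S.d η) ∈ N) :
    k • spIter S t (Psi h Y) - k • Psi h ((⇑(fmap (frb p K) : Frm K s →+ Frm K s))^[t] Y) ∈ N := by
  induction t generalizing Y with
  | zero => simp [spIter]
  | succ t ih =>
    obtain ⟨η, hη, e⟩ := sp_Psi (h := h) S hY
    have h1 := ih (fmap (frb p K) Y) (proj_frb_iter hY) (fun i hi => hN i (by omega))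
    have h2 := hN t (by omega) η hη
    rw [spIter_succ', e, spIter_add, smul_add, Function.iterate_succ_apply]
    convert add_mem h1 h2 using 1
    abel

lemma d_Psi_good (Γ : FS p I K) (S : DiffStr p K) {f : ℕ → I}
    (hf : ∀ i < R + 1, ∀ j < R + 1, i ≠ j → f i ≠ f j) {z : Frm K R}
    (hz : ∀ j, (∀ k < R + 1, f k ≠ j) → fmap (Γ.D j) z = 0) :
    S.d (Psi (fun k => Γ.g (f k)) z) = Psi (fun k => Γ.g (f k)) (dd (fun k => Γ.D (f k)) z)
      + dLog K (Γ.g (f R)) * Psi (fun k => Γ.g (f k)) (fmap (Γ.D (f R)) z) := by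
  rw [Γ.d_Psi_aux S hf (fun k => Γ.g (f k)) R z hz, Finset.sum_range_succ]
  rw [FS.sum_Psi (fun k => Γ.D (f k)) (fun k => Γ.g (f k)) z]

lemma back_gen (Γ : FS p I K) (S : DiffStr p K) {f : ℕ → I}
    (hf : ∀ i < R + 1, ∀ j < R + 1, i ≠ j → f i ≠ f j) {z : Frm K R}
    (hz : ∀ j, (∀ k < R + 1, f k ≠ j) → fmap (Γ.D j) z = 0) {n m i : ℕ} (hzn : proj n z = z)
    (hi : i < e) :
    Psi (fun k => Γ.g (f k)) (fmap (mulL (Γ.g (f R) ^ m))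
      ((⇑(fmap (frb p K) : Frm K R →+ Frm K R))^[i] (dd (fun k => Γ.D (f k)) z)))
      ∈ KK S (Γ.g (f R)) e (n + 1) := by
  set b := Γ.g (f R) with hb
  have hb0 : b ≠ 0 := Γ.g0 _
  set h : ℕ → K := fun k => Γ.g (f k) with hh
  have hN : ∀ i < e, ∀ η ∈ omegaPred K (n + 1), b ^ m • spIter S i (S.d η) ∈ KK S b e (n + 1) :=
    fun i hi η hη => lemmaA hp.out hb0 i hi m η hη
  have hζ : Psi h (fmap (Γ.D (f R)) z) ∈ omegaPow K n := Psi_mem (by rw [← fmap_proj, hzn])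
  have h1 := spIter_Psi S (KK S b e (n + 1)) (h := h) (n := n + 1) (b ^ m) i
    (dd (fun k => Γ.D (f k)) z) (by rw [← dd_proj, hzn]) (fun j hj => hN j (by omega))
  have h2 := hN i hi (Psi h z) (Psi_mem hzn)
  have h3 := spIter_dLog S (KK S b e (n + 1)) i b (b ^ m) _ hζ
    (fun j hj η hη => hN j (by omega) η hη)
  have h4 : b ^ m • (dLog K b * spIter S i (Psi h (fmap (Γ.D (f R)) z))) ∈ KK S b e (n + 1) := by
    rw [← mul_smul_comm]
    exact lemmaB hb0 (by omega) (Submodule.smul_mem _ _ (spIter_mem S i hζ))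
  rw [d_Psi_good Γ S hf hz, spIter_add, smul_add] at h2
  rw [Psi_smul]
  convert sub_mem (sub_mem (sub_mem h2 h4) h3) h1 using 1
  abel

lemma proj_frb_it (n i : ℕ) (Y : Frm K s) :
    proj n ((⇑(fmap (frb p K) : Frm K s →+ Frm K s))^[i] Y) =
      (⇑(fmap (frb p K) : Frm K s →+ Frm K s))^[i] (proj n Y) := by
  induction i generalizing Y with
  | zero => rfl
  | succ i ih => rw [Function.iterate_succ_apply, ih, ← fmap_proj, Function.iterate_succ_apply]

theorem back (Γ : FS p I K) (S : DiffStr p K) {f : ℕ → I}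
    (hf : ∀ i < R + 1, ∀ j < R + 1, i ≠ j → f i ≠ f j) (n : ℕ) {x : Frm K R}
    (hx : x ∈ NN p (fun k => Γ.D (f k)) (Γ.g (f R))
      (fun z => ∀ j, (∀ k < R + 1, f k ≠ j) → fmap (Γ.D j) z = 0) e) :
    Psi (fun k => Γ.g (f k)) (proj n x) ∈ KK S (Γ.g (f R)) e n := by
  unfold NN at hx
  induction hx using AddSubgroup.closure_induction with
  | mem x hx =>
    obtain ⟨m, i, z, hi, hz, rfl⟩ := hx
    rw [← fmap_proj, proj_frb_it]
    cases n with
    | zero =>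
      rw [proj_zero_dd]
      have : (⇑(fmap (frb p K) : Frm K R →+ Frm K R))^[i] 0 = 0 :=
        Function.iterate_fixed (map_zero _) i
      rw [this, map_zero, map_zero]; exact zero_mem _
    | succ n =>
      rw [← dd_proj]
      exact back_gen Γ S hf (fun j hj => by rw [fmap_proj, hz j hj, map_zero]) (proj_proj n z) hi
  | zero => simp
  | add x y _ _ hx hy => rw [map_add, map_add]; exact add_mem hx hy
  | neg x _ hx => rw [map_neg, map_neg]; exact neg_mem hx

end
end HK

namespace HK
universe u v w
set_option linter.unusedSectionVars false

section
variable {p e : ℕ} [hp : Fact p.Prime] {K : Type u} {E : Type v} [Field K] [Field E] [Algebra K E]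
  [CharP K p] [CharP E p] {SF : DiffStr p K} {SE : DiffStr p E}

lemma dLog_pow_char (c : E) : dLog E (c ^ p) = 0 := by
  have h : KaehlerDifferential.D ℤ E (c ^ p) = 0 := by
    rw [Derivation.leibniz_pow, ← Nat.cast_smul_eq_nsmul E p, CharP.cast_eq_zero, zero_smul]
  unfold dLog
  rw [h, smul_zero, map_zero]

lemma res_Psi (Rs : DiffRes p K E SF SE) {h : ℕ → K} {h' : ℕ → E} {s : ℕ}
    (hh : ∀ k < s, h' k = algebraMap K E (h k)) (x : Frm K s) :
    Rs.res (Psi h x) = Psi h' (fmap (algebraMap K E).toAddMonoidHom x) := by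
  induction s with
  | zero => rw [Psi_zero, Psi_zero, Rs.res_smul, Rs.res_one]; rfl
  | succ s ih =>
    have ih' := ih (fun k hk => hh k (by omega))
    rw [Psi_succ, Psi_succ, map_add, Rs.res_mul, res_dLog, ih', ih', hh s (by omega)]; rfl

theorem hard (Rs : DiffRes p K E SF SE) {b : K} (hb : ¬ ∃ y : K, y ^ p = b) (he : 0 < e)
    {β : E} (hβ : β ^ p ^ e = algebraMap K E b) (hgen : Algebra.adjoin K {β} = ⊤)
    {n : ℕ} {ω : DF K} (hω : ω ∈ omegaPow K n) (hr : Rs.res ω ∈ hRel SE n) :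
    ω ∈ KK SF b e n := by
  classical
  have hb0 : b ≠ 0 := by rintro rfl; exact hb ⟨0, zero_pow hp.out.ne_zero⟩
  obtain ⟨X, hXβ, hXb⟩ := exists_spi (p := p) (e := e) hb hβ hgen
  obtain ⟨I, Γ, i0, hg0⟩ := exists_FS (p := p) b hb
  obtain ⟨Λ, hΛ0, hΛ1, hΛD⟩ := exists_FSE he X Γ i0 (by rw [hg0, hXb])
  obtain ⟨u, hu, v, hv, huv⟩ := (mem_hRel_iff SE).1 hr
  obtain ⟨T1, hT1⟩ := Λ.expand i0 SE hu hv
  obtain ⟨T2, hT2⟩ := Γ.support hω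
  obtain ⟨R, f, hf0, hf, hcov⟩ := exists_enum (T1 ∪ T2) i0
  obtain ⟨m, yu, yv, hyv, heq⟩ := hT1 (R + 1) f (fun t ht => hcov t (Finset.mem_union_left _ ht))
  obtain ⟨y, hy, hyω⟩ := hT2 (R + 1) f (fun t ht => hcov t (Finset.mem_union_right _ ht))
  have hfR : Γ.g (f R) = b := by rw [hf0, hg0]
  have hne : ∀ k < R, f k ≠ i0 := fun k hk => by
    rw [← hf0]; exact hf k (by omega) R (by omega) (by omega)
  have hres : Rs.res ω = Psi (fun k => Λ.g (f k))
      (fmk (fmap (algebraMap K E).toAddMonoidHom (fa y)) 0) := by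
    have hdl : dLog E (algebraMap K E b) = 0 := by
      obtain ⟨k, rfl⟩ : ∃ k, e = k + 1 := ⟨e - 1, by omega⟩
      rw [← hβ, pow_succ, pow_mul]; exact dLog_pow_char _
    rw [Psi_succ, fa_mk, fb_mk, map_zero, mul_zero, add_zero, hyω, Psi_succ, map_add, Rs.res_mul,
      res_dLog, hfR, hdl, zero_mul, add_zero]
    exact res_Psi Rs (fun k hk => hΛ1 _ (hne k hk)) _
  obtain ⟨y1, z1, a1, a2, a3⟩ := Λ.lemE1 SE hf hyv (by rw [fb_mk])
    (hres.symm.trans (huv.trans heq))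
  rw [fa_mk] at a3
  obtain ⟨u0, hu0⟩ := descentE he X Γ i0 Λ hΛD hf0 hf a1 a2 a3
  rw [hXb, ← hfR] at hu0
  have h1 := back Γ SF hf n hu0
  have hfa : proj n (fa y) = fa y := by rw [← fa_proj, hy]
  rw [map_sub, map_sub, map_sub, map_sub, hfa, hfR, ← fmap_proj] at h1
  obtain ⟨η, hη, h2⟩ := sp_Psi (h := fun k => Γ.g (f k)) SF (proj_proj n u0)
  have h3 : SF.sp (Psi (fun k => Γ.g (f k)) (proj n u0)) - Psi (fun k => Γ.g (f k)) (proj n u0)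
      ∈ KK SF b e n := hRel_le_KK (mem_hRel_as SF (Psi_mem (proj_proj n u0)))
  have h4 : SF.d η ∈ KK SF b e n := hRel_le_KK (mem_hRel_d SF hη)
  rw [h2] at h3
  have h5 : Psi (fun k => Γ.g (f k)) (fa y) ∈ KK SF b e n := by
    convert sub_mem (add_mem h1 h3) h4 using 1
    abel
  have h6 : dLog K b * Psi (fun k => Γ.g (f k)) (fb y) ∈ KK SF b e n := by
    apply lemmaB hb0 he
    cases n with
    | zero =>
      have : fb y = 0 := by rw [← hy, fb_proj_zero]
      rw [this, map_zero]; exact zero_mem _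
    | succ n => exact Psi_mem (by rw [← fb_proj_succ, hy])
  rw [hyω, Psi_succ, hfR]
  exact add_mem h5 h6
end
end HK

/-- **Corollary 3.5 (35).** Let `b ∈ F∖F^p` and `E = F(b^{1/p^e})` be the simple purely
inseparable extension of exponent `e`. Then `H_p^{n+1}(E/F)` equals
`Σ_{t=0}^{e−1} Σ_{1 ≤ j ≤ p^t, gcd(j,p)=1}` (image of `b^j·(dΩ_F^{n-1})^{[p^t]}`). -/
theorem hKernel_simple_purely_inseparable
    (p : ℕ) (hp : p.Prime) (F E : Type*) [Field F] [Field E] [Algebra F E]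
    [CharP F p] [CharP E p]
    (SF : DiffStr p F) (SE : DiffStr p E) (R : DiffRes p F E SF SE)
    (b : F) (hb : ¬ ∃ y : F, y ^ p = b) (e : ℕ) (he : 0 < e)
    (β : E) (hβ : β ^ p ^ e = algebraMap F E b)
    (hgen : Algebra.adjoin F {β} = ⊤)
    (n : ℕ) (ω : DF F) (hω : ω ∈ omegaPow F n) :
    R.res ω ∈ hRel SE n ↔ ω ∈ AddSubgroup.closure ((hRel SF n : Set (DF F)) ∪
      { x | ∃ t j : ℕ, t < e ∧ 1 ≤ j ∧ j ≤ p ^ t ∧ Nat.Coprime j p ∧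
          ∃ v ∈ omegaPred F n, x = b ^ j • spIter SF t (SF.d v) }) := by
  haveI : Fact p.Prime := ⟨hp⟩
  exact ⟨fun h => HK.hard R hb he hβ hgen hω h, fun h => HK.easy R hβ h⟩
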